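/- Let N be the dimension of ℙ(H_d), 𝒟 = d_1⋯d_n, and D = max_i d_i. For every t ≥ N(4n𝒟² + 1), the probability, for g uniformly distributed in ℙ(H_d), that κ̃(g) ≥ t, is at most 13·n²·D·𝒟·N / t. -/

import Mathlib

open MvPolynomial Finset ENNReal

/-- Bombieri–Weyl inner product of two polynomials (intended for homogeneous
polynomials of the same degree `d`): `⟨Σ aⱼ xʲ, Σ bⱼ xʲ⟩_W = Σ aⱼ bⱼ / binom(d, j)`
where `binom(d, j) = d! / (j₀! ⋯ jₙ!)`. -/
noncomputable def bwInner {m : ℕ} (p q : MvPolynomial (Fin m) ℝ) : ℝ :=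
  ∑ j ∈ p.support ∪ q.support,
    (p.coeff j * q.coeff j) / (Nat.multinomial Finset.univ j : ℝ)

/-- Bombieri–Weyl norm of one polynomial. -/
noncomputable def bwNorm {m : ℕ} (p : MvPolynomial (Fin m) ℝ) : ℝ :=
  Real.sqrt (bwInner p p)

/-- Bombieri–Weyl norm `‖f‖_W` of a system `f = (f_1, …, f_n)`. -/
noncomputable def bwNormSys {n : ℕ} (f : Fin n → MvPolynomial (Fin (n + 1)) ℝ) : ℝ :=
  Real.sqrt (∑ i, bwInner (f i) (f i))

/-- Distance (w.r.t. the Bombieri–Weyl norm) from a system `f` to a set `S` of systems. -/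
noncomputable def bwDist {n : ℕ} (f : Fin n → MvPolynomial (Fin (n + 1)) ℝ)
    (S : Set (Fin n → MvPolynomial (Fin (n + 1)) ℝ)) : ℝ :=
  sInf ((fun g => bwNormSys (f - g)) '' S)

/-- The unit sphere `Sⁿ ⊆ ℝ^{n+1}`. -/
def unitSphere (n : ℕ) : Set (Fin (n + 1) → ℝ) := {x | ∑ k, x k ^ 2 = 1}

/-- `f` belongs to `H_d`: each component is homogeneous of degree `d i`. -/
def IsSystem {n : ℕ} (d : Fin n → ℕ) (f : Fin n → MvPolynomial (Fin (n + 1)) ℝ) : Prop :=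
  ∀ i, (f i).IsHomogeneous (d i)

/-- The derivative `Df(x)` restricted to the tangent space `T_x Sⁿ = x^⊥` is singular,
i.e. it kills some nonzero tangent vector `v`. -/
def SingularAt {n : ℕ} (f : Fin n → MvPolynomial (Fin (n + 1)) ℝ)
    (x : Fin (n + 1) → ℝ) : Prop :=
  ∃ v : Fin (n + 1) → ℝ, v ≠ 0 ∧ (∑ k, v k * x k = 0) ∧
    ∀ i, ∑ k, MvPolynomial.eval x (MvPolynomial.pderiv k (f i)) * v k = 0

/-- `Σ_ℝ(x)`: the systems in `H_d` having `x` as a multiple zero. -/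
def SigmaRx {n : ℕ} (d : Fin n → ℕ) (x : Fin (n + 1) → ℝ) :
    Set (Fin n → MvPolynomial (Fin (n + 1)) ℝ) :=
  {g | IsSystem d g ∧ (∀ i, MvPolynomial.eval x (g i) = 0) ∧ SingularAt g x}

/-- `Σ_ℝ = ⋃_{x ∈ Sⁿ} Σ_ℝ(x)`: the systems in `H_d` with a multiple zero on `Sⁿ`. -/
def SigmaR {n : ℕ} (d : Fin n → ℕ) : Set (Fin n → MvPolynomial (Fin (n + 1)) ℝ) :=
  ⋃ x ∈ unitSphere n, SigmaRx d x

/-- The smallest singular value of `diag(1/√dᵢ) · Df(x)|_{T_x Sⁿ}`, i.e.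
`inf {‖diag(1/√dᵢ)·Df(x) v‖₂ : v ⊥ x, ‖v‖₂ = 1}`.  This equals
`‖f‖_W · μ̃_norm(f,x)⁻¹`, where `μ̃_norm(f,x) = ‖f‖_W ‖(Df(x)|_{T_x Sⁿ})⁻¹ diag(√dᵢ)‖`
(spectral norm, `+∞` when `Df(x)|_{T_x Sⁿ}` is singular); it is `0` exactly
when `μ̃_norm(f,x) = +∞`. -/
noncomputable def sigmaMin {n : ℕ} (d : Fin n → ℕ)
    (f : Fin n → MvPolynomial (Fin (n + 1)) ℝ) (x : Fin (n + 1) → ℝ) : ℝ :=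
  sInf ((fun v => Real.sqrt (∑ i,
      ((∑ k, MvPolynomial.eval x (MvPolynomial.pderiv k (f i)) * v k) / Real.sqrt (d i)) ^ 2)) ''
    {v : Fin (n + 1) → ℝ | (∑ k, v k * x k = 0) ∧ ∑ k, v k ^ 2 = 1})

/-- `κ̃(f, x) = ‖f‖_W / (‖f‖_W² μ̃_norm(f,x)⁻² + ‖f(x)‖₂²)^{1/2}` as an extended
nonnegative real (value `+∞` when `f` has `x` as multiple zero), using
`‖f‖_W² μ̃_norm(f,x)⁻² = (sigmaMin d f x)²`. -/
noncomputable def kappaAt {n : ℕ} (d : Fin n → ℕ)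
    (f : Fin n → MvPolynomial (Fin (n + 1)) ℝ) (x : Fin (n + 1) → ℝ) : ℝ≥0∞ :=
  ENNReal.ofReal (bwNormSys f) /
    ENNReal.ofReal (Real.sqrt (sigmaMin d f x ^ 2 + ∑ i, (MvPolynomial.eval x (f i)) ^ 2))

/-- `κ̃(f) = max_{x ∈ Sⁿ} κ̃(f, x)`. -/
noncomputable def kappa {n : ℕ} (d : Fin n → ℕ)
    (f : Fin n → MvPolynomial (Fin (n + 1)) ℝ) : ℝ≥0∞ :=
  ⨆ x ∈ unitSphere n, kappaAt d f x


open MeasureTheory Metric RealInnerProductSpace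

section GaussianBasics
open ProbabilityTheory

/-- The standard Gaussian measure on `ℝⁿ`, in coordinates. -/
noncomputable abbrev gaussPi (n : ℕ) : Measure (Fin n → ℝ) :=
  Measure.pi fun _ => gaussianReal 0 1

/-- The maximum of the standard Gaussian density on `ℝ`. -/
noncomputable def gaussPeak : ℝ := (Real.sqrt (2 * Real.pi))⁻¹

lemma gaussPeak_pos : 0 < gaussPeak := by
  unfold gaussPeak
  have := Real.pi_pos
  positivity

lemma lintegral_pi_cons {X : Type*} [MeasurableSpace X] (μ : Measure X) [SigmaFinite μ] (n : ℕ)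
    (f : (Fin (n + 1) → X) → ℝ≥0∞) :
    ∫⁻ x, f x ∂(Measure.pi fun _ => μ) =
      ∫⁻ p, f (Fin.cons p.1 p.2) ∂(μ.prod (Measure.pi fun _ : Fin n => μ)) := by
  have h := measurePreserving_piFinSuccAbove (fun _ : Fin (n + 1) => μ) 0
  rw [← (h.symm _).lintegral_comp_emb (MeasurableEquiv.measurableEmbedding _)]
  refine lintegral_congr fun p => ?_
  congr 1
  simp [MeasurableEquiv.piFinSuccAbove, Fin.insertNthEquiv]

lemma lintegral_pi_cons_le {X : Type*} [MeasurableSpace X] (μ : Measure X) [SigmaFinite μ] (n : ℕ)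
    (f : (Fin (n + 1) → X) → ℝ≥0∞) :
    ∫⁻ x, f x ∂(Measure.pi fun _ => μ) ≤
      ∫⁻ a, ∫⁻ p, f (Fin.cons a p) ∂(Measure.pi fun _ : Fin n => μ) ∂μ := by
  rw [lintegral_pi_cons]
  exact lintegral_prod_le _

lemma lintegral_pi_cons_le' {X : Type*} [MeasurableSpace X] (μ : Measure X) [SigmaFinite μ] (n : ℕ)
    (f : (Fin (n + 1) → X) → ℝ≥0∞) :
    ∫⁻ x, f x ∂(Measure.pi fun _ => μ) ≤
      ∫⁻ p, ∫⁻ a, f (Fin.cons a p) ∂μ ∂(Measure.pi fun _ : Fin n => μ) := by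
  rw [lintegral_pi_cons, ← lintegral_prod_swap]
  exact lintegral_prod_le _

lemma lintegral_pi_prod {X : Type*} [MeasurableSpace X] (μ : Measure X) [SigmaFinite μ] (n : ℕ)
    (f : Fin n → X → ℝ≥0∞) (hf : ∀ i, Measurable (f i)) :
    ∫⁻ x, ∏ i, f i (x i) ∂(Measure.pi fun _ => μ) = ∏ i, ∫⁻ x, f i x ∂μ := by
  induction n with
  | zero => simp
  | succ n ih =>
    rw [lintegral_pi_cons]
    simp only [Fin.prod_univ_succ, Fin.cons_zero, Fin.cons_succ]
    have hm : Measurable fun x : Fin n → X => ∏ i, f (Fin.succ i) (x i) :=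
      Finset.measurable_fun_prod _ fun i _ => (hf (Fin.succ i)).comp (measurable_pi_apply i)
    rw [lintegral_prod_mul (g := fun x : Fin n → X => ∏ i, f (Fin.succ i) (x i))
      (hf 0).aemeasurable hm.aemeasurable, ih _ fun i => hf i.succ]

lemma gaussPi_eq_withDensity (n : ℕ) :
    gaussPi n = (volume : Measure (Fin n → ℝ)).withDensity
      fun x => ∏ i, gaussianPDF 0 1 (x i) := by
  refine Measure.pi_eq fun s hs => ?_
  rw [withDensity_apply _ (MeasurableSet.univ_pi hs), ← lintegral_indicator (MeasurableSet.univ_pi hs)]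
  have : ∀ x : Fin n → ℝ, (Set.univ.pi s).indicator (fun x => ∏ i, gaussianPDF 0 1 (x i)) x =
      ∏ i, (s i).indicator (gaussianPDF 0 1) (x i) := by
    intro x
    by_cases hx : x ∈ Set.univ.pi s
    · rw [Set.indicator_of_mem hx]
      exact Finset.prod_congr rfl fun i _ => (Set.indicator_of_mem (hx i trivial) _).symm
    · rw [Set.indicator_of_notMem hx]
      simp only [Set.mem_pi, Set.mem_univ, true_implies, not_forall] at hx
      obtain ⟨i, hi⟩ := hx
      exact (Finset.prod_eq_zero (Finset.mem_univ i) (Set.indicator_of_notMem hi _)).symm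
  simp_rw [this]
  rw [volume_pi, lintegral_pi_prod _ _ _ fun i => (measurable_gaussianPDF 0 1).indicator (hs i)]
  refine Finset.prod_congr rfl fun i _ => ?_
  rw [lintegral_indicator (hs i), gaussianReal_of_var_ne_zero _ one_ne_zero,
    withDensity_apply _ (hs i)]

lemma gaussianPDF_std (x : ℝ) :
    gaussianPDF 0 1 x = ENNReal.ofReal (gaussPeak * Real.exp (-(x ^ 2) / 2)) := by
  simp [gaussianPDF, gaussianPDFReal, gaussPeak]

lemma prod_gaussianPDF (n : ℕ) (x : Fin n → ℝ) :
    ∏ i, gaussianPDF 0 1 (x i) =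
      ENNReal.ofReal (gaussPeak ^ n * Real.exp (-(∑ i, x i ^ 2) / 2)) := by
  simp_rw [gaussianPDF_std]
  rw [← ENNReal.ofReal_prod_of_nonneg fun i _ => by have := gaussPeak_pos; positivity]
  congr 1
  rw [Finset.prod_mul_distrib, ← Real.exp_sum]
  simp only [neg_div, Finset.sum_neg_distrib, Finset.sum_div, Finset.prod_const, Finset.card_univ,
    Fintype.card_fin]

lemma gaussPi_le (n : ℕ) (A : Set (Fin n → ℝ)) :
    gaussPi n A ≤ ENNReal.ofReal (gaussPeak ^ n) * volume A := by
  have h : gaussPi n ≤ ENNReal.ofReal (gaussPeak ^ n) • (volume : Measure (Fin n → ℝ)) := by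
    rw [gaussPi_eq_withDensity, ← withDensity_const]
    refine withDensity_mono (Filter.Eventually.of_forall fun x => ?_)
    simp only [prod_gaussianPDF]
    refine ENNReal.ofReal_le_ofReal ?_
    have : Real.exp (-(∑ i, x i ^ 2) / 2) ≤ 1 := by
      rw [Real.exp_le_one_iff]
      have : 0 ≤ ∑ i, x i ^ 2 := by positivity
      linarith
    have := gaussPeak_pos
    exact mul_le_of_le_one_right (by positivity) ‹_›
  simpa using h A

lemma le_gaussPi (n : ℕ) (A : Set (Fin n → ℝ)) (hA : MeasurableSet A) (r : ℝ)
    (hr : ∀ x ∈ A, ∑ i, x i ^ 2 ≤ r) :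
    ENNReal.ofReal (gaussPeak ^ n * Real.exp (-r / 2)) * volume A ≤ gaussPi n A := by
  rw [gaussPi_eq_withDensity, withDensity_apply _ hA, ← setLIntegral_const]
  refine setLIntegral_mono' hA fun x hx => ?_
  rw [prod_gaussianPDF]
  refine ENNReal.ofReal_le_ofReal ?_
  have := gaussPeak_pos
  have := hr x hx
  gcongr

lemma gaussianReal_Icc_le (m : ℝ) :
    gaussianReal 0 1 {x | |x| ≤ m} ≤ ENNReal.ofReal (2 * gaussPeak * m) := by
  rw [gaussianReal_of_var_ne_zero _ one_ne_zero]
  have hs : {x : ℝ | |x| ≤ m} = Set.Icc (-m) m := by ext x; simp [abs_le]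
  rw [hs, withDensity_apply _ measurableSet_Icc]
  calc ∫⁻ x in Set.Icc (-m) m, gaussianPDF 0 1 x
      ≤ ∫⁻ x in Set.Icc (-m) m, ENNReal.ofReal gaussPeak := by
        refine lintegral_mono fun x => ?_
        rw [gaussianPDF_std]
        refine ENNReal.ofReal_le_ofReal (mul_le_of_le_one_right gaussPeak_pos.le ?_)
        rw [Real.exp_le_one_iff]
        nlinarith [sq_nonneg x]
    _ = ENNReal.ofReal (2 * gaussPeak * m) := by
        rw [setLIntegral_const, Real.volume_Icc, ← ENNReal.ofReal_mul gaussPeak_pos.le]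
        congr 1; ring

lemma lintegral_sq_gaussianReal :
    ∫⁻ x, ENNReal.ofReal (x ^ 2) ∂(gaussianReal 0 1) = 1 := by
  have h := variance_id_gaussianReal (μ := 0) (v := 1)
  rw [variance_eq_integral (by fun_prop)] at h
  simp only [id, integral_id_gaussianReal, sub_zero] at h
  rw [← ofReal_integral_eq_lintegral_ofReal]
  · rw [h]; simp
  · exact (IsGaussian.memLp_two_id (μ := gaussianReal 0 1)).integrable_sq
  · exact Filter.Eventually.of_forall fun x => sq_nonneg x

lemma stdGaussian_map_coord {E : Type*} [NormedAddCommGroup E] [InnerProductSpace ℝ E]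
    [FiniteDimensional ℝ E] [MeasurableSpace E] [BorelSpace E] {ι : Type*} [Fintype ι] (e : ι → E)
    (he : Orthonormal ℝ e) :
    (stdGaussian E).map (fun f i => ⟪f, e i⟫) =
      Measure.pi fun _ => gaussianReal 0 1 := by
  let L : E →L[ℝ] EuclideanSpace ℝ (ι) :=
    (EuclideanSpace.equiv (ι) ℝ).symm.toContinuousLinearMap.comp
      (ContinuousLinearMap.pi fun i => innerSL ℝ (e i))
  have h1 : (stdGaussian E).map L = stdGaussian (EuclideanSpace ℝ (ι)) := by
    have : IsProbabilityMeasure ((stdGaussian E).map L) :=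
      Measure.isProbabilityMeasure_map L.continuous.measurable.aemeasurable
    refine Measure.ext_of_charFunDual ?_
    ext M
    rw [charFunDual_map, charFunDual_stdGaussian, charFunDual_stdGaussian]
    congr 3
    congr 1
    set y := (InnerProductSpace.toDual ℝ (EuclideanSpace ℝ (ι))).symm M
    have hM : M = InnerProductSpace.toDual ℝ _ y := by simp [y]
    have hML : M ∘SL L = InnerProductSpace.toDual ℝ _ (∑ i, y i • e i) := by
      ext f
      simp [hM, L, PiLp.inner_apply, mul_comm]
    rw [hML, hM, LinearIsometryEquiv.norm_map, LinearIsometryEquiv.norm_map]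
    have h3 : ‖∑ i, y i • e i‖ ^ 2 = ‖y‖ ^ 2 := by
      rw [← real_inner_self_eq_norm_sq, he.inner_sum, EuclideanSpace.norm_sq_eq]
      simp [sq]
    have := (sq_eq_sq₀ (norm_nonneg _) (norm_nonneg _)).1 h3
    exact_mod_cast this
  have h2 := map_pi_eq_stdGaussian (ι := ι)
  have h4 := congrArg (Measure.map (WithLp.ofLp (p := 2))) (h1.trans h2.symm)
  rw [Measure.map_map (by fun_prop) L.continuous.measurable,
    Measure.map_map (by fun_prop) (by fun_prop)] at h4
  have h5 : (WithLp.ofLp : EuclideanSpace ℝ (ι) → _) ∘ (WithLp.toLp 2) = id := rfl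
  rw [h5, Measure.map_id] at h4
  refine Eq.trans ?_ h4
  congr 1
  ext f i
  simp [L, real_inner_comm]

lemma measurePreserving_gaussPi_mulVec {n : ℕ} (U : Matrix (Fin n) (Fin n) ℝ)
    (hU : U * U.transpose = 1) :
    MeasurePreserving (fun x => U.mulVec x) (gaussPi n) (gaussPi n) := by
  have hm : Measurable (fun x : Fin n → ℝ => U.mulVec x) := by
    have : Continuous (fun x : Fin n → ℝ => U.mulVec x) := by fun_prop
    exact this.measurable
  refine ⟨hm, ?_⟩
  have he : Orthonormal ℝ (fun i => (WithLp.toLp 2 (U i) : EuclideanSpace ℝ (Fin n))) := by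
    rw [orthonormal_iff_ite]
    intro i j
    have := congrFun (congrFun hU i) j
    rw [Matrix.mul_apply, Matrix.one_apply] at this
    rw [← this]
    simp [PiLp.inner_apply, mul_comm]
  have h1 := stdGaussian_map_coord _ he
  rw [← map_pi_eq_stdGaussian, Measure.map_map (by fun_prop) (by fun_prop)] at h1
  refine Eq.trans ?_ h1
  congr 1
end GaussianBasics

section GaussianDeterminants
open ProbabilityTheory

lemma Matrix.PosSemidef.exists_orthogonal_diagonal {n : ℕ} {H : Matrix (Fin n) (Fin n) ℝ}
    (hH : H.PosSemidef) : ∃ (U : Matrix (Fin n) (Fin n) ℝ) (μ : Fin n → ℝ),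
      U * U.transpose = 1 ∧ U.transpose * U = 1 ∧ (∀ i, 0 ≤ μ i) ∧
      H = U * Matrix.diagonal μ * U.transpose := by
  refine ⟨hH.1.eigenvectorUnitary, hH.1.eigenvalues, ?_, ?_, hH.eigenvalues_nonneg, ?_⟩
  · have := Unitary.coe_mul_star_self hH.1.eigenvectorUnitary
    simpa [Matrix.star_eq_conjTranspose] using this
  · have := Unitary.coe_star_mul_self hH.1.eigenvectorUnitary
    simpa [Matrix.star_eq_conjTranspose] using this
  · have := hH.1.spectral_theorem
    rw [Unitary.conjStarAlgAut_apply] at this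
    simpa [Matrix.star_eq_conjTranspose] using this

lemma Matrix.det_diagonal_add_vecMulVec {n : ℕ} (a b : Fin n → ℝ) (ha : ∀ i, a i ≠ 0) :
    (Matrix.diagonal a + Matrix.vecMulVec b b).det =
      ∏ i, a i + ∑ j, b j ^ 2 * ∏ i ∈ Finset.univ.erase j, a i := by
  have h1 : Matrix.diagonal a + Matrix.vecMulVec b b =
      Matrix.diagonal a * (1 + Matrix.replicateCol Unit (fun i => b i / a i) *
        Matrix.replicateRow Unit b) := by
    ext i j
    rw [Matrix.diagonal_mul, Matrix.add_apply, Matrix.add_apply, Matrix.vecMulVec_apply,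
      Matrix.mul_apply]
    simp only [Matrix.diagonal_apply, Matrix.one_apply, Matrix.replicateCol_apply,
      Matrix.replicateRow_apply, Finset.univ_unique, Finset.sum_singleton]
    have := ha i
    split_ifs
    · field_simp
    · field_simp
      ring
  rw [h1, Matrix.det_mul, Matrix.det_one_add_replicateCol_mul_replicateRow, Matrix.det_diagonal,
    mul_add, mul_one, dotProduct, Finset.mul_sum]
  congr 1
  refine Finset.sum_congr rfl fun j _ => ?_
  rw [← Finset.mul_prod_erase _ _ (Finset.mem_univ j)]
  have := ha j
  field_simp

lemma det_smul_one_add_conj {n : ℕ} (U : Matrix (Fin n) (Fin n) ℝ) (μ b : Fin n → ℝ) (c : ℝ)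
    (h1 : U * U.transpose = 1) (hc : ∀ i, c + μ i ≠ 0) :
    (c • 1 + (U * Matrix.diagonal μ * U.transpose + Matrix.vecMulVec b b)).det =
      ∏ i, (c + μ i) +
        ∑ j, (U.transpose.mulVec b) j ^ 2 * ∏ i ∈ Finset.univ.erase j, (c + μ i) := by
  rw [← Matrix.det_diagonal_add_vecMulVec _ _ hc]
  have h3 : (c • 1 + (U * Matrix.diagonal μ * U.transpose + Matrix.vecMulVec b b)) =
      U * (Matrix.diagonal (fun i => c + μ i) +
        Matrix.vecMulVec (U.transpose.mulVec b) (U.transpose.mulVec b)) * U.transpose := by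
    have h4 : Matrix.diagonal (fun i => c + μ i) = c • 1 + Matrix.diagonal μ := by
      ext i j
      simp only [Matrix.diagonal_apply, Matrix.add_apply, Matrix.smul_apply, Matrix.one_apply]
      split_ifs <;> simp
    have h5 : U * Matrix.vecMulVec (U.transpose.mulVec b) (U.transpose.mulVec b) * U.transpose =
        Matrix.vecMulVec b b := by
      rw [Matrix.mul_vecMulVec, Matrix.vecMulVec_mul, Matrix.mulVec_mulVec, h1, Matrix.one_mulVec,
        ← Matrix.mulVec_transpose, Matrix.transpose_transpose, Matrix.mulVec_mulVec, h1,
        Matrix.one_mulVec]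
    rw [h4, Matrix.mul_add, Matrix.add_mul, h5, Matrix.mul_add, Matrix.add_mul, Matrix.mul_smul,
      Matrix.mul_one, Matrix.smul_mul, h1, add_assoc]
  rw [h3, Matrix.det_mul, Matrix.det_mul]
  have h6 : U.det * U.transpose.det = 1 := by rw [← Matrix.det_mul, h1, Matrix.det_one]
  calc _ = (U.det * U.transpose.det) * (Matrix.diagonal (fun i => c + μ i) +
        Matrix.vecMulVec (U.transpose.mulVec b) (U.transpose.mulVec b)).det := by ring
    _ = _ := by rw [h6, one_mul]

/-- The polynomial `det (X + H)`. -/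
noncomputable def shiftPoly {n : ℕ} (H : Matrix (Fin n) (Fin n) ℝ) : Polynomial ℝ :=
  (-H).charpoly

lemma eval_shiftPoly {n : ℕ} (H : Matrix (Fin n) (Fin n) ℝ) (c : ℝ) :
    (shiftPoly H).eval c = (c • 1 + H).det := by
  rw [shiftPoly, Matrix.eval_charpoly, sub_neg_eq_add, Matrix.smul_one_eq_diagonal]
  rfl

lemma Polynomial.eq_of_eval_pos {P Q : Polynomial ℝ} (h : ∀ c, 0 < c → P.eval c = Q.eval c) :
    P = Q :=
  Polynomial.eq_of_infinite_eval_eq P Q <| (Set.Ioi_infinite (0 : ℝ)).mono fun c hc => h c hc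

lemma shiftPoly_conj_add {n : ℕ} (U : Matrix (Fin n) (Fin n) ℝ) (μ b : Fin n → ℝ)
    (h1 : U * U.transpose = 1) (hμ : ∀ i, 0 ≤ μ i) :
    shiftPoly (U * Matrix.diagonal μ * U.transpose + Matrix.vecMulVec b b) =
      ∏ i, (Polynomial.X + Polynomial.C (μ i)) + ∑ j, ((U.transpose.mulVec b) j ^ 2) •
        ∏ i ∈ Finset.univ.erase j, (Polynomial.X + Polynomial.C (μ i)) := by
  refine Polynomial.eq_of_eval_pos fun c hc => ?_
  rw [eval_shiftPoly, det_smul_one_add_conj U μ b c h1 fun i => by have := hμ i; positivity]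
  simp [Polynomial.eval_prod, Polynomial.eval_finsetSum]

lemma shiftPoly_conj {n : ℕ} (U : Matrix (Fin n) (Fin n) ℝ) (μ : Fin n → ℝ)
    (h1 : U * U.transpose = 1) (hμ : ∀ i, 0 ≤ μ i) :
    shiftPoly (U * Matrix.diagonal μ * U.transpose) =
      ∏ i, (Polynomial.X + Polynomial.C (μ i)) := by
  have := shiftPoly_conj_add U μ 0 h1 hμ
  simpa using this

/-- A linear functional that is nonnegative on polynomials with nonnegative coefficients. -/
def CoeffPos (L : Polynomial ℝ →ₗ[ℝ] ℝ) : Prop :=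
  ∀ P : Polynomial ℝ, (∀ k, 0 ≤ P.coeff k) → 0 ≤ L P

lemma coeff_prod_X_add_C_nonneg {ι : Type*} (s : Finset ι) (μ : ι → ℝ) (hμ : ∀ i ∈ s, 0 ≤ μ i)
    (k : ℕ) : 0 ≤ (∏ i ∈ s, (Polynomial.X + Polynomial.C (μ i))).coeff k := by
  classical
  induction s using Finset.induction_on generalizing k with
  | empty => simp only [Finset.prod_empty, Polynomial.coeff_one]; split_ifs <;> norm_num
  | insert a s ha ih =>
    rw [Finset.prod_insert ha, add_mul, Polynomial.coeff_add, Polynomial.coeff_C_mul]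
    have h1 := ih (fun i hi => hμ i (Finset.mem_insert_of_mem hi))
    have h2 := hμ a (Finset.mem_insert_self _ _)
    have h3 : 0 ≤ (Polynomial.X * ∏ i ∈ s, (Polynomial.X + Polynomial.C (μ i))).coeff k := by
      cases k with
      | zero => simp
      | succ k => rw [Polynomial.coeff_X_mul]; exact h1 k
    have := h1 k
    positivity

/-- The operator `1 + d/dX`. -/
noncomputable def oneAddDeriv : Module.End ℝ (Polynomial ℝ) := 1 + Polynomial.derivative

lemma CoeffPos.comp_oneAddDeriv_pow {L : Polynomial ℝ →ₗ[ℝ] ℝ} (hL : CoeffPos L) (k : ℕ) :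
    CoeffPos (L ∘ₗ (oneAddDeriv ^ k)) := by
  induction k generalizing L with
  | zero => exact hL
  | succ k ih =>
    have h1 : CoeffPos (L ∘ₗ oneAddDeriv) := by
      intro P hP
      refine hL _ fun j => ?_
      simp only [oneAddDeriv, LinearMap.add_apply, Module.End.one_apply, Polynomial.coeff_add,
        Polynomial.coeff_derivative]
      have := hP j
      have := hP (j + 1)
      positivity
    have := ih h1
    rwa [LinearMap.comp_assoc, ← Module.End.mul_eq_comp, ← pow_succ'] at this

lemma derivative_prod_X_add_C {ι : Type*} [DecidableEq ι] (s : Finset ι) (μ : ι → ℝ) :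
    Polynomial.derivative (∏ i ∈ s, (Polynomial.X + Polynomial.C (μ i))) =
      ∑ j ∈ s, ∏ i ∈ s.erase j, (Polynomial.X + Polynomial.C (μ i)) := by
  rw [Polynomial.derivative_prod_finset]
  simp

lemma lintegral_shiftPoly_rankOne {n : ℕ} {H : Matrix (Fin n) (Fin n) ℝ} (hH : H.PosSemidef)
    {L : Polynomial ℝ →ₗ[ℝ] ℝ} (hL : CoeffPos L) :
    ∫⁻ b, ENNReal.ofReal (L (shiftPoly (H + Matrix.vecMulVec b b))) ∂gaussPi n =
      ENNReal.ofReal (L (oneAddDeriv (shiftPoly H))) := by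
  obtain ⟨U, μ, h1, h2, hμ, rfl⟩ := hH.exists_orthogonal_diagonal
  have hQ : ∀ j, 0 ≤ L (∏ i ∈ Finset.univ.erase j, (Polynomial.X + Polynomial.C (μ i))) :=
    fun j => hL _ fun k => coeff_prod_X_add_C_nonneg _ _ (fun i _ => hμ i) k
  have hP : 0 ≤ L (∏ i, (Polynomial.X + Polynomial.C (μ i))) :=
    hL _ fun k => coeff_prod_X_add_C_nonneg _ _ (fun i _ => hμ i) k
  have hmp := measurePreserving_gaussPi_mulVec U.transpose (by rwa [Matrix.transpose_transpose])
  have hev : ∀ j : Fin n, ∫⁻ b, ENNReal.ofReal ((U.transpose.mulVec b) j ^ 2) ∂gaussPi n = 1 := by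
    intro j
    have h3 := (measurePreserving_eval (fun _ : Fin n => gaussianReal 0 1) j).comp hmp
    rw [← lintegral_sq_gaussianReal, ← h3.lintegral_comp (by fun_prop)]
    rfl
  simp_rw [shiftPoly_conj_add U μ _ h1 hμ, map_add, map_sum, map_smul, smul_eq_mul]
  have h4 : ∀ b : Fin n → ℝ, ENNReal.ofReal (L (∏ i, (Polynomial.X + Polynomial.C (μ i))) +
      ∑ j, (U.transpose.mulVec b) j ^ 2 *
        L (∏ i ∈ Finset.univ.erase j, (Polynomial.X + Polynomial.C (μ i)))) =
      ENNReal.ofReal (L (∏ i, (Polynomial.X + Polynomial.C (μ i)))) +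
      ∑ j, ENNReal.ofReal ((U.transpose.mulVec b) j ^ 2) *
        ENNReal.ofReal (L (∏ i ∈ Finset.univ.erase j, (Polynomial.X + Polynomial.C (μ i)))) := by
    intro b
    rw [ENNReal.ofReal_add hP (Finset.sum_nonneg fun j _ => mul_nonneg (sq_nonneg _) (hQ j)),
      ENNReal.ofReal_sum_of_nonneg fun j _ => mul_nonneg (sq_nonneg _) (hQ j)]
    simp_rw [ENNReal.ofReal_mul (sq_nonneg _)]
  have hmeas : ∀ j : Fin n, Measurable fun b : Fin n → ℝ =>
      ENNReal.ofReal ((U.transpose.mulVec b) j ^ 2) := fun j =>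
    ENNReal.measurable_ofReal.comp (((measurable_pi_apply j).comp hmp.measurable).pow_const 2)
  simp_rw [h4]
  rw [lintegral_add_left measurable_const, lintegral_finsetSum _ fun j _ =>
    (hmeas j).mul_const _]
  simp_rw [lintegral_mul_const _ (hmeas _), hev, one_mul]
  rw [shiftPoly_conj U μ h1 hμ, oneAddDeriv, LinearMap.add_apply, Module.End.one_apply,
    derivative_prod_X_add_C, map_add, map_sum,
    ENNReal.ofReal_add hP (Finset.sum_nonneg fun j _ => hQ j),
    ENNReal.ofReal_sum_of_nonneg fun j _ => hQ j]
  simp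

lemma posSemidef_vecMulVec_self {n : ℕ} (b : Fin n → ℝ) :
    (Matrix.vecMulVec b b).PosSemidef := by
  simpa using Matrix.posSemidef_vecMulVec_self_star b

lemma lintegral_shiftPoly_sum_le {n : ℕ} (k : ℕ) {H : Matrix (Fin n) (Fin n) ℝ}
    (hH : H.PosSemidef) {L : Polynomial ℝ →ₗ[ℝ] ℝ} (hL : CoeffPos L) :
    ∫⁻ B : Fin k → Fin n → ℝ,
        ENNReal.ofReal (L (shiftPoly (H + ∑ j, Matrix.vecMulVec (B j) (B j))))
        ∂(Measure.pi fun _ => gaussPi n) ≤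
      ENNReal.ofReal (L ((oneAddDeriv ^ k) (shiftPoly H))) := by
  induction k generalizing H with
  | zero => simp
  | succ k ih =>
    refine (lintegral_pi_cons_le _ _ _).trans ?_
    simp only [Fin.sum_univ_succ, Fin.cons_zero, Fin.cons_succ, ← add_assoc]
    refine (lintegral_mono fun a => ih (hH.add (posSemidef_vecMulVec_self a))).trans ?_
    refine (lintegral_shiftPoly_rankOne hH (hL.comp_oneAddDeriv_pow k)).le.trans ?_
    rw [LinearMap.comp_apply, pow_succ]
    rfl
end GaussianDeterminants

section GaussianCorank
open ProbabilityTheory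

/-- The standard Gaussian measure of `[-m, m]`. -/
noncomputable def slabProb (m : ℝ) : ℝ≥0∞ := gaussianReal 0 1 {x | |x| ≤ m}

lemma measurableSet_slab (m : ℝ) : MeasurableSet {x : ℝ | |x| ≤ m} :=
  measurableSet_le (by fun_prop) measurable_const

lemma lintegral_slab {n : ℕ} (j₀ : Fin n) (m : ℝ) (K₀ : ℝ≥0∞) (K : Fin n → ℝ≥0∞) :
    ∫⁻ β, ({x : ℝ | |x| ≤ m}.indicator 1 (β j₀)) *
        (K₀ + ∑ j ∈ Finset.univ.erase j₀, K j * ENNReal.ofReal (β j ^ 2)) ∂gaussPi n =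
      slabProb m * (K₀ + ∑ j ∈ Finset.univ.erase j₀, K j) := by
  have hI : Measurable ({x : ℝ | |x| ≤ m}.indicator (1 : ℝ → ℝ≥0∞)) :=
    measurable_one.indicator (measurableSet_slab m)
  have hI' : Measurable fun β : Fin n → ℝ => {x : ℝ | |x| ≤ m}.indicator (1 : ℝ → ℝ≥0∞) (β j₀) :=
    hI.comp (measurable_pi_apply j₀)
  have h0 : ∫⁻ β, {x : ℝ | |x| ≤ m}.indicator (1 : ℝ → ℝ≥0∞) (β j₀) ∂gaussPi n = slabProb m := by
    rw [(measurePreserving_eval (fun _ : Fin n => gaussianReal 0 1) j₀).lintegral_comp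
      (f := fun x => {x : ℝ | |x| ≤ m}.indicator 1 x) hI,
      lintegral_indicator_one (measurableSet_slab m)]
    rfl
  have h1 : ∀ j ∈ Finset.univ.erase j₀, ∫⁻ β, {x : ℝ | |x| ≤ m}.indicator (1 : ℝ → ℝ≥0∞) (β j₀) *
      (K j * ENNReal.ofReal (β j ^ 2)) ∂gaussPi n = slabProb m * K j := by
    intro j hj
    have hj' := Finset.ne_of_mem_erase hj
    have h2 := lintegral_pi_prod (gaussianReal 0 1) n
      (fun i x => if i = j₀ then {x : ℝ | |x| ≤ m}.indicator 1 x else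
        if i = j then ENNReal.ofReal (x ^ 2) else 1) (fun i => by
          split_ifs
          · exact hI
          · fun_prop
          · fun_prop)
    have h3 : ∀ f : Fin n → ℝ≥0∞, (∀ i, i ≠ j₀ → i ≠ j → f i = 1) → ∏ i, f i = f j₀ * f j := by
      intro f hf
      rw [← Finset.mul_prod_erase _ _ (Finset.mem_univ j₀), ← Finset.mul_prod_erase _ _ hj,
        Finset.prod_eq_one, mul_one]
      intro i hi
      exact hf i (Finset.ne_of_mem_erase (Finset.mem_of_mem_erase hi)) (Finset.ne_of_mem_erase hi)
    rw [h3 _ (by intro i hi hi'; simp [hi, hi'])] at h2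
    have h4 : ∀ β : Fin n → ℝ, (∏ i, if i = j₀ then {x : ℝ | |x| ≤ m}.indicator 1 (β i) else
        if i = j then ENNReal.ofReal (β i ^ 2) else 1) =
        {x : ℝ | |x| ≤ m}.indicator (1 : ℝ → ℝ≥0∞) (β j₀) * ENNReal.ofReal (β j ^ 2) := by
      intro β
      rw [h3 _ (by intro i hi hi'; simp [hi, hi'])]
      simp [hj']
    simp_rw [h4] at h2
    have h5 : ∀ β : Fin n → ℝ, {x : ℝ | |x| ≤ m}.indicator (1 : ℝ → ℝ≥0∞) (β j₀) *
      (K j * ENNReal.ofReal (β j ^ 2)) = K j * ({x : ℝ | |x| ≤ m}.indicator (1 : ℝ → ℝ≥0∞) (β j₀) *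
        ENNReal.ofReal (β j ^ 2)) := fun β => by ring
    simp_rw [h5]
    rw [lintegral_const_mul _ (by fun_prop), h2]
    simp only [if_true, if_neg hj']
    rw [lintegral_sq_gaussianReal, lintegral_indicator_one (measurableSet_slab m), mul_one, mul_comm]
    rfl
  simp_rw [mul_add, Finset.mul_sum]
  rw [lintegral_add_left (hI'.mul_const _), lintegral_mul_const _ hI', h0,
    lintegral_finsetSum _ fun j _ => by fun_prop, Finset.sum_congr rfl h1]

/-- The functional whose value at `det (X + H)`, for `H` singular, bounds the conditional
expectation of `det (c + H + b bᵀ)` given that `b` has distance at most `m` to the range of `H`. -/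
noncomputable def corankFunctional (c m : ℝ) : Polynomial ℝ →ₗ[ℝ] ℝ where
  toFun P := (c + m ^ 2) * P.divX.eval c + c * (Polynomial.derivative P.divX).eval c
  map_add' P Q := by simp only [Polynomial.divX_add, map_add, Polynomial.eval_add]; ring
  map_smul' a P := by
    simp only [Polynomial.smul_eq_C_mul, Polynomial.divX_C_mul, Polynomial.derivative_C_mul,
      Polynomial.eval_mul, Polynomial.eval_C, RingHom.id_apply, smul_eq_mul]
    ring

lemma eval_nonneg_of_coeff_nonneg {P : Polynomial ℝ} (hP : ∀ k, 0 ≤ P.coeff k) {c : ℝ}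
    (hc : 0 ≤ c) : 0 ≤ P.eval c := by
  rw [Polynomial.eval_eq_sum_range]
  exact Finset.sum_nonneg fun k _ => mul_nonneg (hP k) (pow_nonneg hc k)

lemma corankFunctional_coeffPos {c m : ℝ} (hc : 0 ≤ c) : CoeffPos (corankFunctional c m) := by
  intro P hP
  have h1 : ∀ k, 0 ≤ P.divX.coeff k := fun k => by rw [Polynomial.coeff_divX]; exact hP _
  have h2 : ∀ k, 0 ≤ (Polynomial.derivative P.divX).coeff k := fun k => by
    rw [Polynomial.coeff_derivative]
    have := h1 (k + 1)
    positivity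
  have := eval_nonneg_of_coeff_nonneg h1 hc
  have := eval_nonneg_of_coeff_nonneg h2 hc
  simp only [corankFunctional, LinearMap.coe_mk, AddHom.coe_mk]
  positivity

lemma corankFunctional_X_mul (c m : ℝ) (R : Polynomial ℝ) :
    corankFunctional c m (Polynomial.X * R) =
      (c + m ^ 2) * R.eval c + c * (Polynomial.derivative R).eval c := by
  have : (Polynomial.X * R).divX = R := by
    ext k
    rw [Polynomial.coeff_divX, Polynomial.coeff_X_mul]
  simp [corankFunctional, this]

lemma exists_orthogonal_to_columns {p : ℕ} (B : Fin p → Fin (p + 1) → ℝ) :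
    ∃ y : Fin (p + 1) → ℝ, y ≠ 0 ∧ ∀ k, B k ⬝ᵥ y = 0 := by
  have h := LinearMap.ker_ne_bot_of_finrank_lt
    (f := Matrix.mulVecLin (Matrix.of B)) (by simp)
  obtain ⟨y, hy, hy0⟩ := Submodule.exists_mem_ne_zero_of_ne_bot h
  refine ⟨y, hy0, fun k => ?_⟩
  have := congrFun (LinearMap.mem_ker.1 hy) k
  simpa [Matrix.mulVec] using this

lemma sum_vecMulVec_mulVec {k n : ℕ} (B : Fin k → Fin n → ℝ) (y : Fin n → ℝ) :
    (∑ j, Matrix.vecMulVec (B j) (B j)).mulVec y = ∑ j, (B j ⬝ᵥ y) • B j := by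
  rw [Matrix.sum_mulVec]
  refine Finset.sum_congr rfl fun j _ => ?_
  ext i
  simp [Matrix.vecMulVec_mulVec, mul_comm]

lemma posSemidef_sum_vecMulVec {k n : ℕ} (B : Fin k → Fin n → ℝ) :
    (∑ j, Matrix.vecMulVec (B j) (B j)).PosSemidef :=
  Matrix.posSemidef_sum _ fun j _ => posSemidef_vecMulVec_self (B j)

lemma lintegral_sqrt_det_near_range_le {p : ℕ} (B : Fin p → Fin (p + 1) → ℝ) {c m lam : ℝ}
    (hc : 0 < c) (hm : 0 ≤ m) (hl : 0 < lam) :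
    ∫⁻ b, {b : Fin (p + 1) → ℝ | ∃ w : Fin p → ℝ, ∑ i, (b i + ∑ k, B k i * w k) ^ 2 ≤ m ^ 2}.indicator
        (fun b => ENNReal.ofReal (Real.sqrt (c • 1 +
          (∑ k, Matrix.vecMulVec (B k) (B k) + Matrix.vecMulVec b b)).det)) b ∂gaussPi (p + 1) ≤
      slabProb m * ENNReal.ofReal (lam / 2 * corankFunctional c m
        (shiftPoly (∑ k, Matrix.vecMulVec (B k) (B k))) + 1 / (2 * lam)) := by
  obtain ⟨U, μ, h1, h2, hμ, hH⟩ := (posSemidef_sum_vecMulVec B).exists_orthogonal_diagonal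
  have hdet : (∑ k, Matrix.vecMulVec (B k) (B k)).det = 0 := by
    obtain ⟨y, hy0, hy⟩ := exists_orthogonal_to_columns B
    refine Matrix.exists_mulVec_eq_zero_iff.1 ⟨y, hy0, ?_⟩
    rw [sum_vecMulVec_mulVec]
    simp [hy]
  obtain ⟨j₀, hj₀⟩ : ∃ j, μ j = 0 := by
    have h6 : U.det * U.transpose.det = 1 := by rw [← Matrix.det_mul, h1, Matrix.det_one]
    rw [hH, Matrix.det_mul, Matrix.det_mul, Matrix.det_diagonal] at hdet
    have : ∏ i, μ i = 0 := by
      calc ∏ i, μ i = (∏ i, μ i) * (U.det * U.transpose.det) := by rw [h6, mul_one]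
        _ = 0 := by rw [← hdet]; ring
    obtain ⟨j, -, hj⟩ := Finset.prod_eq_zero_iff.1 this
    exact ⟨j, hj⟩
  set om : Fin (p + 1) → ℝ := fun i => U i j₀ with hom
  have hBom : ∀ k, om ⬝ᵥ B k = 0 := by
    have h3 : (∑ k, Matrix.vecMulVec (B k) (B k)).mulVec om = 0 := by
      have : om = U.mulVec (Pi.single j₀ 1) := by ext i; simp [hom]
      rw [this, hH, Matrix.mulVec_mulVec, Matrix.mul_assoc, h2, Matrix.mul_one,
        ← Matrix.mulVec_mulVec, Matrix.diagonal_mulVec_single, hj₀]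
      simp
    have h4 : om ⬝ᵥ (∑ k, Matrix.vecMulVec (B k) (B k)).mulVec om = 0 := by rw [h3]; simp
    rw [sum_vecMulVec_mulVec, dotProduct_sum] at h4
    have h5 : ∀ k, om ⬝ᵥ (B k ⬝ᵥ om) • B k = (om ⬝ᵥ B k) ^ 2 := fun k => by
      rw [dotProduct_smul, dotProduct_comm (B k)]; simp [sq]
    simp_rw [h5] at h4
    intro k
    have := (Finset.sum_eq_zero_iff_of_nonneg fun i _ => sq_nonneg (om ⬝ᵥ B i)).1 h4 k
      (Finset.mem_univ k)
    exact pow_eq_zero_iff two_ne_zero |>.1 this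
  have homsq : ∑ i, om i ^ 2 = 1 := by
    have := congrFun (congrFun h2 j₀) j₀
    rw [Matrix.mul_apply, Matrix.one_apply_eq] at this
    simpa [sq, hom] using this
  have hmp := measurePreserving_gaussPi_mulVec U.transpose (by rwa [Matrix.transpose_transpose])
  set R := ∏ i ∈ Finset.univ.erase j₀, (Polynomial.X + Polynomial.C (μ i)) with hR
  set Rj : Fin (p + 1) → ℝ := fun j => ∏ i ∈ (Finset.univ.erase j₀).erase j, (c + μ i) with hRj
  have hRjnn : ∀ j, 0 ≤ Rj j := fun j => Finset.prod_nonneg fun i _ => by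
    have := hμ i; positivity
  have hRev : R.eval c = ∏ i ∈ Finset.univ.erase j₀, (c + μ i) := by
    simp [hR, Polynomial.eval_prod]
  have hRnn : 0 ≤ R.eval c := by
    rw [hRev]; exact Finset.prod_nonneg fun i _ => by have := hμ i; positivity
  have hR' : (Polynomial.derivative R).eval c = ∑ j ∈ Finset.univ.erase j₀, Rj j := by
    rw [hR, derivative_prod_X_add_C, Polynomial.eval_finsetSum]
    simp [Polynomial.eval_prod, hRj]
  have hshift : corankFunctional c m (shiftPoly (∑ k, Matrix.vecMulVec (B k) (B k))) =
      (c + m ^ 2) * R.eval c + c * ∑ j ∈ Finset.univ.erase j₀, Rj j := by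
    rw [hH, shiftPoly_conj U μ h1 hμ, ← Finset.mul_prod_erase _ _ (Finset.mem_univ j₀), hj₀,
      Polynomial.C_0, add_zero, corankFunctional_X_mul, hR']
  have hdetb : ∀ b, (c • 1 + (∑ k, Matrix.vecMulVec (B k) (B k) + Matrix.vecMulVec b b)).det =
      c * R.eval c + (U.transpose.mulVec b) j₀ ^ 2 * R.eval c +
        ∑ j ∈ Finset.univ.erase j₀, (U.transpose.mulVec b) j ^ 2 * (c * Rj j) := by
    intro b
    rw [hH, det_smul_one_add_conj U μ b c h1 fun i => by have := hμ i; positivity,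
      ← Finset.mul_prod_erase _ _ (Finset.mem_univ j₀), hj₀, add_zero,
      ← Finset.add_sum_erase _ _ (Finset.mem_univ j₀), hRev, add_assoc]
    congr 2
    refine Finset.sum_congr rfl fun j hj => ?_
    rw [← Finset.mul_prod_erase (Finset.univ.erase j) _ (a := j₀)
      (Finset.mem_erase.2 ⟨(Finset.ne_of_mem_erase hj).symm, Finset.mem_univ _⟩), hj₀, add_zero,
      Finset.erase_right_comm]
  set K₀ := ENNReal.ofReal (lam / 2 * ((c + m ^ 2) * R.eval c) + 1 / (2 * lam)) with hK₀
  set K : Fin (p + 1) → ℝ≥0∞ := fun j => ENNReal.ofReal (lam / 2 * (c * Rj j)) with hK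
  set F : (Fin (p + 1) → ℝ) → ℝ≥0∞ := fun β => ({x : ℝ | |x| ≤ m}.indicator 1 (β j₀)) *
        (K₀ + ∑ j ∈ Finset.univ.erase j₀, K j * ENNReal.ofReal (β j ^ 2)) with hF
  have hFm : Measurable F := by
    refine Measurable.mul ?_ (by fun_prop)
    exact (measurable_one.indicator (measurableSet_slab m)).comp (measurable_pi_apply j₀)
  calc _ ≤ ∫⁻ b, F (U.transpose.mulVec b) ∂gaussPi (p + 1) := by
        refine lintegral_mono fun b => ?_
        by_cases hcond : b ∈ {b : Fin (p + 1) → ℝ |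
          ∃ w : Fin p → ℝ, ∑ i, (b i + ∑ k, B k i * w k) ^ 2 ≤ m ^ 2}
        swap
        · rw [Set.indicator_of_notMem hcond]
          exact zero_le
        rw [Set.indicator_of_mem hcond]
        obtain ⟨w, hw⟩ := hcond
        have hb : |U.transpose.mulVec b j₀| ≤ m := by
          have h7 : U.transpose.mulVec b j₀ = ∑ i, om i * (b i + ∑ k, B k i * w k) := by
            have h8 : ∑ i, om i * ∑ k, B k i * w k = 0 := by
              simp_rw [Finset.mul_sum]
              rw [Finset.sum_comm]
              refine Finset.sum_eq_zero fun k _ => ?_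
              have := hBom k
              rw [dotProduct] at this
              calc _ = (∑ i, om i * B k i) * w k := by
                    rw [Finset.sum_mul]; exact Finset.sum_congr rfl fun i _ => by ring
                _ = 0 := by rw [this, zero_mul]
            simp_rw [mul_add]
            rw [Finset.sum_add_distrib, h8, add_zero]
            simp [Matrix.mulVec, dotProduct, hom]
          have h9 := Finset.sum_mul_sq_le_sq_mul_sq Finset.univ om
            (fun i => b i + ∑ k, B k i * w k)
          rw [← h7, homsq, one_mul] at h9
          exact abs_le_of_sq_le_sq (h9.trans hw) hm
        simp only [hF, Set.indicator_of_mem (show U.transpose.mulVec b j₀ ∈ {x : ℝ | |x| ≤ m} from hb),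
          Pi.one_apply, one_mul, hdetb]
        have hs : 0 ≤ ∑ j ∈ Finset.univ.erase j₀, (U.transpose.mulVec b) j ^ 2 * (c * Rj j) :=
          Finset.sum_nonneg fun j _ => by have := hRjnn j; positivity
        set Dt := c * R.eval c + (U.transpose.mulVec b) j₀ ^ 2 * R.eval c +
          ∑ j ∈ Finset.univ.erase j₀, (U.transpose.mulVec b) j ^ 2 * (c * Rj j) with hDt
        have hDtnn : 0 ≤ Dt := by positivity
        have hsq : (U.transpose.mulVec b) j₀ ^ 2 ≤ m ^ 2 := sq_le_sq' (abs_le.1 hb).1 (abs_le.1 hb).2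
        have hA : Real.sqrt Dt ≤ lam / 2 * Dt + 1 / (2 * lam) := by
          have h10 := Real.sq_sqrt hDtnn
          have h11 : lam / 2 * Dt + 1 / (2 * lam) - Real.sqrt Dt =
              (lam * Real.sqrt Dt - 1) ^ 2 / (2 * lam) := by
            field_simp
            nlinarith
          have : 0 ≤ (lam * Real.sqrt Dt - 1) ^ 2 / (2 * lam) := by positivity
          linarith
        have hB' : lam / 2 * Dt + 1 / (2 * lam) ≤
            (lam / 2 * ((c + m ^ 2) * R.eval c) + 1 / (2 * lam)) +
            ∑ j ∈ Finset.univ.erase j₀, lam / 2 * (c * Rj j) * (U.transpose.mulVec b) j ^ 2 := by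
          have : ∑ j ∈ Finset.univ.erase j₀, lam / 2 * (c * Rj j) * (U.transpose.mulVec b) j ^ 2 =
              lam / 2 * ∑ j ∈ Finset.univ.erase j₀, (U.transpose.mulVec b) j ^ 2 * (c * Rj j) := by
            rw [Finset.mul_sum]; exact Finset.sum_congr rfl fun j _ => by ring
          rw [this, hDt]
          have := mul_le_mul_of_nonneg_right hsq hRnn
          have := mul_le_mul_of_nonneg_left this hl.le
          linarith
        refine (ENNReal.ofReal_le_ofReal (hA.trans hB')).trans ?_
        rw [ENNReal.ofReal_add (by positivity) (Finset.sum_nonneg fun j _ => by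
          have := hRjnn j; positivity), ENNReal.ofReal_sum_of_nonneg fun j _ => by
          have := hRjnn j; positivity]
        refine add_le_add le_rfl (Finset.sum_le_sum fun j _ => ?_)
        rw [ENNReal.ofReal_mul (by have := hRjnn j; positivity)]
    _ = ∫⁻ b, F b ∂gaussPi (p + 1) := hmp.lintegral_comp hFm
    _ = slabProb m * (K₀ + ∑ j ∈ Finset.univ.erase j₀, K j) := lintegral_slab j₀ m K₀ K
    _ = _ := by
      rw [hshift, hK₀, hK, ← ENNReal.ofReal_sum_of_nonneg fun j _ => by
        have := hRjnn j; positivity, ← ENNReal.ofReal_add (by positivity)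
        (Finset.sum_nonneg fun j _ => by have := hRjnn j; positivity)]
      congr 2
      rw [← Finset.mul_sum, ← Finset.mul_sum]
      ring
end GaussianCorank

section GaussianEllipsoid
open ProbabilityTheory

/-- The volume of the Euclidean unit ball of `ℝⁿ`. -/
noncomputable def ballVol (n : ℕ) : ℝ≥0∞ := volume {y : Fin n → ℝ | ∑ i, y i ^ 2 ≤ 1}

lemma volume_sum_sq_le {n : ℕ} {r : ℝ} (hr : 0 < r) :
    volume {y : Fin n → ℝ | ∑ i, y i ^ 2 ≤ r ^ 2} = ENNReal.ofReal (r ^ n) * ballVol n := by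
  have h : {y : Fin n → ℝ | ∑ i, y i ^ 2 ≤ r ^ 2} =
      (fun y => r⁻¹ • y) ⁻¹' {y : Fin n → ℝ | ∑ i, y i ^ 2 ≤ 1} := by
    ext y
    simp only [Set.mem_ofPred_eq, Set.mem_preimage, Pi.smul_apply, smul_eq_mul, mul_pow]
    rw [← Finset.mul_sum, inv_pow, inv_mul_le_one₀ (by positivity)]
  rw [h, Measure.addHaar_preimage_smul _ (by positivity), ballVol]
  congr 2
  rw [Module.finrank_fintype_fun_eq_card, Fintype.card_fin, inv_pow, inv_inv, abs_of_pos]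
  positivity

lemma gaussPi_tube_le {n : ℕ} (hn : 0 < n) (B : Fin n → Fin n → ℝ) (s : Fin n → ℝ)
    (hs : ∀ i, 0 < s i) {ρ e c : ℝ} (hρ : 0 < ρ) (he : 0 < e) (hc : c = n * (e / ρ) ^ 2) :
    gaussPi n {a | ∃ z : Fin n → ℝ, ∑ k, z k ^ 2 ≤ ρ ^ 2 ∧
        ∑ i, (a i / s i + ∑ k, B k i * z k) ^ 2 ≤ e ^ 2} ≤
      ENNReal.ofReal (gaussPeak ^ n * (∏ i, s i) * (ρ * Real.sqrt (1 + 1 / n)) ^ n) * ballVol n *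
      ENNReal.ofReal (Real.sqrt (c • 1 + ∑ k, Matrix.vecMulVec (B k) (B k)).det) := by
  have hn' : (0 : ℝ) < n := by exact_mod_cast hn
  have hc0 : 0 < c := by rw [hc]; positivity
  obtain ⟨U, μ, h1, h2, hμ, hH⟩ := (posSemidef_sum_vecMulVec B).exists_orthogonal_diagonal
  set Q := c • 1 + ∑ k, Matrix.vecMulVec (B k) (B k) with hQ
  have hcμ : ∀ i, 0 < c + μ i := fun i => by have := hμ i; positivity
  have hQU : Q = U * Matrix.diagonal (fun i => c + μ i) * U.transpose := by
    have h4 : Matrix.diagonal (fun i => c + μ i) = c • 1 + Matrix.diagonal μ := by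
      ext i j
      simp only [Matrix.diagonal_apply, Matrix.add_apply, Matrix.smul_apply, Matrix.one_apply]
      split_ifs <;> simp
    rw [hQ, h4, hH, Matrix.mul_add, Matrix.add_mul, Matrix.mul_smul, Matrix.mul_one,
      Matrix.smul_mul, h1]
  set r : Fin n → ℝ := fun i => (Real.sqrt (c + μ i))⁻¹ with hr
  have hrsq : ∀ i, r i * r i = (c + μ i)⁻¹ := fun i => by
    rw [hr]; simp only; rw [← mul_inv, Real.mul_self_sqrt (hcμ i).le]
  set C := Matrix.diagonal r * U.transpose with hC
  have hCC : C.transpose * C = U * Matrix.diagonal (fun i => (c + μ i)⁻¹) * U.transpose := by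
    rw [hC, Matrix.transpose_mul, Matrix.transpose_transpose, Matrix.diagonal_transpose,
      Matrix.mul_assoc, ← Matrix.mul_assoc (Matrix.diagonal r), Matrix.diagonal_mul_diagonal,
      Matrix.mul_assoc]
    simp_rw [hrsq]
  have hQCC : Q * (C.transpose * C) = 1 := by
    rw [hQU, hCC]
    calc _ = U * Matrix.diagonal (fun i => c + μ i) * (U.transpose * U) *
          Matrix.diagonal (fun i => (c + μ i)⁻¹) * U.transpose := by simp only [Matrix.mul_assoc]
      _ = 1 := by
        rw [h2, Matrix.mul_one, Matrix.mul_assoc U, Matrix.diagonal_mul_diagonal]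
        have : (fun i => (c + μ i) * (c + μ i)⁻¹) = fun _ => 1 := by
          ext i; exact mul_inv_cancel₀ (hcμ i).ne'
        rw [this, Matrix.diagonal_one, Matrix.mul_one, h1]
  have hdetC : Q.det * C.det ^ 2 = 1 := by
    have := congrArg Matrix.det hQCC
    rw [Matrix.det_mul, Matrix.det_mul, Matrix.det_transpose, Matrix.det_one] at this
    rw [← this]; ring
  have hCne : C.det ≠ 0 := by
    intro h; rw [h] at hdetC; simp at hdetC
  have hdetC' : |C.det|⁻¹ = Real.sqrt Q.det := by
    rw [eq_div_of_mul_eq (pow_ne_zero 2 hCne) hdetC, Real.sqrt_div zero_le_one, Real.sqrt_one,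
      Real.sqrt_sq_eq_abs, one_div]
  set f := Matrix.toLin' (C * Matrix.diagonal fun i => (s i)⁻¹) with hf
  have hdetf : LinearMap.det f = C.det * ∏ i, (s i)⁻¹ := by
    rw [hf, LinearMap.det_toLin', Matrix.det_mul, Matrix.det_diagonal]
  have hprod : 0 < ∏ i, s i := Finset.prod_pos fun i _ => hs i
  have hprod' : ∏ i, (s i)⁻¹ = (∏ i, s i)⁻¹ := Finset.prod_inv_distrib _
  have hdetf0 : LinearMap.det f ≠ 0 := by
    rw [hdetf, hprod']; exact mul_ne_zero hCne (inv_ne_zero hprod.ne')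
  have hsub : {a : Fin n → ℝ | ∃ z : Fin n → ℝ, ∑ k, z k ^ 2 ≤ ρ ^ 2 ∧
        ∑ i, (a i / s i + ∑ k, B k i * z k) ^ 2 ≤ e ^ 2} ⊆
      f ⁻¹' {y : Fin n → ℝ | ∑ i, y i ^ 2 ≤ (ρ * Real.sqrt (1 + 1 / n)) ^ 2} := by
    rintro a ⟨z, hz, hze⟩
    set y : Fin n → ℝ := fun i => a i / s i with hy
    have hfa : f a = C.mulVec y := by
      rw [hf, Matrix.toLin'_apply, ← Matrix.mulVec_mulVec]
      congr 1
      ext i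
      simp [Matrix.mulVec_diagonal, hy, div_eq_inv_mul]
    set w := (C.transpose * C).mulVec y with hw
    have hyw : y ⬝ᵥ w = ∑ i, f a i ^ 2 := by
      rw [hfa, hw, ← Matrix.mulVec_mulVec, Matrix.dotProduct_mulVec, Matrix.vecMul_transpose,
        dotProduct]
      exact Finset.sum_congr rfl fun i _ => (sq _).symm
    have hQw : Q.mulVec w = y := by
      rw [hw, Matrix.mulVec_mulVec, hQCC, Matrix.one_mulVec]
    have hyw2 : y ⬝ᵥ w = c * (∑ i, w i ^ 2) + ∑ k, (B k ⬝ᵥ w) ^ 2 := by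
      nth_rewrite 1 [← hQw]
      rw [hQ, Matrix.add_mulVec, add_dotProduct, Matrix.smul_mulVec, Matrix.one_mulVec,
        smul_dotProduct, sum_vecMulVec_mulVec, sum_dotProduct]
      congr 1
      · simp [dotProduct, sq]
      · refine Finset.sum_congr rfl fun k _ => ?_
        rw [smul_dotProduct, smul_eq_mul, sq]
    set u := ∑ k, z k * (B k ⬝ᵥ w) with hu
    set v := ∑ i, (y i + ∑ k, B k i * z k) * w i with hv
    have hywuv : y ⬝ᵥ w = v - u := by
      rw [hv, hu]
      simp_rw [add_mul]
      rw [Finset.sum_add_distrib, dotProduct]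
      have : ∑ i, (∑ k, B k i * z k) * w i = ∑ k, z k * (B k ⬝ᵥ w) := by
        simp_rw [Finset.sum_mul, dotProduct, Finset.mul_sum]
        rw [Finset.sum_comm]
        exact Finset.sum_congr rfl fun k _ => Finset.sum_congr rfl fun i _ => by ring
      rw [this]; ring
    have hu2 : u ^ 2 ≤ ρ ^ 2 * ∑ k, (B k ⬝ᵥ w) ^ 2 :=
      (Finset.sum_mul_sq_le_sq_mul_sq _ _ _).trans
        (mul_le_mul_of_nonneg_right hz (Finset.sum_nonneg fun k _ => sq_nonneg _))
    have hv2 : v ^ 2 ≤ e ^ 2 * ∑ i, w i ^ 2 :=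
      (Finset.sum_mul_sq_le_sq_mul_sq _ _ _).trans
        (mul_le_mul_of_nonneg_right hze (Finset.sum_nonneg fun k _ => sq_nonneg _))
    have he2 : e ^ 2 = c * ρ ^ 2 / n := by rw [hc]; field_simp
    set X := y ⬝ᵥ w with hX
    have hXX : X ^ 2 ≤ (1 + 1 / n) * ρ ^ 2 * X := by
      have h5 : X ^ 2 ≤ (1 + 1 / n) * u ^ 2 + (1 + n) * v ^ 2 := by
        rw [hywuv]
        have h6 : (1 + 1 / (n : ℝ)) * u ^ 2 + (1 + n) * v ^ 2 - (v - u) ^ 2 =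
            (u + n * v) ^ 2 / n := by field_simp; ring
        have : 0 ≤ (u + n * v) ^ 2 / n := by positivity
        linarith
      have h7 : (1 + 1 / (n : ℝ)) * u ^ 2 ≤ (1 + 1 / n) * (ρ ^ 2 * ∑ k, (B k ⬝ᵥ w) ^ 2) :=
        mul_le_mul_of_nonneg_left hu2 (by positivity)
      have h8 : (1 + (n : ℝ)) * v ^ 2 ≤ (1 + n) * (c * ρ ^ 2 / n * ∑ i, w i ^ 2) := by
        rw [← he2]; exact mul_le_mul_of_nonneg_left hv2 (by positivity)
      have h9 : (1 + 1 / (n : ℝ)) * ρ ^ 2 * X = (1 + 1 / n) * (ρ ^ 2 * ∑ k, (B k ⬝ᵥ w) ^ 2) +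
          (1 + n) * (c * ρ ^ 2 / n * ∑ i, w i ^ 2) := by
        rw [hyw2]; field_simp
        ring
      linarith
    have hXnn : 0 ≤ X := by
      rw [hyw]; exact Finset.sum_nonneg fun i _ => sq_nonneg _
    have hXle : X ≤ (1 + 1 / n) * ρ ^ 2 := by
      rcases hXnn.eq_or_lt with h0 | h0
      · rw [← h0]; positivity
      · rw [sq] at hXX; exact le_of_mul_le_mul_right hXX h0
    simp only [Set.mem_preimage, Set.mem_ofPred_eq]
    rw [← hyw, mul_pow, Real.sq_sqrt (by positivity)]
    linarith
  refine (gaussPi_le n _).trans ?_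
  refine (mul_le_mul_right (measure_mono hsub) _).trans (le_of_eq ?_)
  rw [Measure.addHaar_preimage_linearMap _ hdetf0, volume_sum_sq_le (by positivity), hdetf, hprod',
    mul_inv, inv_inv, abs_mul, abs_inv, hdetC', abs_of_pos hprod]
  have hg := gaussPeak_pos
  rw [ENNReal.ofReal_mul (p := gaussPeak ^ n * ∏ i, s i) (by positivity),
    ENNReal.ofReal_mul (p := gaussPeak ^ n) (by positivity),
    ENNReal.ofReal_mul (p := Real.sqrt Q.det) (by positivity)]
  ring
end GaussianEllipsoid

section CorankMoments
open ProbabilityTheory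

lemma sum_mul_choose_mul_pow_le (p : ℕ) {x : ℝ} (hx : 0 ≤ x) :
    ∑ i ∈ Finset.range (p + 1), (i : ℝ) * (p.choose i * x ^ i) ≤ p * x * (1 + x) ^ p := by
  cases p with
  | zero => simp
  | succ p =>
    rw [Finset.sum_range_succ']
    have h : ∑ i ∈ Finset.range (p + 1),
        ((i + 1 : ℕ) : ℝ) * (((p + 1).choose (i + 1) : ℕ) * x ^ (i + 1)) =
        (p + 1 : ℕ) * x * (1 + x) ^ p := by
      rw [add_comm 1 x, add_pow, Finset.mul_sum]
      refine Finset.sum_congr rfl fun i _ => ?_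
      have := Nat.add_one_mul_choose_eq p i
      have h2 : ((p + 1 : ℕ) : ℝ) * (p.choose i : ℕ) = ((p + 1).choose (i + 1) : ℕ) * (i + 1 : ℕ) := by
        exact_mod_cast this
      rw [one_pow, mul_one]
      calc _ = (((p + 1).choose (i + 1) : ℕ) * ((i + 1 : ℕ) : ℝ)) * x ^ (i + 1) := by ring
        _ = _ := by rw [← h2]; ring
    rw [h]
    simp only [Nat.cast_zero, zero_mul, add_zero]
    refine mul_le_mul_of_nonneg_left ?_ (by positivity)
    exact pow_le_pow_right₀ (by linarith) (Nat.le_succ p)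

lemma corankFunctional_X_pow_succ (c m : ℝ) (i : ℕ) :
    corankFunctional c m (Polynomial.X ^ (i + 1)) = (c + m ^ 2) * c ^ i + i * c ^ i := by
  rw [pow_succ', corankFunctional_X_mul]
  simp only [Polynomial.eval_pow, Polynomial.eval_X, Polynomial.derivative_X_pow,
    Polynomial.eval_mul, Polynomial.eval_C]
  cases i with
  | zero => simp
  | succ i => simp; ring

lemma corankFunctional_oneAddDeriv_le (p : ℕ) {c m : ℝ} (hc : 0 ≤ c) :
    corankFunctional c m ((oneAddDeriv ^ p) (Polynomial.X ^ (p + 1))) ≤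
      (p + 1).factorial * (1 + c / 2) ^ p * (c * (p + 2) / 2 + m ^ 2) := by
  have h1 : (oneAddDeriv ^ p : Module.End ℝ (Polynomial ℝ)) = ∑ i ∈ Finset.range (p + 1),
      ((p.choose i : ℕ) : Module.End ℝ (Polynomial ℝ)) * Polynomial.derivative ^ (p - i) := by
    rw [oneAddDeriv, (Commute.one_left _).add_pow]
    exact Finset.sum_congr rfl fun i _ => by rw [one_pow, one_mul, Nat.cast_comm]
  have h2 : corankFunctional c m ((oneAddDeriv ^ p) (Polynomial.X ^ (p + 1))) =
      ∑ i ∈ Finset.range (p + 1), (p.choose i : ℝ) * (((p + 1).descFactorial (p - i) : ℕ) *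
        ((c + m ^ 2) * c ^ i + i * c ^ i)) := by
    rw [h1, LinearMap.sum_apply, map_sum]
    refine Finset.sum_congr rfl fun i hi => ?_
    have hi' : i ≤ p := by simpa [Nat.lt_succ_iff] using hi
    rw [Module.End.mul_apply, Module.End.pow_apply, Polynomial.iterate_derivative_X_pow_eq_smul,
      show p + 1 - (p - i) = i + 1 by omega, Module.End.natCast_apply, map_nsmul, map_smul,
      corankFunctional_X_pow_succ, nsmul_eq_mul, smul_eq_mul]
  have h3 : ∀ i ∈ Finset.range (p + 1),
      (p.choose i : ℝ) * (((p + 1).descFactorial (p - i) : ℕ) *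
        ((c + m ^ 2) * c ^ i + i * c ^ i)) ≤ (p + 1).factorial * ((c + m ^ 2) *
          (p.choose i * (c / 2) ^ i) + (i : ℝ) * (p.choose i * (c / 2) ^ i)) := by
    intro i hi
    have hi' : i ≤ p := by simpa [Nat.lt_succ_iff] using hi
    have h4 := Nat.factorial_mul_descFactorial (show p - i ≤ p + 1 by omega)
    rw [show p + 1 - (p - i) = i + 1 by omega] at h4
    have h5 : (2 : ℝ) ^ i ≤ (i + 1).factorial := by
      have : 2 ^ i ≤ (i + 1).factorial := by
        simpa [add_comm] using Nat.factorial_mul_pow_le_factorial (m := 1) (n := i)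
      exact_mod_cast this
    have h6 : (2 : ℝ) ^ i * ((p + 1).descFactorial (p - i) : ℕ) ≤ (p + 1).factorial := by
      rw [← h4]; push_cast
      exact mul_le_mul_of_nonneg_right (by exact_mod_cast h5) (by positivity)
    have h7 : c ^ i = 2 ^ i * (c / 2) ^ i := by rw [← mul_pow]; congr 1; ring
    have h8 : 0 ≤ (p.choose i : ℝ) * ((c + m ^ 2 + i) * (c / 2) ^ i) := by positivity
    have := mul_le_mul_of_nonneg_left h6 h8
    rw [h7]
    linarith
  rw [h2]
  refine (Finset.sum_le_sum h3).trans ?_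
  rw [← Finset.mul_sum, Finset.sum_add_distrib, ← Finset.mul_sum, mul_assoc]
  refine mul_le_mul_of_nonneg_left ?_ (by positivity)
  have h9 : ∑ i ∈ Finset.range (p + 1), ((p.choose i : ℝ) * (c / 2) ^ i) = (1 + c / 2) ^ p := by
    rw [add_comm 1, add_pow]
    exact Finset.sum_congr rfl fun i _ => by rw [one_pow]; ring
  rw [h9]
  have := sum_mul_choose_mul_pow_le p (x := c / 2) (by positivity)
  linarith

lemma shiftPoly_zero (n : ℕ) : shiftPoly (0 : Matrix (Fin n) (Fin n) ℝ) = Polynomial.X ^ n := by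
  rw [shiftPoly, neg_zero, Matrix.charpoly_zero, Fintype.card_fin]

lemma isClosed_exists_mem_compact {X Y : Type*} [TopologicalSpace X] [TopologicalSpace Y]
    {K : Set X} (hK : IsCompact K) {C : Set (X × Y)} (hC : IsClosed C) :
    IsClosed {y | ∃ x ∈ K, (x, y) ∈ C} := by
  have := isCompact_iff_compactSpace.1 hK
  have h : {y | ∃ x ∈ K, (x, y) ∈ C} =
      Prod.snd '' ((fun q : K × Y => ((q.1 : X), q.2)) ⁻¹' C) := by
    ext y
    constructor
    · rintro ⟨x, hx, h⟩
      exact ⟨(⟨x, hx⟩, y), h, rfl⟩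
    · rintro ⟨⟨x, y'⟩, h, rfl⟩
      exact ⟨x, x.2, h⟩
  rw [h]
  exact isClosedMap_snd_of_compactSpace _ (hC.preimage (by fun_prop))

lemma isCompact_sum_sq_le (n : ℕ) (r : ℝ) : IsCompact {z : Fin n → ℝ | ∑ k, z k ^ 2 ≤ r} := by
  refine Metric.isCompact_of_isClosed_isBounded (isClosed_le (by fun_prop) continuous_const) ?_
  refine (Metric.isBounded_closedBall (x := (0 : Fin n → ℝ)) (r := Real.sqrt r)).subset ?_
  intro z hz
  rw [mem_closedBall_zero_iff, pi_norm_le_iff_of_nonneg (Real.sqrt_nonneg _)]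
  intro i
  refine Real.abs_le_sqrt (le_trans ?_ hz)
  exact Finset.single_le_sum (f := fun k => z k ^ 2) (fun k _ => sq_nonneg _) (Finset.mem_univ i)

lemma ballVol_ne_top (n : ℕ) : ballVol n ≠ ⊤ :=
  (isCompact_sum_sq_le n 1).measure_lt_top.ne

/-- Matrices (given by their columns, the first one being rescaled by `s`) for which the first
column is close to a bounded linear combination of the other columns, and the second column
is close to a bounded linear combination of the columns following it. -/
def nearSingularSet (p : ℕ) (s : Fin (p + 1) → ℝ) (ρ e m r : ℝ) :
    Set (Fin (p + 2) → Fin (p + 1) → ℝ) :=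
  {M | (∃ z : Fin (p + 1) → ℝ, ∑ k, z k ^ 2 ≤ ρ ^ 2 ∧
      ∑ i, (M 0 i / s i + ∑ k, M k.succ i * z k) ^ 2 ≤ e ^ 2) ∧
    ∃ w : Fin p → ℝ, ∑ k, w k ^ 2 ≤ r ∧
      ∑ i, (M 1 i + ∑ k : Fin p, M k.succ.succ i * w k) ^ 2 ≤ m ^ 2}

lemma isClosed_nearSingularSet (p : ℕ) (s : Fin (p + 1) → ℝ) (ρ e m r : ℝ) :
    IsClosed (nearSingularSet p s ρ e m r) := by
  refine IsClosed.inter ?_ ?_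
  · exact isClosed_exists_mem_compact (isCompact_sum_sq_le (p + 1) (ρ ^ 2))
      (C := {q : (Fin (p + 1) → ℝ) × (Fin (p + 2) → Fin (p + 1) → ℝ) |
        ∑ i, (q.2 0 i / s i + ∑ k, q.2 k.succ i * q.1 k) ^ 2 ≤ e ^ 2})
      (isClosed_le (by fun_prop) continuous_const)
  · exact isClosed_exists_mem_compact (isCompact_sum_sq_le p r)
      (C := {q : (Fin p → ℝ) × (Fin (p + 2) → Fin (p + 1) → ℝ) |
        ∑ i, (q.2 1 i + ∑ k : Fin p, q.2 k.succ.succ i * q.1 k) ^ 2 ≤ m ^ 2})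
      (isClosed_le (by fun_prop) continuous_const)

lemma measure_nearSingularSet_le (p : ℕ) (s : Fin (p + 1) → ℝ) (hs : ∀ i, 0 < s i)
    {ρ e m r c : ℝ} (hρ : 0 < ρ) (he : 0 < e) (hm : 0 ≤ m)
    (hc : c = (p + 1 : ℕ) * (e / ρ) ^ 2) :
    (Measure.pi fun _ => gaussPi (p + 1)) (nearSingularSet p s ρ e m r) ≤
      ENNReal.ofReal (gaussPeak ^ (p + 1) * (∏ i, s i) *
        (ρ * Real.sqrt (1 + 1 / (p + 1 : ℕ))) ^ (p + 1)) * ballVol (p + 1) * (slabProb m *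
      ENNReal.ofReal (Real.sqrt ((p + 1).factorial * (1 + c / 2) ^ p *
        (c * (p + 2) / 2 + m ^ 2)))) := by
  have hc0 : 0 < c := by rw [hc]; positivity
  set C₀ := ENNReal.ofReal (gaussPeak ^ (p + 1) * (∏ i, s i) *
        (ρ * Real.sqrt (1 + 1 / (p + 1 : ℕ))) ^ (p + 1)) * ballVol (p + 1) with hC₀
  set W : ℝ := (p + 1).factorial * (1 + c / 2) ^ p * (c * (p + 2) / 2 + m ^ 2) with hW
  have hWpos : 0 < W := by positivity
  set lam := (Real.sqrt W)⁻¹ with hlam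
  have hsW : 0 < Real.sqrt W := Real.sqrt_pos.2 hWpos
  have hl : 0 < lam := inv_pos.2 hsW
  have hmeas := (isClosed_nearSingularSet p s ρ e m r).measurableSet
  rw [← lintegral_indicator_one hmeas]
  refine (lintegral_pi_cons_le' _ _ _).trans ?_
  set Ck : Set (Fin (p + 1) → Fin (p + 1) → ℝ) := {B | ∃ w : Fin p → ℝ,
      ∑ i, (B 0 i + ∑ k : Fin p, B k.succ i * w k) ^ 2 ≤ m ^ 2} with hCk
  set F : (Fin (p + 1) → Fin (p + 1) → ℝ) → ℝ≥0∞ := Ck.indicator fun B =>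
      ENNReal.ofReal (Real.sqrt (c • 1 + ∑ k, Matrix.vecMulVec (B k) (B k)).det) with hF
  have hinner : ∀ B : Fin (p + 1) → Fin (p + 1) → ℝ,
      ∫⁻ a, (nearSingularSet p s ρ e m r).indicator 1 (Fin.cons a B : Fin (p + 2) → _)
        ∂gaussPi (p + 1) ≤ C₀ * F B := by
    intro B
    by_cases hB : B ∈ Ck
    · rw [hF, Set.indicator_of_mem hB]
      refine le_trans ?_ (gaussPi_tube_le (Nat.succ_pos p) B s hs hρ he hc)
      refine le_trans (lintegral_mono fun a => ?_) (lintegral_indicator_one_le _)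
      by_cases ha : (Fin.cons a B : Fin (p + 2) → _) ∈ nearSingularSet p s ρ e m r
      · rw [Set.indicator_of_mem ha, Set.indicator_of_mem]
        · rfl
        · simpa using ha.1
      · rw [Set.indicator_of_notMem ha]; exact zero_le
    · rw [hF, Set.indicator_of_notMem hB, mul_zero]
      refine le_of_eq ?_
      have h0 : ∀ a : Fin (p + 1) → ℝ,
          (Fin.cons a B : Fin (p + 2) → _) ∉ nearSingularSet p s ρ e m r := by
        rintro a ⟨-, w, -, hw⟩
        exact hB ⟨w, by simpa using hw⟩
      simp [Set.indicator_of_notMem (h0 _)]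
  refine (lintegral_mono hinner).trans ?_
  rw [lintegral_const_mul' _ _ (ENNReal.mul_ne_top ENNReal.ofReal_ne_top (ballVol_ne_top _))]
  refine mul_le_mul_right ?_ _
  refine (lintegral_pi_cons_le' _ _ _).trans ?_
  have hinner2 : ∀ B : Fin p → Fin (p + 1) → ℝ,
      ∫⁻ b, F (Fin.cons b B) ∂gaussPi (p + 1) ≤
        slabProb m * (ENNReal.ofReal ((lam / 2) • corankFunctional c m
          (shiftPoly (0 + ∑ k, Matrix.vecMulVec (B k) (B k)))) + ENNReal.ofReal (1 / (2 * lam))) := by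
    intro B
    have h := lintegral_sqrt_det_near_range_le B hc0 hm hl
    rw [zero_add, smul_eq_mul]
    refine le_trans (le_trans (lintegral_mono fun b => le_of_eq ?_) h)
      (mul_le_mul_right ENNReal.ofReal_add_le _)
    have h1 : ∑ k, Matrix.vecMulVec ((Fin.cons b B : Fin (p + 1) → _) k)
        ((Fin.cons b B : Fin (p + 1) → Fin (p + 1) → ℝ) k) =
        ∑ k, Matrix.vecMulVec (B k) (B k) + Matrix.vecMulVec b b := by
      rw [Fin.sum_univ_succ]
      exact add_comm _ _
    simp only [hF, hCk, Set.indicator, Set.mem_ofPred_eq, h1]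
    rfl
  refine (lintegral_mono hinner2).trans ?_
  have hslab : slabProb m ≠ ⊤ := measure_ne_top _ _
  rw [lintegral_const_mul' _ _ hslab, lintegral_add_right _ measurable_const]
  refine mul_le_mul_right ?_ _
  have hL : CoeffPos ((lam / 2) • corankFunctional c m) := fun P hP => by
    rw [LinearMap.smul_apply, smul_eq_mul]
    exact mul_nonneg (by positivity) (corankFunctional_coeffPos hc0.le P hP)
  have h1 := lintegral_shiftPoly_sum_le p (Matrix.PosSemidef.zero (n := Fin (p + 1)) (R := ℝ)) hL
  refine (add_le_add h1 le_rfl).trans ?_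
  rw [lintegral_const, measure_univ, mul_one, shiftPoly_zero, LinearMap.smul_apply, smul_eq_mul]
  have h2 := corankFunctional_oneAddDeriv_le p (m := m) hc0.le
  have h3 : 0 ≤ corankFunctional c m ((oneAddDeriv ^ p) (Polynomial.X ^ (p + 1))) := by
    have h4 := ((corankFunctional_coeffPos (m := m) hc0.le).comp_oneAddDeriv_pow p)
      (Polynomial.X ^ (p + 1)) fun k => by
        rw [Polynomial.coeff_X_pow]; split_ifs <;> norm_num
    exact h4
  rw [← ENNReal.ofReal_add (by positivity) (by positivity)]
  refine ENNReal.ofReal_le_ofReal ?_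
  have h5 : lam / 2 * W + 1 / (2 * lam) = Real.sqrt W := by
    rw [hlam]
    have := Real.mul_self_sqrt hWpos.le
    field_simp
    nlinarith
  have := mul_le_mul_of_nonneg_left h2 (show 0 ≤ lam / 2 by positivity)
  rw [← hW] at this
  linarith
end CorankMoments

section Kernels

lemma one_add_pow_sub_le {u : ℝ} (hu : 0 ≤ u) (k : ℕ) :
    (1 + u) ^ (k + 1) - 1 ≤ (k + 1) * u * (1 + u) ^ k := by
  induction k with
  | zero => simp
  | succ k ih =>
    have h1 := mul_le_mul_of_nonneg_left ih (show 0 ≤ 1 + u by linarith)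
    have h2 : u ≤ u * (1 + u) ^ (k + 1) := le_mul_of_one_le_right hu (one_le_pow₀ (by linarith))
    push_cast
    have e1 : (1 + u) ^ (k + 1 + 1) = (1 + u) * (1 + u) ^ (k + 1) := by ring
    have e2 : (1 + u) * (((k : ℝ) + 1) * u * (1 + u) ^ k) = (k + 1) * u * (1 + u) ^ (k + 1) := by ring
    rw [e2] at h1
    linarith

lemma one_add_pow_sub_sub_le {u : ℝ} (hu : 0 ≤ u) (k : ℕ) :
    (1 + u) ^ (k + 2) - 1 - (k + 2) * u ≤ (k + 2) * (k + 1) / 2 * u ^ 2 * (1 + u) ^ k := by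
  induction k with
  | zero => simp; nlinarith
  | succ k ih =>
    have h1 := mul_le_mul_of_nonneg_left ih (show 0 ≤ 1 + u by linarith)
    have h2 : ((k : ℝ) + 2) * u ^ 2 ≤ (k + 2) * u ^ 2 * (1 + u) ^ (k + 1) :=
      le_mul_of_one_le_right (by positivity) (one_le_pow₀ (by linarith))
    push_cast
    have e1 : (1 + u) ^ (k + 1 + 2) = (1 + u) * (1 + u) ^ (k + 2) := by ring
    have e2 : (1 + u) * (((k : ℝ) + 2) * (k + 1) / 2 * u ^ 2 * (1 + u) ^ k) =
      (k + 2) * (k + 1) / 2 * u ^ 2 * (1 + u) ^ (k + 1) := by ring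
    rw [e2] at h1
    linarith

lemma sum_inner_sq_le_of_orthogonal {E : Type*} [NormedAddCommGroup E] [InnerProductSpace ℝ E]
    {ι : Type*} [Fintype ι] [DecidableEq ι] (u : ι → E) (hu : ∀ i j, i ≠ j → ⟪u i, u j⟫ = 0)
    {C : ℝ} (hC0 : 0 ≤ C) (hC : ∀ i, ‖u i‖ ^ 2 ≤ C) (f : E) :
    ∑ i, ⟪f, u i⟫ ^ 2 ≤ C * ‖f‖ ^ 2 := by
  set g := ∑ i, ⟪f, u i⟫ • u i with hg
  set Q := ∑ i, ⟪f, u i⟫ ^ 2 with hQ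
  have h1 : ⟪f, g⟫ = Q := by
    rw [hg, inner_sum]
    exact Finset.sum_congr rfl fun i _ => by rw [real_inner_smul_right, sq]
  have h2 : ‖g‖ ^ 2 ≤ C * Q := by
    rw [← real_inner_self_eq_norm_sq]
    nth_rewrite 1 [hg]
    rw [sum_inner, hQ, Finset.mul_sum]
    refine Finset.sum_le_sum fun i _ => ?_
    have : ⟪u i, g⟫ = ⟪f, u i⟫ * ‖u i‖ ^ 2 := by
      rw [hg, inner_sum, Finset.sum_eq_single i]
      · rw [real_inner_smul_right, real_inner_self_eq_norm_sq]
      · intro j _ hj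
        rw [real_inner_smul_right, hu i j hj.symm, mul_zero]
      · simp
    rw [real_inner_smul_left, this]
    nlinarith [mul_le_mul_of_nonneg_left (hC i) (sq_nonneg ⟪f, u i⟫)]
  have hQ0 : 0 ≤ Q := Finset.sum_nonneg fun i _ => sq_nonneg _
  have h3 : Q ^ 2 ≤ ‖f‖ ^ 2 * (C * Q) := by
    have h4 := abs_real_inner_le_norm f g
    rw [h1, abs_of_nonneg hQ0] at h4
    calc Q ^ 2 ≤ (‖f‖ * ‖g‖) ^ 2 := pow_le_pow_left₀ hQ0 h4 2
      _ = ‖f‖ ^ 2 * ‖g‖ ^ 2 := by ring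
      _ ≤ _ := mul_le_mul_of_nonneg_left h2 (sq_nonneg _)
  rcases hQ0.eq_or_lt with h0 | h0
  · rw [← h0]; positivity
  · have : Q * Q ≤ (C * ‖f‖ ^ 2) * Q := by nlinarith
    exact le_of_mul_le_mul_right this h0

/-- The representers, in a Euclidean space `E`, of the evaluations `f ↦ fᵢ(x)` and of the
directional derivatives `f ↦ Dfᵢ(x) w` of the Bombieri–Weyl reproducing kernel space. -/
structure EvalKernels {n : ℕ} (d : Fin n → ℕ) (E V : Type*) [NormedAddCommGroup E]
    [InnerProductSpace ℝ E] [NormedAddCommGroup V] [InnerProductSpace ℝ V] where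
  ke : Fin n → V → E
  kd : Fin n → V → V →ₗ[ℝ] E
  inner_ke_ke : ∀ i j x y, ⟪ke i x, ke j y⟫ = if i = j then ⟪x, y⟫ ^ d i else 0
  inner_ke_kd : ∀ i j x y w, ⟪ke i x, kd j y w⟫ =
    if i = j then d i * (⟪x, y⟫ ^ (d i - 1) * ⟪x, w⟫) else 0
  inner_kd_kd : ∀ i j x y v w, ⟪kd i x v, kd j y w⟫ =
    if i = j then d i * ((d i - 1 : ℕ) * ⟪x, y⟫ ^ (d i - 2) * (⟪x, w⟫ * ⟪v, y⟫) +
      ⟪x, y⟫ ^ (d i - 1) * ⟪v, w⟫) else 0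

namespace EvalKernels
variable {n : ℕ} {d : Fin n → ℕ} {E V : Type*} [NormedAddCommGroup E]
    [InnerProductSpace ℝ E] [NormedAddCommGroup V] [InnerProductSpace ℝ V] (K : EvalKernels d E V)

lemma inner_kd_ke (i j : Fin n) (x y w : V) : ⟪K.kd i x w, K.ke j y⟫ =
    if i = j then d i * (⟪x, y⟫ ^ (d i - 1) * ⟪w, y⟫) else 0 := by
  rw [real_inner_comm, K.inner_ke_kd, real_inner_comm x y, real_inner_comm w y]
  by_cases h : i = j
  · subst h; rfl
  · rw [if_neg h, if_neg (Ne.symm h)]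

lemma eq_of_inner_sub_self {a b : E} (h : ⟪a - b, a - b⟫ = 0) : a = b :=
  sub_eq_zero.1 (inner_self_eq_zero.1 h)

lemma ke_smul (i : Fin n) (c : ℝ) (x : V) : K.ke i (c • x) = c ^ d i • K.ke i x := by
  refine eq_of_inner_sub_self ?_
  simp only [inner_sub_left, inner_sub_right, real_inner_smul_left, real_inner_smul_right,
    K.inner_ke_ke, if_true]
  ring

lemma kd_smul (i : Fin n) (c : ℝ) (x w : V) :
    K.kd i (c • x) w = c ^ (d i - 1) • K.kd i x w := by
  refine eq_of_inner_sub_self ?_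
  simp only [inner_sub_left, inner_sub_right, real_inner_smul_left, real_inner_smul_right,
    K.inner_kd_kd, if_true]
  rcases hd : d i with _ | _ | k
  · simp
  · simp
  · simp only [Nat.add_sub_cancel, show k + 1 + 1 - 2 = k by omega]
    ring

lemma kd_self (hd : ∀ i, 1 ≤ d i) (i : Fin n) (x : V) : K.kd i x x = (d i : ℝ) • K.ke i x := by
  refine eq_of_inner_sub_self ?_
  simp only [inner_sub_left, inner_sub_right, real_inner_smul_left, real_inner_smul_right,
    K.inner_kd_kd, K.inner_ke_ke, K.inner_ke_kd, K.inner_kd_ke, if_true]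
  have := hd i
  rcases hd : d i with _ | _ | k
  · omega
  · simp
  · simp only [Nat.add_sub_cancel, show k + 1 + 1 - 2 = k by omega]
    push_cast
    ring

lemma norm_taylor_sq_le (i : Fin n) {x z : V} (hx : ⟪x, x⟫ = 1) (hz : ⟪x, z⟫ = 0)
    (hd : 1 ≤ d i) :
    ‖K.ke i (x + z) - K.ke i x - K.kd i x z‖ ^ 2 ≤
      d i * (((d i - 1 : ℕ) : ℝ) / 2 * ‖z‖ ^ 4 * (1 + ‖z‖ ^ 2) ^ (d i - 2)) := by
  have hz' : ⟪z, x⟫ = 0 := by rw [real_inner_comm]; exact hz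
  rw [← real_inner_self_eq_norm_sq (_ - _)]
  have h4 : ‖z‖ ^ 4 = (‖z‖ ^ 2) ^ 2 := by ring
  rw [h4]
  simp only [inner_sub_left, inner_sub_right, inner_add_left, inner_add_right,
    K.inner_kd_kd, K.inner_ke_ke, K.inner_ke_kd, K.inner_kd_ke, if_true, hx, hz, hz',
    real_inner_self_eq_norm_sq]
  have hu : 0 ≤ ‖z‖ ^ 2 := sq_nonneg _
  generalize ‖z‖ ^ 2 = u at hu
  rcases hdi : d i with _ | _ | k
  · omega
  · simp
  · simp only [Nat.add_sub_cancel, show k + 1 + 1 - 2 = k by omega]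
    have := one_add_pow_sub_sub_le hu k
    push_cast
    simp only [one_pow, add_zero, zero_add]
    nlinarith

lemma norm_kd_sub_sq_le (i : Fin n) {x z y : V} (hx : ⟪x, x⟫ = 1) (hz : ⟪x, z⟫ = 0)
    (hy : ⟪x, y⟫ = 0) (hd : 1 ≤ d i) :
    ‖K.kd i (x + z) y - K.kd i x y‖ ^ 2 ≤
      d i * (2 * ((d i - 1 : ℕ) : ℝ) * ‖z‖ ^ 2 * (1 + ‖z‖ ^ 2) ^ (d i - 2) * ‖y‖ ^ 2) := by
  have hz' : ⟪z, x⟫ = 0 := by rw [real_inner_comm]; exact hz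
  have hy' : ⟪y, x⟫ = 0 := by rw [real_inner_comm]; exact hy
  have hzy : ⟪z, y⟫ * ⟪y, z⟫ ≤ ‖z‖ ^ 2 * ‖y‖ ^ 2 := by
    rw [real_inner_comm y z]
    have := abs_real_inner_le_norm z y
    have := abs_le.1 this
    rw [← mul_pow, ← sq, real_inner_comm]
    exact sq_le_sq' this.1 this.2
  rw [← real_inner_self_eq_norm_sq (_ - _)]
  simp only [inner_sub_left, inner_sub_right, inner_add_left, inner_add_right,
    K.inner_kd_kd, if_true, hx, hz, hz', hy, hy', real_inner_self_eq_norm_sq]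
  have hu : 0 ≤ ‖z‖ ^ 2 := sq_nonneg _
  have hv : 0 ≤ ‖y‖ ^ 2 := sq_nonneg _
  generalize ‖z‖ ^ 2 = u at hu hzy
  generalize ‖y‖ ^ 2 = v at hv hzy
  rcases hdi : d i with _ | _ | k
  · omega
  · simp
  · simp only [Nat.add_sub_cancel, show k + 1 + 1 - 2 = k by omega]
    have h1 := mul_le_mul_of_nonneg_left (one_add_pow_sub_le hu k)
      (show 0 ≤ ((k : ℝ) + 1 + 1) * v by positivity)
    have h2 := mul_le_mul_of_nonneg_left hzy
      (show 0 ≤ ((k : ℝ) + 1 + 1) * ((k + 1) * (1 + u) ^ k) by positivity)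
    push_cast
    simp only [one_pow, add_zero, zero_add, zero_mul, mul_zero, mul_one]
    nlinarith
end EvalKernels
end Kernels

section NearSingular

lemma sum_add_sq_le {ι : Type*} [Fintype ι] {a b : ι → ℝ} {A B : ℝ} (hA : 0 ≤ A) (hB : 0 ≤ B)
    (ha : ∑ i, a i ^ 2 ≤ A ^ 2) (hb : ∑ i, b i ^ 2 ≤ B ^ 2) :
    ∑ i, (a i + b i) ^ 2 ≤ (A + B) ^ 2 := by
  have h1 := Finset.sum_mul_sq_le_sq_mul_sq Finset.univ a b
  have h2 : ∑ i, a i * b i ≤ A * B := by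
    refine (abs_le_of_sq_le_sq' ?_ (by positivity)).2
    rw [mul_pow]
    exact h1.trans (mul_le_mul ha hb (Finset.sum_nonneg fun i _ => sq_nonneg _) (sq_nonneg _))
  have h3 : ∑ i, (a i + b i) ^ 2 = ∑ i, a i ^ 2 + 2 * ∑ i, a i * b i + ∑ i, b i ^ 2 := by
    rw [Finset.mul_sum, ← Finset.sum_add_distrib, ← Finset.sum_add_distrib]
    exact Finset.sum_congr rfl fun i _ => by ring
  rw [h3]
  linarith [sq_nonneg A]

lemma sum_mul_sq_le {ι : Type*} [Fintype ι] {a b : ι → ℝ} {A B : ℝ}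
    (ha : ∀ i, a i ^ 2 ≤ A ^ 2) (hb : ∑ i, b i ^ 2 ≤ B ^ 2) :
    ∑ i, (a i * b i) ^ 2 ≤ (A * B) ^ 2 := by
  rw [mul_pow]
  refine le_trans ?_ (mul_le_mul_of_nonneg_left hb (sq_nonneg A))
  rw [Finset.mul_sum]
  refine Finset.sum_le_sum fun i _ => ?_
  rw [mul_pow]
  exact mul_le_mul_of_nonneg_right (ha i) (sq_nonneg _)

namespace EvalKernels
variable {p : ℕ} {d : Fin (p + 1) → ℕ} {E V : Type*} [NormedAddCommGroup E]
    [InnerProductSpace ℝ E] [NormedAddCommGroup V] [InnerProductSpace ℝ V] (K : EvalKernels d E V)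

/-- The values and normalized partial derivatives of `f` at the first vector of the basis `o`. -/
noncomputable def columns (o : OrthonormalBasis (Fin (p + 2)) ℝ V) (f : E) :
    Fin (p + 2) → Fin (p + 1) → ℝ :=
  Fin.cons (fun i => ⟪f, K.ke i (o 0)⟫) fun k i => ⟪f, K.kd i (o 0) (o k.succ)⟫ / √(d i)

lemma sum_columns_mul (o : OrthonormalBasis (Fin (p + 2)) ℝ V) (f : E) {y : V}
    (hy : ⟪o 0, y⟫ = 0) (i : Fin (p + 1)) :
    ∑ k : Fin (p + 1), K.columns o f k.succ i * ⟪o k.succ, y⟫ =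
      ⟪f, K.kd i (o 0) y⟫ / √(d i) := by
  have h : y = ∑ k : Fin (p + 1), ⟪o k.succ, y⟫ • o k.succ := by
    conv_lhs => rw [← o.sum_repr' y, Fin.sum_univ_succ, hy, zero_smul, zero_add]
  conv_rhs => rw [h]
  rw [map_sum, inner_sum, Finset.sum_div]
  refine Finset.sum_congr rfl fun k _ => ?_
  rw [map_smul, real_inner_smul_right, columns, Fin.cons_succ]
  ring

set_option maxHeartbeats 800000 in
lemma columns_mem_nearSingularSet (hd : ∀ i, 1 ≤ d i) {D : ℕ} (hD : ∀ i, d i ≤ D)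
    (o : OrthonormalBasis (Fin (p + 2)) ℝ V) {x₀ v₀ : V} (hx₀ : ‖x₀‖ = 1) (hv₀ : ‖v₀‖ = 1)
    (hxv : ⟪x₀, v₀⟫ = 0) {ρ ε R G h : ℝ} (hρ : 0 ≤ ρ) (hε : 0 ≤ ε) (hG : 0 ≤ G) (hh : 0 < h)
    (hGR : (D - 1 : ℕ) / 2 * R ^ 2 ≤ G ^ 2) (hne : ⟪x₀, o 0⟫ ≠ 0)
    (hcone : ‖o 0 - ⟪x₀, o 0⟫ • x₀‖ ^ 2 ≤ ρ ^ 2 * ⟪x₀, o 0⟫ ^ 2)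
    (hy : h ≤ |⟪v₀, o 1⟫ - ⟪v₀, o 0⟫ * ⟪x₀, o 0⟫⁻¹ * ⟪x₀, o 1⟫|) {f : E} (hf : ‖f‖ ≤ R)
    (hev : ∑ i, ⟪f, K.ke i x₀⟫ ^ 2 + ∑ i, (⟪f, K.kd i x₀ v₀⟫ / √(d i)) ^ 2 ≤ ε ^ 2) :
    K.columns o f ∈ nearSingularSet p (fun i => √(d i)) ρ (√(1 + ρ ^ 2) ^ D * (ε + G * ρ ^ 2))
      (√(1 + ρ ^ 2) ^ D * ((1 + ρ * √D) * ε + 2 * G * ρ) / h) ((1 + ρ ^ 2) / h ^ 2) := by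
  have hx1 : ⟪o 0, o 0⟫ = 1 := by rw [real_inner_self_eq_norm_sq, o.norm_eq_one, one_pow]
  set x := o 0 with hx
  set c := ⟪x₀, x⟫⁻¹ with hc
  have hcx : c * ⟪x₀, x⟫ = 1 := inv_mul_cancel₀ hne
  have hxc : ⟪x, x₀⟫ = ⟪x₀, x⟫ := real_inner_comm _ _
  have hvx : ⟪v₀, x₀⟫ = 0 := by rw [real_inner_comm]; exact hxv
  have hx00 : ⟪x₀, x₀⟫ = 1 := by rw [real_inner_self_eq_norm_sq, hx₀, one_pow]
  have hv00 : ⟪v₀, v₀⟫ = 1 := by rw [real_inner_self_eq_norm_sq, hv₀, one_pow]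
  set Λ := √(1 + ρ ^ 2) with hΛ
  have hΛ2 : Λ ^ 2 = 1 + ρ ^ 2 := Real.sq_sqrt (by positivity)
  have hΛ1 : 1 ≤ Λ := Real.one_le_sqrt.2 (by nlinarith)
  have hΛD : 0 < Λ ^ D := by positivity
  have hx2 : 0 < ⟪x₀, x⟫ ^ 2 := by positivity
  have hcone' : 1 - ⟪x₀, x⟫ ^ 2 ≤ ρ ^ 2 * ⟪x₀, x⟫ ^ 2 := by
    refine le_trans (le_of_eq ?_) hcone
    rw [← real_inner_self_eq_norm_sq]
    simp only [inner_sub_left, inner_sub_right, real_inner_smul_left, real_inner_smul_right, hx1,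
      hx00, hxc]
    ring
  have hc2 : c ^ 2 ≤ Λ ^ 2 := by
    rw [hΛ2, hc, inv_pow, inv_le_iff_one_le_mul₀ hx2]
    linarith
  have hcΛ : |c| ≤ Λ := abs_le_of_sq_le_sq hc2 (by positivity)
  have hcpow : ∀ k ≤ D, (c ^ k) ^ 2 ≤ (Λ ^ D) ^ 2 := by
    intro k hk
    rw [← sq_abs, abs_pow]
    refine pow_le_pow_left₀ (by positivity) ?_ 2
    exact (pow_le_pow_left₀ (abs_nonneg _) hcΛ k).trans (pow_le_pow_right₀ hΛ1 hk)
  set z := c • x₀ - x with hz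
  have hxz : ⟪x, z⟫ = 0 := by
    rw [hz, inner_sub_right, real_inner_smul_right, hxc, hcx, hx1, sub_self]
  have hz2 : ‖z‖ ^ 2 = c ^ 2 - 1 := by
    rw [← real_inner_self_eq_norm_sq, hz]
    simp only [inner_sub_left, inner_sub_right, real_inner_smul_left, real_inner_smul_right, hx1,
      hx00, hxc]
    linear_combination (-2) * hcx
  have hzρ : ‖z‖ ^ 2 ≤ ρ ^ 2 := by rw [hz2]; linarith
  have hxz' : x + z = c • x₀ := by rw [hz]; abel
  have hdpos : ∀ i, (0 : ℝ) < d i := fun i => by exact_mod_cast hd i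
  have hpow : ∀ k, (1 + ‖z‖ ^ 2) ^ k ≤ Λ ^ (2 * k) := fun k => by
    rw [pow_mul, hΛ2]
    exact pow_le_pow_left₀ (by positivity) (by linarith) k
  have hd1 : ∀ i, ((d i - 1 : ℕ) : ℝ) ≤ (D - 1 : ℕ) := fun i => by
    exact_mod_cast Nat.sub_le_sub_right (hD i) 1
  have hf2 : ‖f‖ ^ 2 ≤ R ^ 2 := pow_le_pow_left₀ (norm_nonneg _) hf 2
  have hke : ∑ i, ⟪f, K.ke i x₀⟫ ^ 2 ≤ ε ^ 2 := by
    have : 0 ≤ ∑ i, (⟪f, K.kd i x₀ v₀⟫ / √(d i)) ^ 2 := Finset.sum_nonneg fun i _ => sq_nonneg _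
    linarith
  have hkd : ∑ i, (⟪f, K.kd i x₀ v₀⟫ / √(d i)) ^ 2 ≤ ε ^ 2 := by
    have : 0 ≤ ∑ i, ⟪f, K.ke i x₀⟫ ^ 2 := Finset.sum_nonneg fun i _ => sq_nonneg _
    linarith
  refine ⟨⟨fun k => ⟪o k.succ, z⟫, ?_, ?_⟩, ?_⟩
  · have h1 := o.sum_sq_inner_right z
    rw [Fin.sum_univ_succ, ← hx, hxz] at h1
    linarith
  · set T : Fin (p + 1) → E := fun i =>
      (-(√(d i))⁻¹) • (K.ke i (x + z) - K.ke i x - K.kd i x z) with hT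
    have hTo : ∀ i j, i ≠ j → ⟪T i, T j⟫ = 0 := by
      intro i j hij
      simp only [hT, inner_sub_left, inner_sub_right, real_inner_smul_left, real_inner_smul_right,
        K.inner_ke_ke, K.inner_ke_kd, K.inner_kd_ke, K.inner_kd_kd, if_neg hij]
      ring
    have hTn : ∀ i, ‖T i‖ ^ 2 ≤ (D - 1 : ℕ) / 2 * (ρ ^ 2 * Λ ^ D) ^ 2 := by
      intro i
      rw [hT]
      simp only
      rw [norm_smul, mul_pow, norm_neg, Real.norm_eq_abs, sq_abs, inv_pow,
        Real.sq_sqrt (hdpos i).le]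
      refine (mul_le_mul_of_nonneg_left (K.norm_taylor_sq_le i hx1 hxz (hd i))
        (inv_nonneg.2 (hdpos i).le)).trans ?_
      rw [inv_mul_cancel_left₀ (hdpos i).ne', mul_pow, ← pow_mul Λ, mul_comm D 2, ← mul_assoc]
      have h1 : ‖z‖ ^ 4 ≤ (ρ ^ 2) ^ 2 := by
        calc ‖z‖ ^ 4 = (‖z‖ ^ 2) ^ 2 := by ring
          _ ≤ _ := pow_le_pow_left₀ (by positivity) hzρ 2
      have h2 : (1 + ‖z‖ ^ 2) ^ (d i - 2) ≤ Λ ^ (2 * D) :=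
        (hpow _).trans (pow_le_pow_right₀ hΛ1 (by have := hD i; omega))
      have := hd1 i
      gcongr
    have h1 := sum_inner_sq_le_of_orthogonal T hTo (by positivity) hTn f
    have h2 : ∑ i, ⟪f, T i⟫ ^ 2 ≤ (G * ρ ^ 2 * Λ ^ D) ^ 2 := by
      refine h1.trans ?_
      calc _ ≤ (D - 1 : ℕ) / 2 * (ρ ^ 2 * Λ ^ D) ^ 2 * R ^ 2 := by gcongr
        _ = ((D - 1 : ℕ) / 2 * R ^ 2) * (ρ ^ 2 * Λ ^ D) ^ 2 := by ring
        _ ≤ G ^ 2 * (ρ ^ 2 * Λ ^ D) ^ 2 := by gcongr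
        _ = _ := by ring
    have h3 : ∑ i, (c ^ d i / √(d i) * ⟪f, K.ke i x₀⟫) ^ 2 ≤ (Λ ^ D * ε) ^ 2 := by
      refine sum_mul_sq_le (fun i => ?_) hke
      rw [div_pow, Real.sq_sqrt (hdpos i).le]
      exact (div_le_self (sq_nonneg _) (by exact_mod_cast hd i)).trans (hcpow _ (hD i))
    have h4 := sum_add_sq_le (by positivity) (by positivity) h3 h2
    refine le_trans (le_of_eq ?_) (h4.trans (le_of_eq (by ring)))
    refine Finset.sum_congr rfl fun i _ => ?_
    congr 1
    rw [K.sum_columns_mul o f hxz i, hT]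
    simp only [columns, Fin.cons_zero]
    rw [real_inner_smul_right, inner_sub_right, inner_sub_right, hxz', K.ke_smul,
      real_inner_smul_right]
    ring
  set β := ⟪v₀, x⟫ * c with hβ
  have hβ2 : β ^ 2 ≤ ρ ^ 2 := by
    have h1 : ⟪v₀, x - ⟪x₀, x⟫ • x₀⟫ = ⟪v₀, x⟫ := by
      rw [inner_sub_right, real_inner_smul_right, hvx, mul_zero, sub_zero]
    have h2 := abs_real_inner_le_norm v₀ (x - ⟪x₀, x⟫ • x₀)
    rw [h1, hv₀, one_mul] at h2
    have h3 : ⟪v₀, x⟫ ^ 2 ≤ ρ ^ 2 * ⟪x₀, x⟫ ^ 2 := by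
      rw [← sq_abs]
      exact (pow_le_pow_left₀ (abs_nonneg _) h2 2).trans hcone
    calc β ^ 2 = ⟪v₀, x⟫ ^ 2 * c ^ 2 := by rw [hβ, mul_pow]
      _ ≤ (ρ ^ 2 * ⟪x₀, x⟫ ^ 2) * c ^ 2 := by gcongr
      _ = ρ ^ 2 * (c * ⟪x₀, x⟫) ^ 2 := by ring
      _ = ρ ^ 2 := by rw [hcx]; ring
  set y := v₀ - β • x₀ with hyd
  have hxy : ⟪x, y⟫ = 0 := by
    rw [hyd, inner_sub_right, real_inner_smul_right, hxc, real_inner_comm, hβ]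
    linear_combination (-⟪v₀, x⟫) * hcx
  have hy2 : ‖y‖ ^ 2 ≤ 1 + ρ ^ 2 := by
    rw [← real_inner_self_eq_norm_sq, hyd]
    simp only [inner_sub_left, inner_sub_right, real_inner_smul_left, real_inner_smul_right, hv00,
      hx00, hxv, hvx]
    linarith
  have hy1 : h ≤ |⟪o 1, y⟫| := by
    rw [hyd, inner_sub_right, real_inner_smul_right, real_inner_comm v₀, real_inner_comm x₀, hβ]
    exact hy
  have hyne : ⟪o 1, y⟫ ≠ 0 := fun h0 => by rw [h0, abs_zero] at hy1; linarith
  have hinv : (⟪o 1, y⟫⁻¹) ^ 2 ≤ (h⁻¹) ^ 2 := by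
    rw [← sq_abs, abs_inv]
    exact pow_le_pow_left₀ (by positivity) (inv_anti₀ hh hy1) 2
  have hBy : ∑ i, (⟪f, K.kd i x y⟫ / √(d i)) ^ 2 ≤
      (Λ ^ D * ((1 + ρ * √D) * ε + 2 * G * ρ)) ^ 2 := by
    set T : Fin (p + 1) → E := fun i =>
      (-(√(d i))⁻¹) • (K.kd i (x + z) y - K.kd i x y) with hT
    have hTo : ∀ i j, i ≠ j → ⟪T i, T j⟫ = 0 := by
      intro i j hij
      simp only [hT, inner_sub_left, inner_sub_right, real_inner_smul_left, real_inner_smul_right,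
        K.inner_kd_kd, if_neg hij]
      ring
    have hTn : ∀ i, ‖T i‖ ^ 2 ≤ (D - 1 : ℕ) / 2 * (2 * ρ * Λ ^ D) ^ 2 := by
      intro i
      rw [hT]
      simp only
      rw [norm_smul, mul_pow, norm_neg, Real.norm_eq_abs, sq_abs, inv_pow,
        Real.sq_sqrt (hdpos i).le]
      refine (mul_le_mul_of_nonneg_left (K.norm_kd_sub_sq_le i hx1 hxz hxy (hd i))
        (inv_nonneg.2 (hdpos i).le)).trans ?_
      rw [inv_mul_cancel_left₀ (hdpos i).ne']
      have h2 : (1 + ‖z‖ ^ 2) ^ (d i - 2) * ‖y‖ ^ 2 ≤ (Λ ^ D) ^ 2 := by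
        calc _ ≤ Λ ^ (2 * (d i - 2)) * Λ ^ 2 := by
              rw [hΛ2]; exact mul_le_mul (hpow _) hy2 (by positivity) (by positivity)
          _ = Λ ^ (2 * (d i - 2) + 2) := by rw [pow_add]
          _ ≤ Λ ^ (D * 2) := pow_le_pow_right₀ hΛ1 (by have := hD i; have := hd i; omega)
          _ = _ := pow_mul _ _ _
      calc _ = 2 * ((d i - 1 : ℕ) : ℝ) * ‖z‖ ^ 2 * ((1 + ‖z‖ ^ 2) ^ (d i - 2) * ‖y‖ ^ 2) := by ring
        _ ≤ 2 * ((D - 1 : ℕ) : ℝ) * ρ ^ 2 * (Λ ^ D) ^ 2 := by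
          have := hd1 i
          gcongr
        _ = _ := by ring
    have h1 := sum_inner_sq_le_of_orthogonal T hTo (by positivity) hTn f
    have h2 : ∑ i, ⟪f, T i⟫ ^ 2 ≤ (2 * G * ρ * Λ ^ D) ^ 2 := by
      refine h1.trans ?_
      calc _ ≤ (D - 1 : ℕ) / 2 * (2 * ρ * Λ ^ D) ^ 2 * R ^ 2 := by gcongr
        _ = ((D - 1 : ℕ) / 2 * R ^ 2) * (2 * ρ * Λ ^ D) ^ 2 := by ring
        _ ≤ G ^ 2 * (2 * ρ * Λ ^ D) ^ 2 := by gcongr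
        _ = _ := by ring
    have h3 : ∑ i, (c ^ (d i - 1) * (⟪f, K.kd i x₀ v₀⟫ / √(d i))) ^ 2 ≤ (Λ ^ D * ε) ^ 2 :=
      sum_mul_sq_le (fun i => hcpow _ ((Nat.sub_le _ _).trans (hD i))) hkd
    have h4 : ∑ i, (-(c ^ (d i - 1) * β * √(d i)) * ⟪f, K.ke i x₀⟫) ^ 2 ≤
        (Λ ^ D * ρ * √D * ε) ^ 2 := by
      refine sum_mul_sq_le (fun i => ?_) hke
      have h5 := hcpow _ ((Nat.sub_le (d i) 1).trans (hD i))
      have h6 : (d i : ℝ) ≤ D := by exact_mod_cast hD i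
      calc (-(c ^ (d i - 1) * β * √(d i))) ^ 2 = (c ^ (d i - 1)) ^ 2 * β ^ 2 * √(d i) ^ 2 := by ring
        _ = (c ^ (d i - 1)) ^ 2 * β ^ 2 * d i := by rw [Real.sq_sqrt (hdpos i).le]
        _ ≤ (Λ ^ D) ^ 2 * ρ ^ 2 * D :=
          mul_le_mul (mul_le_mul h5 hβ2 (sq_nonneg _) (sq_nonneg _)) h6 (hdpos i).le (by positivity)
        _ = (Λ ^ D) ^ 2 * ρ ^ 2 * √D ^ 2 := by rw [Real.sq_sqrt (Nat.cast_nonneg D)]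
        _ = _ := by ring
    have h5 := sum_add_sq_le (by positivity) (by positivity)
      (sum_add_sq_le (by positivity) (by positivity) h3 h4) h2
    refine le_trans (le_of_eq ?_) (h5.trans (le_of_eq (by ring)))
    refine Finset.sum_congr rfl fun i _ => ?_
    congr 1
    have h6 : √(d i : ℝ) * √(d i) = d i := Real.mul_self_sqrt (hdpos i).le
    have h7 : √(d i : ℝ) ≠ 0 := (Real.sqrt_pos.2 (hdpos i)).ne'
    have h8 : K.kd i (c • x₀) y = c ^ (d i - 1) • (K.kd i x₀ v₀ - β • ((d i : ℝ) • K.ke i x₀)) := by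
      rw [K.kd_smul, hyd, map_sub, map_smul, K.kd_self hd]
    rw [hT]
    simp only
    rw [real_inner_smul_right, inner_sub_right, hxz', h8, real_inner_smul_right, inner_sub_right,
      real_inner_smul_right, real_inner_smul_right]
    field_simp
    linear_combination (β * ⟪f, K.ke i x₀⟫ * c ^ (d i - 1)) * h6
  refine ⟨fun k => ⟪o k.succ.succ, y⟫ * ⟪o 1, y⟫⁻¹, ?_, ?_⟩
  · have h1 := o.sum_sq_inner_right y
    rw [Fin.sum_univ_succ, Fin.sum_univ_succ] at h1
    simp only [mul_pow]
    rw [← Finset.sum_mul, div_eq_mul_inv, ← inv_pow]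
    refine mul_le_mul ?_ hinv (sq_nonneg _) (by positivity)
    refine le_trans ?_ (h1.le.trans hy2)
    rw [← add_assoc]
    exact le_add_of_nonneg_left (by positivity)
  · rw [div_eq_mul_inv, mul_pow _ h⁻¹]
    refine le_trans (le_of_eq ?_) (mul_le_mul hBy hinv (sq_nonneg _) (sq_nonneg _))
    rw [Finset.sum_mul]
    refine Finset.sum_congr rfl fun i _ => ?_
    rw [← mul_pow, ← K.sum_columns_mul o f hxy i, Fin.sum_univ_succ, add_mul, Finset.sum_mul]
    congr 2
    · rw [Fin.succ_zero_eq_one, mul_assoc, mul_inv_cancel₀ hyne, mul_one]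
    · exact Finset.sum_congr rfl fun k _ => by ring
end EvalKernels
end NearSingular

section Columns
open ProbabilityTheory

lemma continuous_of_inner {X E : Type*} [TopologicalSpace X] [NormedAddCommGroup E]
    [InnerProductSpace ℝ E] (g : X → E) (h : Continuous fun q : X × X => ⟪g q.1, g q.2⟫) :
    Continuous g := by
  rw [continuous_iff_continuousAt]
  intro a
  rw [ContinuousAt, tendsto_iff_norm_sub_tendsto_zero]
  have h1 : ∀ x, ‖g x - g a‖ = √(⟪g x, g x⟫ - 2 * ⟪g x, g a⟫ + ⟪g a, g a⟫) := fun x => by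
    rw [← Real.sqrt_sq (norm_nonneg (g x - g a)), norm_sub_sq_real, real_inner_self_eq_norm_sq,
      real_inner_self_eq_norm_sq]
  simp_rw [h1]
  have h2 : Continuous fun x => ⟪g x, g x⟫ := h.comp (continuous_id.prodMk continuous_id)
  have h3 : Continuous fun x => ⟪g x, g a⟫ := h.comp (continuous_id.prodMk continuous_const)
  have h4 : Continuous fun x => √(⟪g x, g x⟫ - 2 * ⟪g x, g a⟫ + ⟪g a, g a⟫) := by fun_prop
  convert h4.tendsto a using 2
  rw [eq_comm, Real.sqrt_eq_zero']
  linarith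

lemma exists_orthonormalBasis_pair {V : Type*} [NormedAddCommGroup V] [InnerProductSpace ℝ V]
    [FiniteDimensional ℝ V] {p : ℕ} (hV : Module.finrank ℝ V = p + 2) {a b : V} (ha : ‖a‖ = 1)
    (hb : ‖b‖ = 1) (hab : ⟪a, b⟫ = 0) :
    ∃ o : OrthonormalBasis (Fin (p + 2)) ℝ V, o 0 = a ∧ o 1 = b := by
  have h : Orthonormal ℝ (({0, 1} : Set (Fin (p + 2))).restrict
      (Fin.cons a (fun _ => b) : Fin (p + 2) → V)) := by
    constructor
    · rintro ⟨i, rfl | rfl⟩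
      · exact ha
      · exact hb
    · rintro ⟨i, rfl | rfl⟩ ⟨j, rfl | rfl⟩ hij
      · exact absurd rfl hij
      · exact hab
      · exact (real_inner_comm _ _).trans hab
      · exact absurd rfl hij
  obtain ⟨o, ho⟩ := h.exists_orthonormalBasis_extension_of_card_eq (by simpa using hV)
  exact ⟨o, ho 0 (by simp), ho 1 (by simp)⟩

lemma exists_orthonormalBasis_zero {V : Type*} [NormedAddCommGroup V] [InnerProductSpace ℝ V]
    [FiniteDimensional ℝ V] {p : ℕ} (hV : Module.finrank ℝ V = p + 1) {a : V} (ha : ‖a‖ = 1) :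
    ∃ o : OrthonormalBasis (Fin (p + 1)) ℝ V, o 0 = a := by
  have h : Orthonormal ℝ (({0} : Set (Fin (p + 1))).restrict (fun _ => a)) := by
    constructor
    · rintro ⟨i, rfl⟩
      exact ha
    · rintro ⟨i, rfl⟩ ⟨j, rfl⟩ hij
      exact absurd rfl hij
  obtain ⟨o, ho⟩ := h.exists_orthonormalBasis_extension_of_card_eq (by simpa using hV)
  exact ⟨o, ho 0 (by simp)⟩

namespace EvalKernels

section
variable {n : ℕ} {d : Fin n → ℕ} {E V : Type*} [NormedAddCommGroup E]
    [InnerProductSpace ℝ E] [NormedAddCommGroup V] [InnerProductSpace ℝ V] (K : EvalKernels d E V)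

lemma continuous_ke (i : Fin n) : Continuous (K.ke i) := by
  refine continuous_of_inner _ ?_
  simp only [K.inner_ke_ke, if_true]
  fun_prop

lemma continuous_kd (i : Fin n) : Continuous fun q : V × V => K.kd i q.1 q.2 := by
  refine continuous_of_inner _ ?_
  simp only [K.inner_kd_kd, if_true]
  fun_prop
end

variable {p : ℕ} {d : Fin (p + 1) → ℕ} {E V : Type*} [NormedAddCommGroup E]
    [InnerProductSpace ℝ E] [NormedAddCommGroup V] [InnerProductSpace ℝ V] (K : EvalKernels d E V)

lemma map_columns [FiniteDimensional ℝ E] [MeasurableSpace E] [BorelSpace E]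
    (hd : ∀ i, 1 ≤ d i) (o : OrthonormalBasis (Fin (p + 2)) ℝ V) :
    MeasurePreserving (K.columns o) (stdGaussian E)
      (Measure.pi fun _ : Fin (p + 2) => gaussPi (p + 1)) := by
  have ho : ∀ a b, ⟪o a, o b⟫ = if a = b then (1 : ℝ) else 0 :=
    orthonormal_iff_ite.1 o.orthonormal
  have hdpos : ∀ i, (0 : ℝ) < d i := fun i => by exact_mod_cast hd i
  set e : Fin (p + 2) × Fin (p + 1) → E := fun q =>
    (Fin.cons (K.ke q.2 (o 0)) (fun k => (√(d q.2))⁻¹ • K.kd q.2 (o 0) (o k.succ)) :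
      Fin (p + 2) → E) q.1 with he
  have heo : Orthonormal ℝ e := by
    rw [orthonormal_iff_ite]
    rintro ⟨k, i⟩ ⟨l, j⟩
    have hs : √(d i : ℝ) * √(d i) = d i := Real.mul_self_sqrt (hdpos i).le
    have hs0 : √(d i : ℝ) ≠ 0 := (Real.sqrt_pos.2 (hdpos i)).ne'
    refine Fin.cases ?_ (fun k => ?_) k <;> refine Fin.cases ?_ (fun l => ?_) l <;>
      simp only [he, Fin.cons_zero, Fin.cons_succ, real_inner_smul_left, real_inner_smul_right,
        K.inner_ke_ke, K.inner_ke_kd, K.inner_kd_ke, K.inner_kd_kd, ho, Prod.mk.injEq]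
    · simp
    · simp [(Fin.succ_ne_zero l).symm]
    · simp [(Fin.succ_ne_zero k)]
    · by_cases hij : i = j
      · subst hij
        simp only [(Fin.succ_ne_zero _), (Fin.succ_ne_zero _).symm, if_true, if_false, one_pow,
          Fin.succ_inj, and_true]
        split_ifs
        · field_simp
          linear_combination -hs
        · simp
      · simp [hij]
  have hcont : Continuous fun f => fun q => ⟪f, e q⟫ := by fun_prop
  have h1 : MeasurePreserving (fun (f : E) q => ⟪f, e q⟫) (stdGaussian E)
      (Measure.pi fun _ : Fin (p + 2) × Fin (p + 1) => gaussianReal 0 1) :=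
    ⟨hcont.measurable, stdGaussian_map_coord e heo⟩
  have h2 : MeasurePreserving (MeasurableEquiv.curry (Fin (p + 2)) (Fin (p + 1)) ℝ)
      (Measure.pi fun _ : Fin (p + 2) × Fin (p + 1) => gaussianReal 0 1)
      (Measure.pi fun _ : Fin (p + 2) => gaussPi (p + 1)) := by
    refine ⟨MeasurableEquiv.measurable _, ?_⟩
    have := Measure.infinitePi_map_curry
      (fun (_ : Fin (p + 2)) (_ : Fin (p + 1)) => gaussianReal 0 1)
    simpa only [Measure.infinitePi_eq_pi] using this
  have h3 : K.columns o = MeasurableEquiv.curry (Fin (p + 2)) (Fin (p + 1)) ℝ ∘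
      fun (f : E) q => ⟪f, e q⟫ := by
    ext f k i
    refine Fin.cases ?_ (fun k => ?_) k
    · rfl
    · simp only [columns, Fin.cons_succ, Function.comp, MeasurableEquiv.curry, he]
      show _ = ⟪f, (√(d i : ℝ))⁻¹ • K.kd i (o 0) (o k.succ)⟫
      rw [real_inner_smul_right]
      ring
  rw [h3]
  exact h2.comp h1
end EvalKernels
end Columns

section Fat
open ProbabilityTheory

/-- The orthonormal pairs of vectors of `V`. -/
def orthPairs (V : Type*) [NormedAddCommGroup V] [InnerProductSpace ℝ V] : Set (V × V) :=
  {w | ‖w.1‖ = 1 ∧ ‖w.2‖ = 1 ∧ ⟪w.1, w.2⟫ = 0}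

lemma isCompact_orthPairs (V : Type*) [NormedAddCommGroup V] [InnerProductSpace ℝ V]
    [FiniteDimensional ℝ V] : IsCompact (orthPairs V) := by
  have : ProperSpace V := FiniteDimensional.proper ℝ V
  refine ((isCompact_closedBall (0 : V) 1).prod (isCompact_closedBall (0 : V) 1)).of_isClosed_subset
    ?_ ?_
  · exact (isClosed_eq (by fun_prop) continuous_const).inter
      ((isClosed_eq (by fun_prop) continuous_const).inter
        (isClosed_eq (by fun_prop) continuous_const))
  · rintro w ⟨h1, h2, -⟩
    exact ⟨by simp [h1], by simp [h2]⟩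

namespace EvalKernels

section
variable {n : ℕ} {d : Fin n → ℕ} {E V : Type*} [NormedAddCommGroup E]
    [InnerProductSpace ℝ E] [NormedAddCommGroup V] [InnerProductSpace ℝ V] (K : EvalKernels d E V)

/-- The squared size of the value and of the normalized derivative of `f` at a unit vector, in
the direction of another. -/
noncomputable def resid (f : E) (w : V × V) : ℝ :=
  ∑ i, ⟪f, K.ke i w.1⟫ ^ 2 + ∑ i, (⟪f, K.kd i w.1 w.2⟫ / √(d i)) ^ 2

lemma continuous_resid : Continuous fun q : E × (V × V) => K.resid q.1 q.2 := by
  have h1 : ∀ i, Continuous fun q : E × (V × V) => K.ke i q.2.1 := fun i =>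
    (K.continuous_ke i).comp (by fun_prop)
  have h2 : ∀ i, Continuous fun q : E × (V × V) => K.kd i q.2.1 q.2.2 := fun i =>
    (K.continuous_kd i).comp (by fun_prop : Continuous fun q : E × (V × V) => (q.2.1, q.2.2))
  unfold resid
  fun_prop

/-- The points with a residual at most `(‖f‖ / t) ^ 2` at some orthonormal pair. -/
def illSet (t : ℝ) : Set E :=
  {f | ∃ w ∈ orthPairs V, K.resid f w ≤ (‖f‖ / t) ^ 2}

lemma isClosed_illSet [FiniteDimensional ℝ V] (t : ℝ) : IsClosed (K.illSet t) := by
  refine isClosed_exists_mem_compact (isCompact_orthPairs V)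
    (C := {q : (V × V) × E | K.resid q.2 q.1 ≤ (‖q.2‖ / t) ^ 2}) (isClosed_le ?_ (by fun_prop))
  exact K.continuous_resid.comp (by fun_prop : Continuous fun q : (V × V) × E => (q.2, q.1))

/-- The thickening of the bad set by the vectors `x`, `v` near an orthonormal pair with small
residual. -/
def fatSet (ε R ρ s : ℝ) : Set (E × V × V) :=
  {q | q.2.1 ≠ 0 ∧ ∃ w ∈ orthPairs V, K.resid q.1 w ≤ ε ^ 2 ∧ ‖q.1‖ ≤ R ∧
    ‖q.2.1 - ⟪w.1, q.2.1⟫ • w.1‖ ^ 2 ≤ ρ ^ 2 * ⟪w.1, q.2.1⟫ ^ 2 ∧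
    s * |⟪w.1, q.2.1⟫| ≤ |⟪w.2, q.2.2⟫ * ⟪w.1, q.2.1⟫ - ⟪w.2, q.2.1⟫ * ⟪w.1, q.2.2⟫|}

lemma measurableSet_fatSet [FiniteDimensional ℝ V] [FiniteDimensional ℝ E] [MeasurableSpace V]
    [BorelSpace V] [MeasurableSpace E] [BorelSpace E] (ε R ρ s : ℝ) :
    MeasurableSet (K.fatSet ε R ρ s) := by
  have h1 : IsClosed {q : E × V × V | ∃ w ∈ orthPairs V, K.resid q.1 w ≤ ε ^ 2 ∧ ‖q.1‖ ≤ R ∧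
    ‖q.2.1 - ⟪w.1, q.2.1⟫ • w.1‖ ^ 2 ≤ ρ ^ 2 * ⟪w.1, q.2.1⟫ ^ 2 ∧
    s * |⟪w.1, q.2.1⟫| ≤ |⟪w.2, q.2.2⟫ * ⟪w.1, q.2.1⟫ - ⟪w.2, q.2.1⟫ * ⟪w.1, q.2.2⟫|} := by
    refine isClosed_exists_mem_compact (isCompact_orthPairs V)
      (C := {q : (V × V) × (E × V × V) | K.resid q.2.1 q.1 ≤ ε ^ 2 ∧ ‖q.2.1‖ ≤ R ∧
        ‖q.2.2.1 - ⟪q.1.1, q.2.2.1⟫ • q.1.1‖ ^ 2 ≤ ρ ^ 2 * ⟪q.1.1, q.2.2.1⟫ ^ 2 ∧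
        s * |⟪q.1.1, q.2.2.1⟫| ≤ |⟪q.1.2, q.2.2.2⟫ * ⟪q.1.1, q.2.2.1⟫ -
          ⟪q.1.2, q.2.2.1⟫ * ⟪q.1.1, q.2.2.2⟫|}) ?_
    simp only [Set.ofPred_and]
    refine IsClosed.inter ?_ (IsClosed.inter ?_ (IsClosed.inter ?_ ?_))
    rotate_left
    · exact isClosed_le (by fun_prop) (by fun_prop)
    · exact isClosed_le (by fun_prop) (by fun_prop)
    · exact isClosed_le (by fun_prop) (by fun_prop)
    refine isClosed_le ?_ continuous_const
    exact K.continuous_resid.comp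
      (by fun_prop : Continuous fun q : (V × V) × (E × V × V) => (q.2.1, q.1))
  have h2 : IsOpen {q : E × V × V | q.2.1 ≠ 0} := isOpen_ne_fun (by fun_prop) (by fun_prop)
  exact h2.measurableSet.inter h1.measurableSet
end

variable {p : ℕ} {d : Fin (p + 1) → ℕ} {E V : Type*} [NormedAddCommGroup E]
    [InnerProductSpace ℝ E] [NormedAddCommGroup V] [InnerProductSpace ℝ V] (K : EvalKernels d E V)

/-- The bound for the distance of the values to a singular system. -/
noncomputable def valueTol (D : ℕ) (ε R ρ : ℝ) : ℝ := √(1 + ρ ^ 2) ^ D * (ε + R * ρ ^ 2)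

/-- The bound for the distance of the derivatives to a singular system. -/
noncomputable def derivTol (D : ℕ) (ε R ρ : ℝ) : ℝ :=
  √(1 + ρ ^ 2) ^ D * ((1 + ρ * √D) * ε + 2 * R * ρ)

/-- The constant factor in the bound for the fibers of `fatSet`. -/
noncomputable def fiberConst (d : Fin (p + 1) → ℕ) (ρ q : ℝ) : ℝ≥0∞ :=
  ENNReal.ofReal (gaussPeak ^ (p + 1) * (∏ i, √(d i : ℝ)) *
    (ρ * √(1 + 1 / (p + 1 : ℕ))) ^ (p + 1)) * ballVol (p + 1) *
    ENNReal.ofReal (2 * gaussPeak * √((p + 1).factorial * (1 + (p + 1 : ℕ) * q ^ 2 / 2) ^ p))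

lemma fiber_le_of_basis [FiniteDimensional ℝ E] [MeasurableSpace E] [BorelSpace E]
    (hd : ∀ i, 1 ≤ d i) {D : ℕ} (hD : ∀ i, d i ≤ D) (o : OrthonormalBasis (Fin (p + 2)) ℝ V)
    {ρ ε R G h s : ℝ} (hρ : 0 < ρ) (hε : 0 < ε) (hG : 0 ≤ G) (hh : 0 < h)
    (hGR : (D - 1 : ℕ) / 2 * R ^ 2 ≤ G ^ 2) {x v : V} {l : ℝ} (hl : 0 < l) (hx : x = l • o 0)
    (hy : ∀ w ∈ orthPairs V, ⟪w.1, o 0⟫ ≠ 0 →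
      s * |⟪w.1, x⟫| ≤ |⟪w.2, v⟫ * ⟪w.1, x⟫ - ⟪w.2, x⟫ * ⟪w.1, v⟫| →
      h ≤ |⟪w.2, o 1⟫ - ⟪w.2, o 0⟫ * ⟪w.1, o 0⟫⁻¹ * ⟪w.1, o 1⟫|) :
    stdGaussian E {f | (f, x, v) ∈ K.fatSet ε R ρ s} ≤
      fiberConst d ρ (valueTol D ε G ρ / ρ) * ENNReal.ofReal (derivTol D ε G ρ / h *
        √((p + 1 : ℕ) * (p + 2) / 2 * (valueTol D ε G ρ / ρ) ^ 2 + (derivTol D ε G ρ / h) ^ 2)) := by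
  have hdpos : ∀ i, (0 : ℝ) < √(d i) := fun i => Real.sqrt_pos.2 (by exact_mod_cast hd i)
  have he : 0 < valueTol D ε G ρ := by unfold valueTol; positivity
  have hm : 0 ≤ derivTol D ε G ρ / h := by unfold derivTol; positivity
  have h1 : {f | (f, x, v) ∈ K.fatSet ε R ρ s} ⊆ K.columns o ⁻¹' nearSingularSet p
      (fun i => √(d i)) ρ (valueTol D ε G ρ) (derivTol D ε G ρ / h) ((1 + ρ ^ 2) / h ^ 2) := by
    rintro f ⟨hx0, w, hw, hres, hf, hcone, hs⟩
    simp only at hx0 hres hf hcone hs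
    have hcone' : ‖o 0 - ⟪w.1, o 0⟫ • w.1‖ ^ 2 ≤ ρ ^ 2 * ⟪w.1, o 0⟫ ^ 2 := by
      have e1 : x - ⟪w.1, x⟫ • w.1 = l • (o 0 - ⟪w.1, o 0⟫ • w.1) := by
        rw [hx, real_inner_smul_right, smul_sub, smul_smul]
      rw [e1, norm_smul, hx, real_inner_smul_right, mul_pow, mul_pow, Real.norm_eq_abs, sq_abs]
        at hcone
      have hl2 : 0 < l ^ 2 := by positivity
      refine le_of_mul_le_mul_left (hcone.trans (le_of_eq (by ring))) hl2
    have hne : ⟪w.1, o 0⟫ ≠ 0 := by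
      intro h0
      rw [h0, zero_smul, sub_zero, o.norm_eq_one] at hcone'
      norm_num at hcone'
    exact K.columns_mem_nearSingularSet hd hD o hw.1 hw.2.1 hw.2.2 hρ.le hε.le hG hh hGR hne hcone'
      (hy w hw hne hs) hf hres
  refine (measure_mono h1).trans ?_
  rw [(K.map_columns hd o).measure_preimage
    (isClosed_nearSingularSet _ _ _ _ _ _).measurableSet.nullMeasurableSet]
  refine (measure_nearSingularSet_le p _ hdpos hρ he hm rfl).trans ?_
  rw [fiberConst, mul_assoc _ (ENNReal.ofReal (2 * gaussPeak * _))]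
  refine mul_le_mul_right ?_ _
  refine (mul_le_mul_left (gaussianReal_Icc_le _) _).trans (le_of_eq ?_)
  have := gaussPeak_pos
  rw [← ENNReal.ofReal_mul (by positivity), ← ENNReal.ofReal_mul (by positivity),
    Real.sqrt_mul (by positivity)]
  congr 1
  have e2 : ((p + 1 : ℕ) * (valueTol D ε G ρ / ρ) ^ 2 * ((p : ℝ) + 2) / 2 +
    (derivTol D ε G ρ / h) ^ 2) = ((p + 1 : ℕ) * ((p : ℝ) + 2) / 2 * (valueTol D ε G ρ / ρ) ^ 2 +
    (derivTol D ε G ρ / h) ^ 2) := by ring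
  rw [e2]
  ring
end EvalKernels
end Fat

section Fibers
open ProbabilityTheory

lemma measurePreserving_inner_stdGaussian {E : Type*} [NormedAddCommGroup E]
    [InnerProductSpace ℝ E] [FiniteDimensional ℝ E] [MeasurableSpace E] [BorelSpace E] {e : E}
    (he : ‖e‖ = 1) : MeasurePreserving (fun f => ⟪f, e⟫) (stdGaussian E) (gaussianReal 0 1) := by
  have h1 : Orthonormal ℝ (fun _ : Unit => e) :=
    ⟨fun _ => he, fun i j hij => absurd (Subsingleton.elim i j) hij⟩
  have h2 : MeasurePreserving (fun (f : E) (_ : Unit) => ⟪f, e⟫) (stdGaussian E)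
      (Measure.pi fun _ => gaussianReal 0 1) :=
    ⟨(by fun_prop : Continuous fun (f : E) (_ : Unit) => ⟪f, e⟫).measurable,
      stdGaussian_map_coord _ h1⟩
  exact (measurePreserving_eval (fun _ : Unit => gaussianReal 0 1) ()).comp h2

lemma lintegral_inner_sq_stdGaussian {E : Type*} [NormedAddCommGroup E]
    [InnerProductSpace ℝ E] [FiniteDimensional ℝ E] [MeasurableSpace E] [BorelSpace E] {e : E}
    (he : ‖e‖ = 1) : ∫⁻ f, ENNReal.ofReal (⟪f, e⟫ ^ 2) ∂stdGaussian E = 1 := by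
  rw [← lintegral_sq_gaussianReal]
  exact (measurePreserving_inner_stdGaussian he).lintegral_comp
    (f := fun x => ENNReal.ofReal (x ^ 2)) (by fun_prop)

lemma lintegral_sum_inner_sq_stdGaussian {E : Type*} [NormedAddCommGroup E]
    [InnerProductSpace ℝ E] [FiniteDimensional ℝ E] [MeasurableSpace E] [BorelSpace E]
    {ι : Type*} [Fintype ι] {e : ι → E} (he : ∀ i, ‖e i‖ = 1) :
    ∫⁻ f, ENNReal.ofReal (∑ i, ⟪f, e i⟫ ^ 2) ∂stdGaussian E = Fintype.card ι := by
  have h : ∀ f : E, ENNReal.ofReal (∑ i, ⟪f, e i⟫ ^ 2) = ∑ i, ENNReal.ofReal (⟪f, e i⟫ ^ 2) :=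
    fun f => ENNReal.ofReal_sum_of_nonneg fun i _ => sq_nonneg _
  simp_rw [h]
  rw [lintegral_finsetSum _ fun i _ => by fun_prop]
  simp [lintegral_inner_sq_stdGaussian (he _)]

lemma lintegral_norm_sq_stdGaussian (E : Type*) [NormedAddCommGroup E]
    [InnerProductSpace ℝ E] [FiniteDimensional ℝ E] [MeasurableSpace E] [BorelSpace E] :
    ∫⁻ f, ENNReal.ofReal (‖f‖ ^ 2) ∂stdGaussian E = Module.finrank ℝ E := by
  have h := lintegral_sum_inner_sq_stdGaussian (stdOrthonormalBasis ℝ E).orthonormal.1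
  simp only [OrthonormalBasis.sum_sq_inner_left] at h
  simpa using h

lemma mul_sqrt_add_le {a A r μ : ℝ} (ha : 0 ≤ a) (hA : 0 ≤ A) (hμ : 0 < μ) :
    a * r * √(A + (a * r) ^ 2) ≤ a / 2 * (A / μ) + a / 2 * (μ + a ^ 2 / μ) * r ^ 2 := by
  set W := √(A + (a * r) ^ 2) with hW
  have hW2 : W ^ 2 = A + (a * r) ^ 2 := Real.sq_sqrt (by positivity)
  have h1 : 2 * (r * W) ≤ μ * r ^ 2 + W ^ 2 / μ := by
    have h2 : μ * r ^ 2 + W ^ 2 / μ - 2 * (r * W) = (μ * r - W) ^ 2 / μ := by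
      field_simp
      ring
    have h3 : 0 ≤ (μ * r - W) ^ 2 / μ := by positivity
    linarith
  calc a * r * W = a / 2 * (2 * (r * W)) := by ring
    _ ≤ a / 2 * (μ * r ^ 2 + W ^ 2 / μ) := by gcongr
    _ = _ := by rw [hW2]; ring

namespace EvalKernels
variable {p : ℕ} {d : Fin (p + 1) → ℕ} {E V : Type*} [NormedAddCommGroup E]
    [InnerProductSpace ℝ E] [NormedAddCommGroup V] [InnerProductSpace ℝ V] (K : EvalKernels d E V)

lemma fiber_le_of_pos [FiniteDimensional ℝ E] [MeasurableSpace E] [BorelSpace E]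
    [FiniteDimensional ℝ V] (hV : Module.finrank ℝ V = p + 2)
    (hd : ∀ i, 1 ≤ d i) {D : ℕ} (hD : ∀ i, d i ≤ D)
    {ρ ε R G s : ℝ} (hρ : 0 < ρ) (hε : 0 < ε) (hG : 0 ≤ G) (hs : 0 < s)
    (hGR : (D - 1 : ℕ) / 2 * R ^ 2 ≤ G ^ 2) {x : V} {l : ℝ} (hl : 0 < l)
    (b : OrthonormalBasis (Fin (p + 2)) ℝ V) (hx : x = l • b 0) (v : V) :
    stdGaussian E {f | (f, x, v) ∈ K.fatSet ε R ρ s} ≤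
      fiberConst d ρ (valueTol D ε G ρ / ρ) * ENNReal.ofReal (derivTol D ε G ρ / s *
        √(∑ k : Fin (p + 1), ⟪v, b k.succ⟫ ^ 2) *
        √((p + 1 : ℕ) * (p + 2) / 2 * (valueTol D ε G ρ / ρ) ^ 2 + (derivTol D ε G ρ / s *
        √(∑ k : Fin (p + 1), ⟪v, b k.succ⟫ ^ 2)) ^ 2)) := by
  have hsum : ∑ k : Fin (p + 1), ⟪v, b k.succ⟫ ^ 2 = ‖v - ⟪b 0, v⟫ • b 0‖ ^ 2 := by
    have h1 := b.sum_sq_inner_left v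
    rw [Fin.sum_univ_succ] at h1
    rw [norm_sub_sq_real, norm_smul, real_inner_smul_right, b.norm_eq_one, ← h1,
      real_inner_comm v (b 0), Real.norm_eq_abs, mul_one, sq_abs]
    ring
  rw [hsum, Real.sqrt_sq (norm_nonneg _)]
  set r := ‖v - ⟪b 0, v⟫ • b 0‖ with hr
  have hb0 : ⟪b 0, b 0⟫ = 1 := by rw [real_inner_self_eq_norm_sq, b.norm_eq_one, one_pow]
  rcases (norm_nonneg (v - ⟪b 0, v⟫ • b 0)).eq_or_lt with h0 | h0
  · have hv : v = ⟪b 0, v⟫ • b 0 := sub_eq_zero.1 (norm_eq_zero.1 h0.symm)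
    have hemp : {f | (f, x, v) ∈ K.fatSet ε R ρ s} = ∅ := by
      refine Set.eq_empty_iff_forall_notMem.2 ?_
      rintro f ⟨hx0, w, hw, -, -, hcone, hsv⟩
      simp only at hx0 hcone hsv
      have h2 : ⟪w.2, v⟫ * ⟪w.1, x⟫ - ⟪w.2, x⟫ * ⟪w.1, v⟫ = 0 := by
        rw [hx, hv]
        simp only [real_inner_smul_right]
        ring
      rw [h2, abs_zero] at hsv
      have h3 : ⟪w.1, x⟫ = 0 := by
        rw [← abs_nonpos_iff]
        exact nonpos_of_mul_nonpos_right hsv hs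
      rw [h3, zero_smul, sub_zero] at hcone
      refine hx0 (norm_eq_zero.1 (pow_eq_zero_iff (two_ne_zero) |>.1 ?_))
      exact le_antisymm (hcone.trans (by norm_num)) (sq_nonneg _)
    rw [hemp, measure_empty]
    exact zero_le
  · rw [← hr] at h0
    have ho1 : ‖r⁻¹ • (v - ⟪b 0, v⟫ • b 0)‖ = 1 := by
      rw [norm_smul, norm_inv, Real.norm_of_nonneg h0.le, ← hr, inv_mul_cancel₀ h0.ne']
    have ho2 : ⟪b 0, r⁻¹ • (v - ⟪b 0, v⟫ • b 0)⟫ = 0 := by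
      rw [real_inner_smul_right, inner_sub_right, real_inner_smul_right, hb0]
      ring
    obtain ⟨o, hoa, hob⟩ := exists_orthonormalBasis_pair hV (b.norm_eq_one 0) ho1 ho2
    have hv : v = ⟪b 0, v⟫ • o 0 + r • o 1 := by
      rw [hoa, hob, smul_smul, mul_inv_cancel₀ h0.ne', one_smul]
      abel
    have := K.fiber_le_of_basis hd hD o (h := s / r) (s := s) hρ hε hG (by positivity) hGR (v := v)
      hl (x := x) (by rw [hx, hoa]) (by
        intro w hw hne hsv
        have h3 : 0 < |⟪w.1, o 0⟫| := abs_pos.2 hne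
        rw [div_le_iff₀ h0]
        refine le_of_mul_le_mul_left ?_ (mul_pos hl h3)
        calc l * |⟪w.1, o 0⟫| * s = s * |⟪w.1, x⟫| := by
              rw [hx, ← hoa, real_inner_smul_right, abs_mul, abs_of_pos hl]; ring
          _ ≤ _ := hsv
          _ = |l * r * (⟪w.1, o 0⟫ *
              (⟪w.2, o 1⟫ - ⟪w.2, o 0⟫ * ⟪w.1, o 0⟫⁻¹ * ⟪w.1, o 1⟫))| := by
              congr 1
              rw [hv, hx, ← hoa]
              simp only [real_inner_smul_right, inner_add_right]
              field_simp
              ring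
          _ = _ := by
              rw [abs_mul, abs_of_pos (mul_pos hl h0), abs_mul]
              ring)
    rwa [div_div_eq_mul_div, mul_div_right_comm] at this

lemma lintegral_fiber_le_of_pos [FiniteDimensional ℝ E] [MeasurableSpace E] [BorelSpace E]
    [FiniteDimensional ℝ V] [MeasurableSpace V] [BorelSpace V] (hV : Module.finrank ℝ V = p + 2)
    (hd : ∀ i, 1 ≤ d i) {D : ℕ} (hD : ∀ i, d i ≤ D)
    {ρ ε R G s : ℝ} (hρ : 0 < ρ) (hε : 0 < ε) (hG : 0 ≤ G) (hs : 0 < s)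
    (hGR : (D - 1 : ℕ) / 2 * R ^ 2 ≤ G ^ 2) (x : V) :
    ∫⁻ v, stdGaussian E {f | (f, x, v) ∈ K.fatSet ε R ρ s} ∂stdGaussian V ≤
      fiberConst d ρ (valueTol D ε G ρ / ρ) * ENNReal.ofReal (derivTol D ε G ρ / s *
        √((p + 1 : ℕ) * ((p + 1 : ℕ) * (p + 2) / 2 * (valueTol D ε G ρ / ρ) ^ 2 +
          (derivTol D ε G ρ / s) ^ 2 * (p + 1 : ℕ)))) := by
  by_cases hx0 : x = 0
  · have : ∀ v, {f | (f, x, v) ∈ K.fatSet ε R ρ s} = ∅ := fun v =>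
      Set.eq_empty_iff_forall_notMem.2 fun f hf => hf.1 hx0
    simp [this]
  have hxn : 0 < ‖x‖ := norm_pos_iff.2 hx0
  obtain ⟨b, hb⟩ := exists_orthonormalBasis_zero (p := p + 1) hV (a := ‖x‖⁻¹ • x) (by
    rw [norm_smul, norm_inv, norm_norm, inv_mul_cancel₀ hxn.ne'])
  have hx : x = ‖x‖ • b 0 := by rw [hb, smul_smul, mul_inv_cancel₀ hxn.ne', one_smul]
  set a := derivTol D ε G ρ / s with ha
  set A : ℝ := (p + 1 : ℕ) * (p + 2) / 2 * (valueTol D ε G ρ / ρ) ^ 2 with hA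
  have ha0 : 0 ≤ a := by rw [ha]; unfold derivTol; positivity
  have hA0 : 0 < A := by
    have : 0 < valueTol D ε G ρ := by unfold valueTol; positivity
    positivity
  set W : ℝ := A + a ^ 2 * (p + 1 : ℕ) with hW
  have hW0 : 0 < W := by positivity
  set μ := √(W / (p + 1 : ℕ)) with hμ
  have hμ0 : 0 < μ := Real.sqrt_pos.2 (by positivity)
  have hμ2 : μ ^ 2 = W / (p + 1 : ℕ) := Real.sq_sqrt (by positivity)
  calc _ ≤ ∫⁻ v, fiberConst d ρ (valueTol D ε G ρ / ρ) * (ENNReal.ofReal (a / 2 * (A / μ)) +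
        ENNReal.ofReal (a / 2 * (μ + a ^ 2 / μ)) *
          ENNReal.ofReal (∑ k : Fin (p + 1), ⟪v, b k.succ⟫ ^ 2)) ∂stdGaussian V := by
        refine lintegral_mono fun v => ?_
        refine (K.fiber_le_of_pos hV hd hD hρ hε hG hs hGR hxn b hx v).trans ?_
        refine mul_le_mul_right ?_ _
        rw [← ENNReal.ofReal_mul (by positivity), ← ENNReal.ofReal_add (by positivity)
          (by positivity)]
        refine ENNReal.ofReal_le_ofReal ((mul_sqrt_add_le ha0 hA0.le hμ0).trans (le_of_eq ?_))
        rw [Real.sq_sqrt (Finset.sum_nonneg fun k _ => sq_nonneg _)]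
    _ = fiberConst d ρ (valueTol D ε G ρ / ρ) * (ENNReal.ofReal (a / 2 * (A / μ)) +
        ENNReal.ofReal (a / 2 * (μ + a ^ 2 / μ)) * (p + 1 : ℕ)) := by
        rw [lintegral_const_mul _ (by fun_prop), lintegral_add_left (by fun_prop),
          lintegral_const_mul _ (by fun_prop),
          lintegral_sum_inner_sq_stdGaussian fun k => b.norm_eq_one _]
        simp
    _ = _ := by
        rw [← ENNReal.ofReal_natCast (p + 1), ← ENNReal.ofReal_mul (by positivity),
          ← ENNReal.ofReal_add (by positivity) (by positivity)]
        congr 2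
        have h1 : √((p + 1 : ℕ) * W) = (p + 1 : ℕ) * μ := by
          rw [hμ, Real.sqrt_div' _ (by positivity), Real.sqrt_mul (by positivity)]
          have h2 := Real.mul_self_sqrt (show (0 : ℝ) ≤ (p + 1 : ℕ) by positivity)
          have h3 : √((p + 1 : ℕ) : ℝ) ≠ 0 := by positivity
          field_simp
          linear_combination h2
        rw [h1]
        have h4 : W = μ ^ 2 * (p + 1 : ℕ) := by rw [hμ2]; field_simp
        have h5 : A = μ ^ 2 * (p + 1 : ℕ) - a ^ 2 * (p + 1 : ℕ) := by rw [← h4, hW]; ring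
        rw [h5]
        field_simp
        ring

lemma fiber_le_of_zero {d : Fin 1 → ℕ} (K : EvalKernels d E V)
    [FiniteDimensional ℝ E] [MeasurableSpace E] [BorelSpace E]
    [FiniteDimensional ℝ V] (hV : Module.finrank ℝ V = 2)
    (hd : ∀ i, 1 ≤ d i) {D : ℕ} (hD : ∀ i, d i ≤ D)
    {ρ ε R G : ℝ} (hρ : 0 < ρ) (hε : 0 < ε) (hG : 0 ≤ G)
    (hGR : (D - 1 : ℕ) / 2 * R ^ 2 ≤ G ^ 2) (x v : V) :
    stdGaussian E {f | (f, x, v) ∈ K.fatSet ε R ρ 0} ≤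
      fiberConst d ρ (valueTol D ε G ρ / ρ) * ENNReal.ofReal (derivTol D ε G ρ *
        √((valueTol D ε G ρ / ρ) ^ 2 + derivTol D ε G ρ ^ 2)) := by
  by_cases hx0 : x = 0
  · have : {f | (f, x, v) ∈ K.fatSet ε R ρ 0} = ∅ :=
      Set.eq_empty_iff_forall_notMem.2 fun f hf => hf.1 hx0
    simp [this]
  have hxn : 0 < ‖x‖ := norm_pos_iff.2 hx0
  obtain ⟨o, ho⟩ := exists_orthonormalBasis_zero (p := 1) hV (a := ‖x‖⁻¹ • x) (by
    rw [norm_smul, norm_inv, norm_norm, inv_mul_cancel₀ hxn.ne'])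
  have hx : x = ‖x‖ • o 0 := by rw [ho, smul_smul, mul_inv_cancel₀ hxn.ne', one_smul]
  have := K.fiber_le_of_basis hd hD o (h := 1) (s := 0) hρ hε hG one_pos hGR (v := v) hxn hx (by
    intro w hw hne _
    set y := w.2 - (⟪w.2, o 0⟫ * ⟪w.1, o 0⟫⁻¹) • w.1 with hy
    have h1 : ⟪w.2, o 1⟫ - ⟪w.2, o 0⟫ * ⟪w.1, o 0⟫⁻¹ * ⟪w.1, o 1⟫ = ⟪y, o 1⟫ := by
      rw [hy, inner_sub_left, real_inner_smul_left]
    have h2 : ⟪y, o 0⟫ = 0 := by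
      rw [hy, inner_sub_left, real_inner_smul_left, inv_mul_cancel_right₀ hne, sub_self]
    have h3 := o.sum_sq_inner_left y
    rw [Fin.sum_univ_two, h2] at h3
    have h4 : ‖y‖ ^ 2 = 1 + (⟪w.2, o 0⟫ * ⟪w.1, o 0⟫⁻¹) ^ 2 := by
      rw [hy, norm_sub_sq_real, norm_smul, real_inner_smul_right, real_inner_comm w.1 w.2, hw.1, hw.2.1,
        hw.2.2, mul_one, Real.norm_eq_abs, sq_abs]
      ring
    rw [h1, ← one_le_sq_iff_one_le_abs]
    nlinarith [sq_nonneg (⟪w.2, o 0⟫ * ⟪w.1, o 0⟫⁻¹)])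
  norm_num at this ⊢
  exact this
end EvalKernels
end Fibers

section Cones
open ProbabilityTheory

lemma le_stdGaussian_slab_compl {V : Type*} [NormedAddCommGroup V]
    [InnerProductSpace ℝ V] [FiniteDimensional ℝ V] [MeasurableSpace V] [BorelSpace V] (u : V)
    (s : ℝ) :
    1 - ENNReal.ofReal (2 * gaussPeak * s) ≤ stdGaussian V {v | s * ‖u‖ ≤ |⟪v, u⟫|} := by
  by_cases hu : u = 0
  · simp [hu]
  have hn : 0 < ‖u‖ := norm_pos_iff.2 hu
  have he : ‖‖u‖⁻¹ • u‖ = 1 := by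
    rw [norm_smul, norm_inv, norm_norm, inv_mul_cancel₀ hn.ne']
  have h1 : {v | s * ‖u‖ ≤ |⟪v, u⟫|}ᶜ ⊆ (fun f => ⟪f, ‖u‖⁻¹ • u⟫) ⁻¹' {x | |x| ≤ s} := by
    intro v hv
    simp only [Set.mem_compl_iff, Set.mem_ofPred_eq, not_le, Set.mem_preimage] at hv ⊢
    rw [real_inner_smul_right, abs_mul, abs_inv, abs_norm, inv_mul_le_iff₀ hn, mul_comm]
    exact hv.le
  have h2 : stdGaussian V {v | s * ‖u‖ ≤ |⟪v, u⟫|}ᶜ ≤ ENNReal.ofReal (2 * gaussPeak * s) := by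
    refine (measure_mono h1).trans ?_
    rw [(measurePreserving_inner_stdGaussian he).measure_preimage
      (measurableSet_slab s).nullMeasurableSet]
    exact gaussianReal_Icc_le s
  have h3 : MeasurableSet {v : V | s * ‖u‖ ≤ |⟪v, u⟫|} :=
    measurableSet_le measurable_const (by fun_prop)
  rw [tsub_le_iff_right, ← prob_add_prob_compl (μ := stdGaussian V) h3]
  gcongr

lemma lintegral_abs_pow_mul_exp (n : ℕ) {b : ℝ} (hb : 0 < b) :
    ∫⁻ y : ℝ, ENNReal.ofReal (|y| ^ n * Real.exp (-b * y ^ 2)) =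
      ENNReal.ofReal ((√b ^ (n + 1))⁻¹ * Real.Gamma ((n + 1) / 2)) := by
  have h1 : ∫ y : ℝ, |y| ^ n * Real.exp (-b * y ^ 2) =
      (√b ^ (n + 1))⁻¹ * Real.Gamma ((n + 1) / 2) := by
    have h2 := integral_comp_abs (f := fun y => y ^ n * Real.exp (-b * y ^ 2))
    have h3 := integral_rpow_mul_exp_neg_mul_rpow (p := 2) (q := n) (b := b) two_pos
      (by have : (0 : ℝ) ≤ n := Nat.cast_nonneg n
          linarith) hb
    simp only [sq_abs] at h2
    rw [h2]
    simp only [Real.rpow_natCast, Real.rpow_ofNat] at h3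
    rw [h3]
    have h4 : b ^ (-((n : ℝ) + 1) / 2) = (√b ^ (n + 1))⁻¹ := by
      rw [Real.sqrt_eq_rpow, ← Real.rpow_natCast, ← Real.rpow_mul hb.le, ← Real.rpow_neg hb.le]
      congr 1
      push_cast
      ring
    rw [h4]
    ring
  rw [← h1, ofReal_integral_eq_lintegral_ofReal]
  · refine not_imp_comm.1 integral_undef ?_
    rw [h1]
    have : 0 < Real.Gamma (((n : ℝ) + 1) / 2) := Real.Gamma_pos_of_pos (by positivity)
    positivity
  · exact Filter.Eventually.of_forall fun y => by positivity

/-- The constant factor in the lower bound for the Gaussian measure of a round cone. -/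
noncomputable def coneConst (n : ℕ) (ρ : ℝ) : ℝ :=
  gaussPeak ^ (n + 1) * ρ ^ n * ((√((1 + ρ ^ 2) / 2) ^ (n + 1))⁻¹ * Real.Gamma ((n + 1) / 2))

lemma measurableSet_cone (n : ℕ) (ρ : ℝ) : MeasurableSet
    {y : Fin (n + 1) → ℝ | y 0 ≠ 0 ∧ ∑ k : Fin n, y k.succ ^ 2 ≤ ρ ^ 2 * y 0 ^ 2} := by
  rw [Set.ofPred_and]
  refine MeasurableSet.inter ?_ ?_
  · exact (measurableSet_singleton (0 : ℝ)).compl.preimage (measurable_pi_apply 0)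
  · exact measurableSet_le (by fun_prop) (by fun_prop)

lemma le_gaussPi_cone (n : ℕ) (hn : n ≠ 0) {ρ : ℝ} (hρ : 0 < ρ) :
    ENNReal.ofReal (coneConst n ρ) * ballVol n ≤
      gaussPi (n + 1) {y | y 0 ≠ 0 ∧ ∑ k : Fin n, y k.succ ^ 2 ≤ ρ ^ 2 * y 0 ^ 2} := by
  have hg := gaussPeak_pos
  set S : Set (Fin (n + 1) → ℝ) := {y | y 0 ≠ 0 ∧ ∑ k : Fin n, y k.succ ^ 2 ≤ ρ ^ 2 * y 0 ^ 2}
    with hS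
  have hSm : MeasurableSet S := measurableSet_cone n ρ
  have hcons : Measurable fun q : ℝ × (Fin n → ℝ) => (Fin.cons q.1 q.2 : Fin (n + 1) → ℝ) := by
    refine measurable_pi_iff.2 fun i => ?_
    refine Fin.cases ?_ (fun k => ?_) i
    · simpa using measurable_fst
    · simp only [Fin.cons_succ]
      fun_prop
  have hm : Measurable fun q : ℝ × (Fin n → ℝ) =>
      S.indicator (1 : (Fin (n + 1) → ℝ) → ℝ≥0∞) (Fin.cons q.1 q.2) :=
    (measurable_one.indicator hSm).comp hcons
  rw [← lintegral_indicator_one hSm, lintegral_pi_cons, lintegral_prod _ hm.aemeasurable]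
  have hpt : ∀ y : ℝ, ENNReal.ofReal (gaussPeak ^ n * ρ ^ n) *
      ENNReal.ofReal (|y| ^ n * Real.exp (-(ρ ^ 2 / 2) * y ^ 2)) * ballVol n ≤
      ∫⁻ z, S.indicator 1 (Fin.cons y z) ∂gaussPi n := by
    intro y
    by_cases hy : y = 0
    · simp [hy, hn]
    have hy0 : 0 < |y| := abs_pos.2 hy
    have hB : MeasurableSet {z : Fin n → ℝ | ∑ k, z k ^ 2 ≤ (ρ * |y|) ^ 2} :=
      measurableSet_le (by fun_prop) (by fun_prop)
    have h1 := le_gaussPi n _ hB ((ρ * |y|) ^ 2) fun x hx => hx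
    rw [volume_sum_sq_le (by positivity), ← mul_assoc, ← ENNReal.ofReal_mul (by positivity)] at h1
    have h2 : (fun z : Fin n → ℝ => S.indicator (1 : (Fin (n + 1) → ℝ) → ℝ≥0∞) (Fin.cons y z)) =
        {z : Fin n → ℝ | ∑ k, z k ^ 2 ≤ (ρ * |y|) ^ 2}.indicator 1 := by
      ext z
      simp only [Set.indicator, hS, Set.mem_ofPred_eq, Fin.cons_zero, Fin.cons_succ, mul_pow, sq_abs]
      simp [hy]
    rw [h2, lintegral_indicator_one hB, ← ENNReal.ofReal_mul (by positivity)]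
    refine le_trans (le_of_eq ?_) h1
    congr 2
    rw [mul_pow, mul_pow, sq_abs]
    ring_nf
  refine le_trans (le_of_eq ?_) (lintegral_mono hpt)
  rw [lintegral_mul_const _ (by fun_prop), lintegral_const_mul _ (by fun_prop),
    gaussianReal_of_var_ne_zero _ one_ne_zero,
    lintegral_withDensity_eq_lintegral_mul _ (by fun_prop) (by fun_prop)]
  congr 1
  have h3 : ∀ y : ℝ, (gaussianPDF 0 1 * fun y => ENNReal.ofReal
      (|y| ^ n * Real.exp (-(ρ ^ 2 / 2) * y ^ 2))) y = ENNReal.ofReal gaussPeak *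
        ENNReal.ofReal (|y| ^ n * Real.exp (-((1 + ρ ^ 2) / 2) * y ^ 2)) := by
    intro y
    rw [Pi.mul_apply, gaussianPDF_std, ← ENNReal.ofReal_mul (by positivity),
      ← ENNReal.ofReal_mul (by positivity)]
    congr 1
    have : Real.exp (-((1 + ρ ^ 2) / 2) * y ^ 2) =
        Real.exp (-(y ^ 2) / 2) * Real.exp (-(ρ ^ 2 / 2) * y ^ 2) := by
      rw [← Real.exp_add]
      congr 1
      ring
    rw [this]
    ring
  rw [lintegral_congr h3, lintegral_const_mul _ (by fun_prop),
    lintegral_abs_pow_mul_exp n (by positivity), ← ENNReal.ofReal_mul (by positivity),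
    ← ENNReal.ofReal_mul (by positivity), coneConst]
  congr 1
  ring

lemma le_stdGaussian_cone {V : Type*} [NormedAddCommGroup V] [InnerProductSpace ℝ V]
    [FiniteDimensional ℝ V] [MeasurableSpace V] [BorelSpace V] {p : ℕ}
    (hV : Module.finrank ℝ V = p + 2) {w : V} (hw : ‖w‖ = 1) {ρ : ℝ} (hρ : 0 < ρ) :
    ENNReal.ofReal (coneConst (p + 1) ρ) * ballVol (p + 1) ≤
      stdGaussian V {x | x ≠ 0 ∧ ‖x - ⟪w, x⟫ • w‖ ^ 2 ≤ ρ ^ 2 * ⟪w, x⟫ ^ 2} := by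
  obtain ⟨b, hb⟩ := exists_orthonormalBasis_zero (p := p + 1) hV hw
  have hmp : MeasurePreserving (fun (f : V) i => ⟪f, b i⟫) (stdGaussian V) (gaussPi (p + 2)) :=
    ⟨(by fun_prop : Continuous fun (f : V) i => ⟪f, b i⟫).measurable,
      stdGaussian_map_coord _ b.orthonormal⟩
  refine (le_gaussPi_cone (p + 1) (by omega) hρ).trans ?_
  rw [← hmp.measure_preimage]
  · refine measure_mono fun x hx => ?_
    simp only [Set.mem_preimage, Set.mem_ofPred_eq, hb] at hx ⊢
    refine ⟨fun h => hx.1 (by rw [h, inner_zero_left]), ?_⟩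
    have h1 := b.sum_sq_inner_left x
    rw [Fin.sum_univ_succ, hb] at h1
    rw [norm_sub_sq_real, norm_smul, hw, real_inner_smul_right, real_inner_comm x w,
      Real.norm_eq_abs, mul_one, sq_abs]
    linarith [hx.2]
  · exact (measurableSet_cone (p + 1) ρ).nullMeasurableSet
end Cones

section Fubini
open ProbabilityTheory

namespace EvalKernels
variable {n p : ℕ} {d : Fin n → ℕ} {E V : Type*} [NormedAddCommGroup E]
    [InnerProductSpace ℝ E] [FiniteDimensional ℝ E] [MeasurableSpace E] [BorelSpace E]
    [NormedAddCommGroup V] [InnerProductSpace ℝ V] [FiniteDimensional ℝ V] [MeasurableSpace V]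
    [BorelSpace V] (K : EvalKernels d E V)

lemma measure_illSet_mul_le (hV : Module.finrank ℝ V = p + 2) {R ρ s t : ℝ}
    (ht : 0 < t) (hρ : 0 < ρ) (hs : 0 ≤ s) {B : ℝ≥0∞}
    (hB : ∀ x : V, ∫⁻ v, stdGaussian E {f | (f, x, v) ∈ K.fatSet (R / t) R ρ s} ∂stdGaussian V ≤ B) :
    stdGaussian E (K.illSet t ∩ {f | ‖f‖ ≤ R}) *
      (ENNReal.ofReal (coneConst (p + 1) ρ) * ballVol (p + 1) *
        (1 - ENNReal.ofReal (2 * gaussPeak * s))) ≤ B := by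
  have hm := K.measurableSet_fatSet (R / t) R ρ s
  have hT : MeasurableSet (K.illSet t ∩ {f | ‖f‖ ≤ R}) :=
    (K.isClosed_illSet t).measurableSet.inter (measurableSet_le (by fun_prop) (by fun_prop))
  set c := ENNReal.ofReal (coneConst (p + 1) ρ) * ballVol (p + 1) *
        (1 - ENNReal.ofReal (2 * gaussPeak * s)) with hc
  have h1 : ∀ f ∈ K.illSet t ∩ {f | ‖f‖ ≤ R},
      c ≤ ((stdGaussian V).prod (stdGaussian V)) (Prod.mk f ⁻¹' K.fatSet (R / t) R ρ s) := by
    rintro f ⟨⟨w, hw, hres⟩, hf⟩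
    simp only [Set.mem_ofPred_eq] at hf
    set C : Set V := {x | x ≠ 0 ∧ ‖x - ⟪w.1, x⟫ • w.1‖ ^ 2 ≤ ρ ^ 2 * ⟪w.1, x⟫ ^ 2} with hC
    have hCm : MeasurableSet C := by
      rw [hC, Set.ofPred_and]
      refine MeasurableSet.inter ?_ ?_
      · exact (measurableSet_singleton (0 : V)).compl
      · exact measurableSet_le (by fun_prop) (by fun_prop)
    rw [Measure.prod_apply (measurable_prodMk_left hm)]
    calc c ≤ stdGaussian V C * (1 - ENNReal.ofReal (2 * gaussPeak * s)) :=
          mul_le_mul_left (le_stdGaussian_cone hV hw.1 hρ) _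
      _ = ∫⁻ x, C.indicator (fun _ => 1 - ENNReal.ofReal (2 * gaussPeak * s)) x ∂stdGaussian V := by
          rw [lintegral_indicator_const hCm, mul_comm]
      _ ≤ _ := by
          refine lintegral_mono fun x => ?_
          by_cases hx : x ∈ C
          · rw [Set.indicator_of_mem hx]
            set u := ⟪w.1, x⟫ • w.2 - ⟪w.2, x⟫ • w.1 with hu
            refine (le_stdGaussian_slab_compl u s).trans (measure_mono fun v hv => ?_)
            refine ⟨hx.1, w, hw, hres.trans ?_, hf, hx.2, ?_⟩
            · have : ‖f‖ / t ≤ R / t := by gcongr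
              exact pow_le_pow_left₀ (by positivity) this 2
            · simp only [Set.mem_ofPred_eq] at hv
              have h2 : ⟪w.2, v⟫ * ⟪w.1, x⟫ - ⟪w.2, x⟫ * ⟪w.1, v⟫ = ⟪v, u⟫ := by
                rw [hu, inner_sub_right, real_inner_smul_right, real_inner_smul_right,
                  real_inner_comm v w.2, real_inner_comm v w.1]
                ring
              have h3 : |⟪w.1, x⟫| ≤ ‖u‖ := by
                refine abs_le_of_sq_le_sq ?_ (norm_nonneg _)
                rw [hu, norm_sub_sq_real, norm_smul, norm_smul, hw.1, hw.2.1, real_inner_smul_left,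
                  real_inner_smul_right, real_inner_comm w.1 w.2, hw.2.2, Real.norm_eq_abs,
                  Real.norm_eq_abs, mul_one, mul_one, sq_abs, sq_abs]
                nlinarith [sq_nonneg ⟪w.2, x⟫]
              simp only
              rw [h2]
              exact (mul_le_mul_of_nonneg_left h3 hs).trans hv
          · rw [Set.indicator_of_notMem hx]
            exact zero_le
  calc stdGaussian E (K.illSet t ∩ {f | ‖f‖ ≤ R}) * c
      = ∫⁻ f, (K.illSet t ∩ {f | ‖f‖ ≤ R}).indicator (fun _ => c) f ∂stdGaussian E := by
        rw [lintegral_indicator_const hT, mul_comm]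
    _ ≤ ∫⁻ f, ((stdGaussian V).prod (stdGaussian V))
        (Prod.mk f ⁻¹' K.fatSet (R / t) R ρ s) ∂stdGaussian E := by
        refine lintegral_mono fun f => ?_
        by_cases hf : f ∈ K.illSet t ∩ {f | ‖f‖ ≤ R}
        · rw [Set.indicator_of_mem hf]
          exact h1 f hf
        · rw [Set.indicator_of_notMem hf]
          exact zero_le
    _ = ((stdGaussian E).prod ((stdGaussian V).prod (stdGaussian V))) (K.fatSet (R / t) R ρ s) :=
        (Measure.prod_apply hm).symm
    _ = ∫⁻ x, ∫⁻ v, stdGaussian E {f | (f, x, v) ∈ K.fatSet (R / t) R ρ s}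
          ∂stdGaussian V ∂stdGaussian V := by
        rw [Measure.prod_apply_symm hm, lintegral_prod _ (measurable_measure_prodMk_right hm).aemeasurable]
        rfl
    _ ≤ ∫⁻ _, B ∂stdGaussian V := lintegral_mono hB
    _ = B := by simp
end EvalKernels
end Fubini

section Radial
open ProbabilityTheory

lemma setLIntegral_cone_radial {E : Type*} [NormedAddCommGroup E] [NormedSpace ℝ E]
    [FiniteDimensional ℝ E] [Nontrivial E] [MeasurableSpace E] [BorelSpace E] (μ : Measure E)
    [μ.IsAddHaarMeasure] {T : Set E} (hT : MeasurableSet T)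
    (hcone : ∀ c : ℝ, 0 < c → ∀ x ∈ T, c • x ∈ T) {g : ℝ → ℝ≥0∞} (hg : Measurable g) :
    ∫⁻ x in T, g ‖x‖ ∂μ = μ.toSphere {x | (x : E) ∈ T} *
      ∫⁻ r : Set.Ioi (0 : ℝ), g r ∂Measure.volumeIoiPow (Module.finrank ℝ E - 1) := by
  have hS : MeasurableSet {x : sphere (0 : E) 1 | (x : E) ∈ T} := measurable_subtype_coe hT
  have hmp := μ.measurePreserving_homeomorphUnitSphereProd
  have hmem : ∀ x : ({0}ᶜ : Set E),
      (homeomorphUnitSphereProd E x).1 ∈ {x : sphere (0 : E) 1 | (x : E) ∈ T} ↔ (x : E) ∈ T := by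
    intro x
    have hx : 0 < ‖(x : E)‖ := norm_pos_iff.2 x.2
    have h1 : ((homeomorphUnitSphereProd E x).1 : E) = ‖(x : E)‖⁻¹ • (x : E) := by simp
    rw [Set.mem_ofPred_eq, h1]
    refine ⟨fun h => ?_, fun h => hcone _ (inv_pos.2 hx) _ h⟩
    have := hcone _ hx _ h
    rwa [smul_smul, mul_inv_cancel₀ hx.ne', one_smul] at this
  have h2 : ∫⁻ x in T, g ‖x‖ ∂μ =
      ∫⁻ x : ({0}ᶜ : Set E), T.indicator (fun x => g ‖x‖) x ∂(μ.comap (↑)) := by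
    rw [lintegral_subtype_comap (measurableSet_singleton _).compl, restrict_compl_singleton,
      lintegral_indicator hT]
  set F : sphere (0 : E) 1 × Set.Ioi (0 : ℝ) → ℝ≥0∞ := fun p =>
    {x : sphere (0 : E) 1 | (x : E) ∈ T}.indicator 1 p.1 * g p.2 with hF
  have hFm : Measurable F := by
    refine Measurable.mul ?_ ?_
    · exact (measurable_one.indicator hS).comp measurable_fst
    · exact hg.comp (measurable_subtype_coe.comp measurable_snd)
  have h3 : ∀ x : ({0}ᶜ : Set E), T.indicator (fun x => g ‖x‖) x =
      F (homeomorphUnitSphereProd E x) := by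
    intro x
    by_cases hx : (x : E) ∈ T
    · simp only [hF, Set.indicator_of_mem hx, Set.indicator_of_mem ((hmem x).2 hx)]
      simp
    · simp only [hF, Set.indicator_of_notMem hx, Set.indicator_of_notMem (mt (hmem x).1 hx)]
      simp
  rw [h2, lintegral_congr h3, hmp.lintegral_comp hFm,
    hF, lintegral_prod_mul (g := fun r : Set.Ioi (0 : ℝ) => g r) (measurable_one.indicator hS).aemeasurable
      (hg.comp measurable_subtype_coe).aemeasurable, lintegral_indicator_one hS]

lemma stdGaussian_eq_withDensity (k : ℕ) :
    stdGaussian (EuclideanSpace ℝ (Fin k)) =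
      (volume : Measure (EuclideanSpace ℝ (Fin k))).withDensity
        fun x => ENNReal.ofReal (gaussPeak ^ k * Real.exp (-(‖x‖ ^ 2) / 2)) := by
  have h1 : stdGaussian (EuclideanSpace ℝ (Fin k)) = (gaussPi k).map (WithLp.toLp 2) :=
    map_pi_eq_stdGaussian.symm
  rw [h1]
  ext s hs
  have hm : Measurable (WithLp.toLp 2 : (Fin k → ℝ) → EuclideanSpace ℝ (Fin k)) :=
    WithLp.measurable_toLp _ _
  rw [Measure.map_apply hm hs, gaussPi_eq_withDensity, withDensity_apply _ (hm hs),
    withDensity_apply _ hs, ← (PiLp.volume_preserving_toLp (Fin k)).setLIntegral_comp_preimage hs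
      (by fun_prop)]
  refine lintegral_congr fun x => ?_
  rw [prod_gaussianPDF, EuclideanSpace.real_norm_sq_eq]

lemma half_le_stdGaussian_ball (k : ℕ) {R : ℝ} (hR : 0 < R) (hkR : 2 * (k : ℝ) ≤ R ^ 2) :
    1 / 2 ≤ stdGaussian (EuclideanSpace ℝ (Fin k)) {f | ‖f‖ ≤ R} := by
  set E := EuclideanSpace ℝ (Fin k)
  have h0 : MeasurableSet {f : E | ‖f‖ ≤ R} := measurableSet_le (by fun_prop) (by fun_prop)
  have h1 := lintegral_norm_sq_stdGaussian E
  have h2 : stdGaussian E {f | ENNReal.ofReal (R ^ 2) ≤ ENNReal.ofReal (‖f‖ ^ 2)} ≤ 1 / 2 := by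
    refine (meas_ge_le_lintegral_div (f := fun f : E => ENNReal.ofReal (‖f‖ ^ 2)) (by fun_prop)
      (by simp [hR.ne']) ENNReal.ofReal_ne_top).trans ?_
    rw [h1, finrank_euclideanSpace, Fintype.card_fin]
    refine ENNReal.div_le_of_le_mul ?_
    rw [← ENNReal.ofReal_natCast, show (1 / 2 : ℝ≥0∞) = ENNReal.ofReal (1 / 2) by
      rw [ENNReal.ofReal_div_of_pos two_pos]; simp, ← ENNReal.ofReal_mul (by norm_num)]
    exact ENNReal.ofReal_le_ofReal (by linarith)
  have h3 : {f : E | ‖f‖ ≤ R}ᶜ ⊆ {f | ENNReal.ofReal (R ^ 2) ≤ ENNReal.ofReal (‖f‖ ^ 2)} := by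
    intro f hf
    simp only [Set.mem_compl_iff, Set.mem_ofPred_eq, not_le] at hf ⊢
    exact ENNReal.ofReal_le_ofReal (pow_le_pow_left₀ hR.le hf.le 2)
  have h4 : stdGaussian E {f : E | ‖f‖ ≤ R}ᶜ ≤ 1 / 2 := (measure_mono h3).trans h2
  have h5 := prob_add_prob_compl (μ := stdGaussian E) h0
  by_contra! h
  have : stdGaussian E {f : E | ‖f‖ ≤ R} + stdGaussian E {f : E | ‖f‖ ≤ R}ᶜ < 1 / 2 + 1 / 2 :=
    ENNReal.add_lt_add_of_lt_of_le (by
      exact measure_ne_top _ _) h h4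
  rw [h5, ENNReal.add_halves] at this
  exact lt_irrefl _ this

lemma toSphere_div_le (k : ℕ) {T : Set (EuclideanSpace ℝ (Fin (k + 1)))} (hT : MeasurableSet T)
    (hcone : ∀ c : ℝ, 0 < c → ∀ x ∈ T, c • x ∈ T) {R : ℝ} (hR : 0 < R)
    (hkR : 2 * ((k + 1 : ℕ) : ℝ) ≤ R ^ 2) :
    (volume : Measure (EuclideanSpace ℝ (Fin (k + 1)))).toSphere {x | (x : EuclideanSpace ℝ (Fin (k + 1))) ∈ T} /
      (volume : Measure (EuclideanSpace ℝ (Fin (k + 1)))).toSphere Set.univ ≤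
      2 * stdGaussian (EuclideanSpace ℝ (Fin (k + 1))) (T ∩ {f | ‖f‖ ≤ R}) := by
  set σ := (volume : Measure (EuclideanSpace ℝ (Fin (k + 1)))).toSphere
  set g : ℝ → ℝ≥0∞ := fun r => (Set.Iic R).indicator
    (fun r => ENNReal.ofReal (gaussPeak ^ (k + 1) * Real.exp (-(r ^ 2) / 2))) r with hg
  have hgm : Measurable g := Measurable.indicator (by fun_prop) measurableSet_Iic
  have hB : MeasurableSet {f : EuclideanSpace ℝ (Fin (k + 1)) | ‖f‖ ≤ R} := measurableSet_le (by fun_prop) (by fun_prop)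
  have key : ∀ A : Set (EuclideanSpace ℝ (Fin (k + 1))), MeasurableSet A → (∀ c : ℝ, 0 < c → ∀ x ∈ A, c • x ∈ A) →
      stdGaussian (EuclideanSpace ℝ (Fin (k + 1))) (A ∩ {f | ‖f‖ ≤ R}) = σ {x | (x : EuclideanSpace ℝ (Fin (k + 1))) ∈ A} *
      ∫⁻ r : Set.Ioi (0 : ℝ), g r ∂Measure.volumeIoiPow (Module.finrank ℝ (EuclideanSpace ℝ (Fin (k + 1))) - 1) := by
    intro A hA hAc
    rw [← setLIntegral_cone_radial volume hA hAc hgm, stdGaussian_eq_withDensity,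
      withDensity_apply _ (hA.inter hB), ← lintegral_indicator (hA.inter hB),
      ← lintegral_indicator hA]
    refine lintegral_congr fun x => ?_
    by_cases h1 : x ∈ A <;> by_cases h2 : ‖x‖ ≤ R <;> simp [h1, h2, hg, Set.indicator]
  set I := ∫⁻ r : Set.Ioi (0 : ℝ), g r ∂Measure.volumeIoiPow (Module.finrank ℝ (EuclideanSpace ℝ (Fin (k + 1))) - 1)
  have k1 := key T hT hcone
  have k2 := key Set.univ MeasurableSet.univ (fun _ _ _ _ => Set.mem_univ _)
  rw [Set.univ_inter] at k2
  have k3 : 1 / 2 ≤ σ Set.univ * I := by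
    have := half_le_stdGaussian_ball (k + 1) hR hkR
    rw [k2] at this
    simpa using this
  have k4 : σ Set.univ ≠ 0 := by
    intro h
    rw [h, zero_mul] at k3
    simp at k3
  rw [k1, ENNReal.div_le_iff k4 (measure_ne_top _ _)]
  calc σ {x | (x : EuclideanSpace ℝ (Fin (k + 1))) ∈ T} = 2 * (1 / 2) * σ {x | (x : EuclideanSpace ℝ (Fin (k + 1))) ∈ T} := by
        rw [one_div, ENNReal.mul_inv_cancel (by simp) (by simp), one_mul]
    _ ≤ 2 * (σ Set.univ * I) * σ {x | (x : EuclideanSpace ℝ (Fin (k + 1))) ∈ T} := by gcongr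
    _ = _ := by ring
end Radial

section Reproducing

lemma bwInner_eq_sum {m : ℕ} (p q : MvPolynomial (Fin m) ℝ) {S : Finset (Fin m →₀ ℕ)}
    (hS : p.support ⊆ S) :
    bwInner p q = ∑ j ∈ S, (p.coeff j * q.coeff j) / (Nat.multinomial Finset.univ j : ℝ) := by
  have h : ∀ T : Finset (Fin m →₀ ℕ), p.support ⊆ T →
      ∑ j ∈ T, (p.coeff j * q.coeff j) / (Nat.multinomial Finset.univ j : ℝ) =
      ∑ j ∈ p.support, (p.coeff j * q.coeff j) / (Nat.multinomial Finset.univ j : ℝ) := by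
    intro T hT
    refine (Finset.sum_subset hT fun j _ hj => ?_).symm
    rw [MvPolynomial.notMem_support_iff.1 hj]
    simp
  rw [h S hS, bwInner, h _ Finset.subset_union_left]

lemma bwInner_add_self {m : ℕ} (p q : MvPolynomial (Fin m) ℝ) :
    bwInner (p + q) (p + q) = bwInner p p + 2 * bwInner p q + bwInner q q := by
  rw [bwInner_eq_sum (p + q) (p + q) MvPolynomial.support_add,
    bwInner_eq_sum p p Finset.subset_union_left, bwInner_eq_sum p q Finset.subset_union_left,
    bwInner_eq_sum q q Finset.subset_union_right, Finset.mul_sum, ← Finset.sum_add_distrib,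
    ← Finset.sum_add_distrib]
  refine Finset.sum_congr rfl fun j _ => ?_
  rw [coeff_add]
  ring

lemma bwInner_self_nonneg {m : ℕ} (p : MvPolynomial (Fin m) ℝ) : 0 ≤ bwInner p p :=
  Finset.sum_nonneg fun _ _ => div_nonneg (mul_self_nonneg _) (Nat.cast_nonneg _)

lemma bwInner_linear_pow {m D : ℕ} {p : MvPolynomial (Fin m) ℝ} (hp : p.IsHomogeneous D)
    (x : Fin m → ℝ) : bwInner p ((∑ k, x k • X k) ^ D) = eval x p := by
  rw [bwInner_eq_sum p _ subset_rfl, eval_eq']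
  refine Finset.sum_congr rfl fun j hj => ?_
  have h1 : (j.sum fun _ m => m) = D := by
    have := hp (mem_support_iff.1 hj)
    rwa [Finsupp.weight_apply, Finsupp.sum_congr (g2 := fun _ m => m) (by simp)] at this
  have h2 : j.multinomial = Nat.multinomial Finset.univ j := by
    rw [Finsupp.multinomial, Nat.multinomial, Finsupp.sum_fintype _ _ (by simp),
      Finsupp.prod_fintype _ _ (by simp)]
    simp
  have h3 : (Nat.multinomial Finset.univ j : ℝ) ≠ 0 :=
    Nat.cast_ne_zero.2 (Nat.multinomial_pos _ _).ne'
  rw [coeff_linearCombination_X_pow_of_fintype, if_pos h1, h2, Finsupp.prod_fintype _ _ (by simp)]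
  field_simp

variable {n : ℕ} {d : Fin n → ℕ} {E : Type*} [NormedAddCommGroup E] [InnerProductSpace ℝ E]
  {φ : E →ₗ[ℝ] (Fin n → MvPolynomial (Fin (n + 1)) ℝ)}

lemma inner_eq_sum_bwInner (hφiso : ∀ v, bwNormSys (φ v) = ‖v‖) (v w : E) :
    ⟪v, w⟫ = ∑ i, bwInner (φ v i) (φ w i) := by
  have h : ∀ v, ‖v‖ ^ 2 = ∑ i, bwInner (φ v i) (φ v i) := fun v => by
    rw [← hφiso, bwNormSys, Real.sq_sqrt (Finset.sum_nonneg fun i _ => bwInner_self_nonneg _)]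
  have h1 := norm_add_sq_real v w
  rw [h, h, h] at h1
  simp only [map_add, Pi.add_apply, bwInner_add_self, Finset.sum_add_distrib,
    ← Finset.mul_sum] at h1
  linarith

lemma exists_reproducing (hφsys : ∀ v, IsSystem d (φ v)) (hφiso : ∀ v, bwNormSys (φ v) = ‖v‖)
    (hφsurj : ∀ g, IsSystem d g → ∃ v, φ v = g) (i : Fin n) (x : Fin (n + 1) → ℝ) :
    ∃ k : E, (φ k = Pi.single i ((∑ l, x l • X l) ^ d i)) ∧
      ∀ f, ⟪f, k⟫ = eval x (φ f i) := by
  have hlin : ((∑ l, x l • X l : MvPolynomial (Fin (n + 1)) ℝ)).IsHomogeneous 1 :=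
    IsHomogeneous.sum _ _ _ fun l _ => by
      rw [smul_eq_C_mul]
      simpa using (isHomogeneous_C _ _).mul (isHomogeneous_X ℝ l)
  obtain ⟨k, hk⟩ := hφsurj (Pi.single i ((∑ l, x l • X l) ^ d i)) (by
    intro j
    by_cases h : j = i
    · subst h
      simpa using hlin.pow (d j)
    · rw [Pi.single_eq_of_ne h]
      exact isHomogeneous_zero _ _ _)
  refine ⟨k, hk, fun f => ?_⟩
  rw [inner_eq_sum_bwInner hφiso, hk, Finset.sum_eq_single i]
  · rw [Pi.single_eq_same, bwInner_linear_pow (hφsys f i)]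
  · intro j _ hj
    rw [Pi.single_eq_of_ne hj]
    simp [bwInner]
  · simp

lemma eval_linear {m : ℕ} (x y : Fin m → ℝ) :
    eval y (∑ l, x l • X l : MvPolynomial (Fin m) ℝ) = ∑ l, x l * y l := by
  simp [smul_eval]

lemma pderiv_linear {m : ℕ} (x : Fin m → ℝ) (k : Fin m) :
    pderiv k (∑ l, x l • X l : MvPolynomial (Fin m) ℝ) = C (x k) := by
  rw [map_sum, Finset.sum_eq_single k]
  · rw [smul_eq_C_mul, pderiv_C_mul, pderiv_X_self, mul_one]
  · intro j _ hj
    rw [smul_eq_C_mul, pderiv_C_mul, pderiv_X_of_ne hj, mul_zero]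
  · simp

lemma exists_evalKernels [FiniteDimensional ℝ E] (hφsys : ∀ v, IsSystem d (φ v))
    (hφiso : ∀ v, bwNormSys (φ v) = ‖v‖) (hφsurj : ∀ g, IsSystem d g → ∃ v, φ v = g) :
    ∃ K : EvalKernels d E (EuclideanSpace ℝ (Fin (n + 1))),
      (∀ f i x, ⟪f, K.ke i x⟫ = eval x.ofLp (φ f i)) ∧
      ∀ f i x w, ⟪f, K.kd i x w⟫ = ∑ k, eval x.ofLp (pderiv k (φ f i)) * w k := by
  choose ke hke hrep using exists_reproducing hφsys hφiso hφsurj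
  have hr : ∀ (i : Fin n) (x : Fin (n + 1) → ℝ) (k : Fin (n + 1)),
      ∃ r : E, ∀ f, ⟪f, r⟫ = eval x (pderiv k (φ f i)) := by
    intro i x k
    let Λ : E →ₗ[ℝ] ℝ :=
      { toFun := fun f => eval x (pderiv k (φ f i))
        map_add' := by intro f g; simp
        map_smul' := by intro c f; simp [smul_eval] }
    refine ⟨(InnerProductSpace.toDual ℝ E).symm Λ.toContinuousLinearMap, fun f => ?_⟩
    rw [real_inner_comm, InnerProductSpace.toDual_symm_apply]
    rfl
  choose r hr using hr
  let kd : Fin n → EuclideanSpace ℝ (Fin (n + 1)) → EuclideanSpace ℝ (Fin (n + 1)) →ₗ[ℝ] E :=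
    fun i x =>
      { toFun := fun w => ∑ k, w k • r i x.ofLp k
        map_add' := by intro v w; simp [add_smul, Finset.sum_add_distrib]
        map_smul' := by intro c w; simp [Finset.smul_sum, smul_smul] }
  have hkd : ∀ f i x w, ⟪f, kd i x w⟫ = ∑ k, eval x.ofLp (pderiv k (φ f i)) * w k := by
    intro f i x w
    change ⟪f, ∑ k, w k • r i x.ofLp k⟫ = _
    rw [inner_sum]
    exact Finset.sum_congr rfl fun k _ => by rw [real_inner_smul_right, hr, mul_comm]
  have hip : ∀ x y : EuclideanSpace ℝ (Fin (n + 1)), ⟪x, y⟫ = ∑ l, x l * y l := by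
    intro x y
    simp [PiLp.inner_apply, mul_comm]
  have hked : ∀ i j (x y w : EuclideanSpace ℝ (Fin (n + 1))), ⟪ke i x.ofLp, kd j y w⟫ =
      if i = j then d i * (⟪x, y⟫ ^ (d i - 1) * ⟪x, w⟫) else 0 := by
    intro i j x y w
    rw [hkd, hke]
    by_cases h : i = j
    · subst h
      rw [if_pos rfl, Pi.single_eq_same, hip x w, Finset.mul_sum, Finset.mul_sum]
      refine Finset.sum_congr rfl fun k _ => ?_
      rw [pderiv_pow, pderiv_linear]
      simp only [map_mul, map_pow, eval_linear, eval_C, map_natCast, hip]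
      ring
    · rw [if_neg h, Pi.single_eq_of_ne (Ne.symm h)]
      simp
  have hφkd : ∀ i j (x v : EuclideanSpace ℝ (Fin (n + 1))), φ (kd i x v) j =
      if i = j then C (d i : ℝ) * ((∑ l, x l • X l) ^ (d i - 1) * (∑ l, v l • X l)) else 0 := by
    intro i j x v
    refine MvPolynomial.funext fun y => ?_
    have h := hked j i (WithLp.toLp 2 y) x v
    rw [real_inner_comm, hrep] at h
    change eval y _ = _
    rw [h]
    by_cases hij : i = j
    · subst hij
      simp only [if_true, map_mul, map_pow, eval_linear, eval_C, hip]
      simp only [mul_comm]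
    · rw [if_neg hij, if_neg (Ne.symm hij), map_zero]
  refine ⟨⟨fun i x => ke i x.ofLp, kd, ?_, hked, ?_⟩, fun f i x => hrep i x.ofLp f, hkd⟩
  · intro i j x y
    rw [hrep, hke]
    by_cases h : i = j
    · subst h
      rw [if_pos rfl, Pi.single_eq_same, map_pow, eval_linear, hip]
    · rw [if_neg h, Pi.single_eq_of_ne (Ne.symm h), map_zero]
  · intro i j x y v w
    rw [hkd]
    by_cases h : i = j
    · subst h
      have e1 : ∀ k, eval y.ofLp (pderiv k (φ (kd i x v) i)) =
          d i * ((d i - 1 : ℕ) * ⟪x, y⟫ ^ (d i - 2) * (x k * ⟪v, y⟫) +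
            ⟪x, y⟫ ^ (d i - 1) * v k) := by
        intro k
        rw [hφkd, if_pos rfl, pderiv_C_mul, pderiv_mul, pderiv_pow, pderiv_linear, pderiv_linear]
        simp only [map_add, map_mul, map_pow, eval_linear, eval_C, map_natCast, ← hip]
        rw [show d i - 1 - 1 = d i - 2 from rfl]
        ring
      simp only [e1, if_true]
      rw [hip x w, hip v w]
      simp only [Finset.mul_sum, Finset.sum_mul, ← Finset.sum_add_distrib]
      refine Finset.sum_congr rfl fun k _ => ?_
      ring
    · rw [if_neg h]
      simp [hφkd, h]
end Reproducing

section Reduction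

lemma EvalKernels.smul_mem_illSet {n : ℕ} {d : Fin n → ℕ} {E V : Type*} [NormedAddCommGroup E]
    [InnerProductSpace ℝ E] [NormedAddCommGroup V] [InnerProductSpace ℝ V]
    (K : EvalKernels d E V) {t c : ℝ} {f : E} (hf : f ∈ K.illSet t) : c • f ∈ K.illSet t := by
  obtain ⟨w, hw, h⟩ := hf
  refine ⟨w, hw, ?_⟩
  have h1 : K.resid (c • f) w = c ^ 2 * K.resid f w := by
    simp only [resid, real_inner_smul_left, mul_add, Finset.mul_sum]
    congr 1 <;> refine Finset.sum_congr rfl fun i _ => ?_ <;> ring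
  rw [h1, norm_smul, mul_div_assoc, mul_pow, Real.norm_eq_abs, sq_abs]
  exact mul_le_mul_of_nonneg_left h (sq_nonneg c)

variable {n : ℕ} {d : Fin n → ℕ} {E : Type*} [NormedAddCommGroup E] [InnerProductSpace ℝ E]
  {φ : E →ₗ[ℝ] (Fin n → MvPolynomial (Fin (n + 1)) ℝ)}

lemma mem_illSet_of_lt_kappa (hn : 1 ≤ n) (hφiso : ∀ v, bwNormSys (φ v) = ‖v‖)
    (K : EvalKernels d E (EuclideanSpace ℝ (Fin (n + 1))))
    (hke : ∀ f i x, ⟪f, K.ke i x⟫ = eval x.ofLp (φ f i))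
    (hkd : ∀ f i x w, ⟪f, K.kd i x w⟫ = ∑ k, eval x.ofLp (pderiv k (φ f i)) * w k)
    {t : ℝ} (ht : 0 < t) {f : E} (hf : ENNReal.ofReal t < kappa d (φ f)) : f ∈ K.illSet t := by
  rw [kappa, lt_iSup_iff] at hf
  obtain ⟨x, hf⟩ := hf
  rw [lt_iSup_iff] at hf
  obtain ⟨hx, hf⟩ := hf
  rw [kappaAt, hφiso] at hf
  have hip : ∀ x y : EuclideanSpace ℝ (Fin (n + 1)), ⟪x, y⟫ = ∑ l, x l * y l := by
    intro x y
    simp [PiLp.inner_apply, mul_comm]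
  set s := sigmaMin d (φ f) x with hs
  set e := ∑ i, (eval x (φ f i)) ^ 2 with he
  have he0 : 0 ≤ e := Finset.sum_nonneg fun _ _ => sq_nonneg _
  have h1 : t * √(s ^ 2 + e) < ‖f‖ := by
    by_contra! h
    refine hf.not_ge (ENNReal.div_le_of_le_mul ?_)
    rw [← ENNReal.ofReal_mul ht.le]
    exact ENNReal.ofReal_le_ofReal h
  have h2 : s ^ 2 + e < (‖f‖ / t) ^ 2 := by
    rw [← Real.sqrt_lt' (by
      have := (mul_nonneg ht.le (Real.sqrt_nonneg (s ^ 2 + e))).trans_lt h1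
      positivity), lt_div_iff₀ ht, mul_comm]
    exact h1
  have hx1 : ‖(WithLp.toLp 2 x : EuclideanSpace ℝ (Fin (n + 1)))‖ = 1 := by
    rw [EuclideanSpace.norm_eq]
    have : ∑ i, x i ^ 2 = 1 := hx
    simp [this]
  obtain ⟨b, hb⟩ := exists_orthonormalBasis_zero (V := EuclideanSpace ℝ (Fin (n + 1))) (p := n)
    (by simp) hx1
  have h3 : s < √((‖f‖ / t) ^ 2 - e) := Real.lt_sqrt_of_sq_lt (by linarith)
  obtain ⟨_, ⟨v, ⟨hv1, hv2⟩, rfl⟩, hv⟩ := exists_lt_of_csInf_lt (by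
    refine Set.Nonempty.image _ ⟨(b ⟨1, by omega⟩).ofLp, ?_, ?_⟩
    · have h4 : ⟪b ⟨1, by omega⟩, b 0⟫ = 0 := b.orthonormal.2 (by
        simp [Fin.ext_iff])
      rw [hip, hb] at h4
      exact h4
    · have := b.orthonormal.1 ⟨1, by omega⟩
      rw [← EuclideanSpace.real_norm_sq_eq, this, one_pow]) h3
  refine ⟨(WithLp.toLp 2 x, WithLp.toLp 2 v), ⟨hx1, ?_, ?_⟩, ?_⟩
  · rw [EuclideanSpace.norm_eq]
    simp [hv2]
  · rw [hip, ← hv1]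
    exact Finset.sum_congr rfl fun k _ => mul_comm _ _
  · have h4 := (Real.sqrt_lt_sqrt_iff (Finset.sum_nonneg fun _ _ => sq_nonneg _)).1 hv
    simp only [EvalKernels.resid, hke, hkd]
    linarith
end Reduction

section TailBound
open ProbabilityTheory

lemma ballVol_ne_zero (n : ℕ) : ballVol n ≠ 0 := by
  refine fun h => (isOpen_lt (f := fun y : Fin n → ℝ => ∑ i, y i ^ 2) (g := fun _ => (1 : ℝ))
    (by fun_prop) (by fun_prop)).measure_ne_zero volume ⟨0, by simp⟩
    (measure_mono_null (fun y hy => ?_) h)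
  exact (show ∑ i, y i ^ 2 < 1 from hy).le

lemma coneConst_pos (n : ℕ) {ρ : ℝ} (hρ : 0 < ρ) : 0 < coneConst n ρ := by
  have h1 := gaussPeak_pos
  have h2 : 0 < Real.Gamma (((n : ℝ) + 1) / 2) := Real.Gamma_pos_of_pos (by positivity)
  unfold coneConst
  positivity

lemma gaussPeak_sq : gaussPeak ^ 2 = (2 * Real.pi)⁻¹ := by
  rw [gaussPeak, inv_pow, Real.sq_sqrt (by positivity)]

lemma gaussPeak_le : gaussPeak ≤ 0.399 := by
  have h := Real.pi_gt_d4
  refine abs_le_of_sq_le_sq' ?_ (by norm_num) |>.2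
  rw [gaussPeak_sq, inv_le_comm₀ (by positivity) (by norm_num)]
  norm_num
  linarith

lemma factorial_mul_pi_le_Gamma_sq (n : ℕ) :
    ((n + 1).factorial * Real.pi ≤ 2 ^ (n + 2) * Real.Gamma ((n + 3) / 2) ^ 2) ∧
    ((n + 2).factorial * Real.pi ≤ 2 ^ (n + 3) * Real.Gamma ((n + 4) / 2) ^ 2) := by
  induction n with
  | zero =>
    have h1 : Real.Gamma ((0 + 3) / 2) = 1 / 2 * √Real.pi := by
      rw [show ((0 : ℝ) + 3) / 2 = 1 / 2 + 1 by norm_num, Real.Gamma_add_one (by norm_num),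
        Real.Gamma_one_half_eq]
    have h2 : Real.Gamma ((0 + 4) / 2) = 1 := by
      rw [show ((0 : ℝ) + 4) / 2 = 2 by norm_num, Real.Gamma_two]
    push_cast
    rw [h1, h2, mul_pow, Real.sq_sqrt Real.pi_pos.le]
    refine ⟨by norm_num; linarith, ?_⟩
    have := Real.pi_lt_four
    simp [Nat.factorial]
    linarith
  | succ n ih =>
    refine ⟨?_, ?_⟩
    · have := ih.2
      push_cast
      rw [show ((n : ℝ) + 1 + 3) = n + 4 by ring]
      exact this
    · have h3 : ((n : ℝ) + 1 + 4) / 2 = (n + 3) / 2 + 1 := by ring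
      push_cast
      rw [h3, Real.Gamma_add_one (by positivity), show n + 1 + 2 = (n + 1) + 1 + 1 from rfl,
        Nat.factorial_succ, Nat.factorial_succ]
      push_cast
      calc (((n : ℝ) + 2 + 1) * ((n + 1 + 1) * (n + 1).factorial)) * Real.pi
          = ((n + 3) * (n + 2)) * ((n + 1).factorial * Real.pi) := by ring
        _ ≤ ((n + 3) * (n + 3)) * (2 ^ (n + 2) * Real.Gamma ((n + 3) / 2) ^ 2) :=
            mul_le_mul (by gcongr; norm_num) ih.1 (by positivity) (by positivity)
        _ = 2 ^ (n + 1 + 3) * ((n + 3) / 2 * Real.Gamma ((n + 3) / 2)) ^ 2 := by ring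

lemma sqrt_factorial_div_Gamma_le (p : ℕ) :
    √((p + 2).factorial) * √(1 / 2) ^ (p + 3) / Real.Gamma ((p + 3) / 2) ≤
      √(p + 2) * gaussPeak := by
  have hG : 0 < Real.Gamma (((p : ℝ) + 3) / 2) := Real.Gamma_pos_of_pos (by positivity)
  have hg := gaussPeak_pos
  rw [div_le_iff₀ hG]
  refine abs_le_of_sq_le_sq' ?_ (by positivity) |>.2
  rw [mul_pow, mul_pow, mul_pow, Real.sq_sqrt (by positivity), Real.sq_sqrt (by positivity),
    gaussPeak_sq, ← pow_mul, mul_comm (p + 3) 2, pow_mul, Real.sq_sqrt (by norm_num)]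
  have h := (factorial_mul_pi_le_Gamma_sq p).1
  have hpi := Real.pi_pos
  rw [show p + 2 = (p + 1) + 1 from rfl, Nat.factorial_succ]
  push_cast
  rw [one_div, inv_pow, ← div_eq_mul_inv, div_le_iff₀ (by positivity)]
  have e : ((p : ℝ) + 2) * (2 * Real.pi)⁻¹ * Real.Gamma ((p + 3) / 2) ^ 2 * 2 ^ (p + 3) =
      (p + 2) * (2 ^ (p + 2) * Real.Gamma ((p + 3) / 2) ^ 2) / Real.pi := by
    field_simp
    ring
  rw [e, le_div_iff₀ hpi]
  nlinarith [mul_le_mul_of_nonneg_left h (by positivity : (0 : ℝ) ≤ p + 2)]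

lemma le_of_mul_ofReal_le {x b c : ℝ≥0∞} {a A B C e : ℝ} (ha : 0 < a) (he : 0 < e)
    (hb : b ≠ 0) (hb' : b ≠ ⊤) (hA : 0 ≤ A) (hB : 0 ≤ B) (hc : ENNReal.ofReal e ≤ c)
    (h : x * (ENNReal.ofReal a * b * c) ≤
      ENNReal.ofReal A * b * ENNReal.ofReal B * ENNReal.ofReal C) :
    x ≤ ENNReal.ofReal (A * B * C / (a * e)) := by
  have h1 : x * ENNReal.ofReal (a * e) * b ≤ ENNReal.ofReal (A * B * C) * b := by
    rw [ENNReal.ofReal_mul ha.le, ENNReal.ofReal_mul (by positivity), ENNReal.ofReal_mul hA]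
    calc x * (ENNReal.ofReal a * ENNReal.ofReal e) * b
        = x * (ENNReal.ofReal a * b * ENNReal.ofReal e) := by ring
      _ ≤ x * (ENNReal.ofReal a * b * c) := by gcongr
      _ ≤ _ := h
      _ = _ := by ring
  have h2 := (ENNReal.mul_le_mul_iff_left hb hb').1 h1
  rw [ENNReal.ofReal_div_of_pos (by positivity)]
  rwa [ENNReal.le_div_iff_mul_le (by left; simp; positivity) (by left; simp)]

namespace EvalKernels
variable {p : ℕ} {E V : Type*} [NormedAddCommGroup E]
    [InnerProductSpace ℝ E] [FiniteDimensional ℝ E] [MeasurableSpace E] [BorelSpace E]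
    [NormedAddCommGroup V] [InnerProductSpace ℝ V] [FiniteDimensional ℝ V] [MeasurableSpace V]
    [BorelSpace V]

lemma stdGaussian_illSet_le_of_pos {d : Fin (p + 2) → ℕ} (K : EvalKernels d E V)
    (hV : Module.finrank ℝ V = p + 3)
    (hd : ∀ i, 1 ≤ d i) {D : ℕ} (hD : ∀ i, d i ≤ D) {ρ R t G : ℝ} (hρ : 0 < ρ) (hR : 0 < R)
    (ht : 0 < t) (hG : 0 ≤ G) (hGR : (D - 1 : ℕ) / 2 * R ^ 2 ≤ G ^ 2) {q τ : ℝ}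
    (hq : q = valueTol D (R / t) G ρ / ρ) (hτ : τ = derivTol D (R / t) G ρ) :
    stdGaussian E (K.illSet t ∩ {f | ‖f‖ ≤ R}) ≤
      ENNReal.ofReal (32 / 5 * gaussPeak * (∏ i, √(d i : ℝ)) * √(1 + 1 / (p + 2)) ^ (p + 2) *
        √(1 + ρ ^ 2) ^ (p + 3) * √((1 + (p + 2) * q ^ 2 / 2) ^ (p + 1)) * √(p + 2) * (p + 2) *
        (τ * √((p + 3) / 2 * q ^ 2 + 64 / 25 * τ ^ 2))) := by
  have hg := gaussPeak_pos
  have hτ0 : 0 ≤ τ := by rw [hτ, derivTol]; positivity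
  have h1 := K.measure_illSet_mul_le (p := p + 1) hV (R := R) ht hρ (s := 5 / 8) (by norm_num)
    (fun x => K.lintegral_fiber_le_of_pos (p := p + 1) hV hd hD hρ (by positivity) hG (by norm_num) hGR x)
  rw [← hq, ← hτ, fiberConst] at h1
  have h2 : ENNReal.ofReal (1 / 2) ≤ 1 - ENNReal.ofReal (2 * gaussPeak * (5 / 8)) := by
    rw [← ENNReal.ofReal_one, ← ENNReal.ofReal_sub _ (by positivity)]
    refine ENNReal.ofReal_le_ofReal ?_
    have := gaussPeak_le
    norm_num at this ⊢
    linarith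
  refine (le_of_mul_ofReal_le (coneConst_pos _ hρ) one_half_pos (ballVol_ne_zero _)
    (ballVol_ne_top _) (by positivity) (by positivity) h2 h1).trans (ENNReal.ofReal_le_ofReal ?_)
  have hG0 : 0 < Real.Gamma (((p : ℝ) + 3) / 2) := Real.Gamma_pos_of_pos (by positivity)
  have h3 : √((1 + ρ ^ 2) / 2) = √(1 + ρ ^ 2) * √(1 / 2) := by
    rw [← Real.sqrt_mul (by positivity)]
    congr 1
    ring
  have h4 : τ / (5 / 8) * √(((p + 1 + 1 : ℕ) : ℝ) * (((p + 1 + 1 : ℕ) : ℝ) * ((p + 1 : ℕ) + 2) / 2 *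
      q ^ 2 + (τ / (5 / 8)) ^ 2 * (p + 1 + 1 : ℕ))) =
      8 / 5 * (p + 2) * (τ * √((p + 3) / 2 * q ^ 2 + 64 / 25 * τ ^ 2)) := by
    rw [show ((p + 1 + 1 : ℕ) : ℝ) * (((p + 1 + 1 : ℕ) : ℝ) * ((p + 1 : ℕ) + 2) / 2 *
      q ^ 2 + (τ / (5 / 8)) ^ 2 * (p + 1 + 1 : ℕ)) = ((p : ℝ) + 2) ^ 2 *
        ((p + 3) / 2 * q ^ 2 + 64 / 25 * τ ^ 2) by push_cast; ring,
      Real.sqrt_mul (by positivity), Real.sqrt_sq (by positivity)]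
    ring
  have h5 := sqrt_factorial_div_Gamma_le p
  rw [h4, coneConst, h3, Real.sqrt_mul (by positivity)]
  push_cast
  rw [show ((p : ℝ) + 1 + 1) = p + 2 by ring, show ((p : ℝ) + 2 + 1) = p + 3 by ring]
  set A := ∏ i, √(d i : ℝ)
  set T := τ * √((p + 3) / 2 * q ^ 2 + 64 / 25 * τ ^ 2)
  set W := √((1 + ((p : ℝ) + 2) * q ^ 2 / 2) ^ (p + 1))
  set a := √(1 + 1 / ((p : ℝ) + 2))
  set L := √(1 + ρ ^ 2)
  have hL : 0 < L := by positivity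
  calc _ = 32 / 5 * A * a ^ (p + 2) * L ^ (p + 3) * W * (p + 2) * T *
        (√((p + 2).factorial) * √(1 / 2) ^ (p + 3) / Real.Gamma ((p + 3) / 2)) := by
        have hh : (0 : ℝ) < √(1 / 2) := by positivity
        rw [show p + 1 + 1 = p + 2 from rfl, show p + 2 + 1 = p + 3 from rfl]
        field_simp
        ring
    _ ≤ 32 / 5 * A * a ^ (p + 2) * L ^ (p + 3) * W * (p + 2) * T * (√(p + 2) * gaussPeak) := by
        gcongr
    _ = _ := by ring

lemma stdGaussian_illSet_le_of_zero {d : Fin 1 → ℕ} (K : EvalKernels d E V)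
    (hV : Module.finrank ℝ V = 2)
    (hd : ∀ i, 1 ≤ d i) {D : ℕ} (hD : ∀ i, d i ≤ D) {ρ R t G : ℝ} (hρ : 0 < ρ) (hR : 0 < R)
    (ht : 0 < t) (hG : 0 ≤ G) (hGR : (D - 1 : ℕ) / 2 * R ^ 2 ≤ G ^ 2) {q τ : ℝ}
    (hq : q = valueTol D (R / t) G ρ / ρ) (hτ : τ = derivTol D (R / t) G ρ) :
    stdGaussian E (K.illSet t ∩ {f | ‖f‖ ≤ R}) ≤
      ENNReal.ofReal (√(2 * d 0) * (1 + ρ ^ 2) * (τ * √(q ^ 2 + τ ^ 2))) := by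
  have hg := gaussPeak_pos
  have h1 := K.measure_illSet_mul_le (p := 0) hV (R := R) ht hρ (s := 0) le_rfl
    (B := fiberConst d ρ q * ENNReal.ofReal (τ * √(q ^ 2 + τ ^ 2))) (fun x => by
      calc _ ≤ ∫⁻ _ : V, fiberConst d ρ q * ENNReal.ofReal (τ * √(q ^ 2 + τ ^ 2))
            ∂stdGaussian V := lintegral_mono fun v => by
              rw [hq, hτ]
              exact K.fiber_le_of_zero hV hd hD hρ (by positivity) hG hGR x v
        _ = _ := by simp)
  rw [fiberConst] at h1
  refine (le_of_mul_ofReal_le (coneConst_pos _ hρ) one_pos (ballVol_ne_zero _)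
    (ballVol_ne_top _) (by positivity) (by positivity) (by simp) h1).trans
    (ENNReal.ofReal_le_ofReal (le_of_eq ?_))
  have h3 : √((1 + ρ ^ 2) / 2) ^ 2 = (1 + ρ ^ 2) / 2 := Real.sq_sqrt (by positivity)
  have h4 : √(1 + 1 : ℝ) ^ 2 = 1 + 1 := Real.sq_sqrt (by positivity)
  have h5 : (0 : ℝ) < √(1 + 1) := by positivity
  have h6 : ∏ i : Fin (0 + 1), √(d i : ℝ) = √(d 0) := by simp
  simp only [coneConst, h6, Real.sqrt_mul zero_le_two]
  norm_num at h3 h4 h5 ⊢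
  rw [h3]
  field_simp
end EvalKernels
end TailBound

section Numerics
open EvalKernels

lemma sqrt_pow_eq {x : ℝ} (hx : 0 ≤ x) (k : ℕ) : √(x ^ k) = √x ^ k := by
  rw [Real.sqrt_eq_iff_mul_self_eq (by positivity) (by positivity), ← mul_pow,
    Real.mul_self_sqrt hx]

lemma tol_mul_sqrt_eq {D : ℕ} {g t ρ R : ℝ} (hg : 0 < g) (ht : 0 < t) (hρ : 0 < ρ)
    (hρ2 : ρ ^ 2 = 1 / (9 * g * t)) (hR : 0 < R) {q τ : ℝ}
    (hq : q = valueTol D (R / t) (g * R) ρ / ρ) (hτ : τ = derivTol D (R / t) (g * R) ρ)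
    {a b κ : ℝ} (hκ : κ = 1 + 9 / 2 * ρ * (1 + ρ * √D)) :
    q ^ 2 = 100 * (1 + ρ ^ 2) ^ D * (g * R ^ 2 / (9 * t)) ∧
    τ * √(a * q ^ 2 + b * τ ^ 2) =
      2 * κ * (1 + ρ ^ 2) ^ D * (g * R ^ 2 / (9 * t)) * √(100 * a + 4 * b * κ ^ 2) := by
  have h1 : R / t = 9 * (g * R) * ρ ^ 2 := by rw [hρ2]; field_simp
  have h2 : g * R ^ 2 / (9 * t) = (g * R * ρ) ^ 2 := by
    rw [mul_pow, hρ2]; field_simp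
  have hL : (1 + ρ ^ 2) ^ D = (√(1 + ρ ^ 2) ^ D) ^ 2 := by
    rw [← pow_mul, mul_comm D 2, pow_mul, Real.sq_sqrt (by positivity)]
  have h3 : q = 10 * (√(1 + ρ ^ 2) ^ D * (g * R * ρ)) := by
    rw [hq, valueTol, h1]; field_simp; ring
  have h4 : τ = 2 * κ * (√(1 + ρ ^ 2) ^ D * (g * R * ρ)) := by
    rw [hτ, derivTol, h1, hκ]; ring
  have h5 : 0 ≤ √(1 + ρ ^ 2) ^ D * (g * R * ρ) := by positivity
  rw [h2, hL]
  set β := √(1 + ρ ^ 2) ^ D * (g * R * ρ) with hβ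
  refine ⟨by rw [h3, hβ]; ring, ?_⟩
  rw [h3, h4, show a * (10 * β) ^ 2 + b * (2 * κ * β) ^ 2 =
    β ^ 2 * (100 * a + 4 * b * κ ^ 2) by ring, Real.sqrt_mul (by positivity), Real.sqrt_sq h5, hβ]
  ring

lemma one_add_inv_pow_le {n : ℕ} (hn : 2 ≤ n) : (1 + 1 / (n : ℝ)) ^ (n + 1) ≤ 27 / 8 := by
  obtain h | h := lt_or_ge n 6
  · interval_cases n <;> norm_num
  · have h6 : (6 : ℝ) ≤ n := by exact_mod_cast h
    have h1 : (1 + 1 / (n : ℝ)) ^ (n + 1) ≤ Real.exp (1 + 1 / 6) := by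
      calc (1 + 1 / (n : ℝ)) ^ (n + 1) ≤ Real.exp (1 / n) ^ (n + 1) := by
            gcongr
            linarith [Real.add_one_le_exp (1 / (n : ℝ))]
        _ = Real.exp (1 + 1 / n) := by
            rw [← Real.exp_nat_mul]
            congr 1
            push_cast
            field_simp
        _ ≤ _ := by gcongr
    have h2 : Real.exp (1 / 6) ≤ 6 / 5 := by
      have := Real.one_sub_le_exp_neg (1 / 6)
      rw [Real.exp_neg, le_inv_comm₀ (by norm_num) (Real.exp_pos _)] at this
      linarith
    rw [Real.exp_add] at h1
    nlinarith [Real.exp_one_lt_d9, Real.exp_pos 1, Real.exp_pos (1 / 6)]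

lemma exp_le_inv_one_sub {x : ℝ} (hx : x < 1) : Real.exp x ≤ (1 - x)⁻¹ := by
  have := Real.one_sub_le_exp_neg x
  rw [Real.exp_neg] at this
  exact (le_inv_comm₀ (by linarith) (Real.exp_pos _)).1 this

lemma one_add_pow_le_exp {x : ℝ} (hx : 0 ≤ 1 + x) (k : ℕ) : (1 + x) ^ k ≤ Real.exp (k * x) := by
  rw [Real.exp_nat_mul]
  gcongr
  linarith [Real.add_one_le_exp x]

lemma sqrt_one_add_pow_le_exp {x : ℝ} (hx : 0 ≤ 1 + x) (k : ℕ) :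
    √((1 + x) ^ k) ≤ Real.exp (k * x / 2) := by
  rw [Real.exp_half]
  exact Real.sqrt_le_sqrt (one_add_pow_le_exp hx k)

lemma sqrt_growth_le {n : ℕ} (hn : 2 ≤ n) {κ : ℝ} (hκ0 : 0 ≤ κ) (hκ : κ ≤ 1.1944) :
    √(1 + 1 / (n : ℝ)) ^ n * √n * √(100 * ((n + 1) / 2) + 4 * (64 / 25) * κ ^ 2) ≤ 13.61 * n := by
  have hn0 : (2 : ℝ) ≤ n := by exact_mod_cast hn
  have h1 := one_add_inv_pow_le hn
  set w := (1 + 1 / (n : ℝ)) ^ n with hw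
  have hw0 : 0 < w := by positivity
  have h2 : w * (n + 1) ≤ 27 / 8 * n := by
    rw [pow_succ, ← hw] at h1
    calc w * (n + 1) = w * (1 + 1 / n) * n := by field_simp
      _ ≤ _ := by gcongr
  have h3 : w ≤ 9 / 8 * n := by nlinarith
  have h4 : κ ^ 2 ≤ 1.1944 ^ 2 := by gcongr
  rw [← sqrt_pow_eq (by positivity), ← hw, ← Real.sqrt_mul (by positivity),
    ← Real.sqrt_mul (by positivity)]
  refine Real.sqrt_le_iff.2 ⟨by positivity, ?_⟩
  have h5 : w * κ ^ 2 ≤ 9 / 8 * n * 1.1944 ^ 2 := by gcongr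
  calc w * n * (100 * ((n + 1) / 2) + 4 * (64 / 25) * κ ^ 2)
      = (n : ℝ) * (50 * (w * (n + 1)) + 10.24 * (w * κ ^ 2)) := by ring
    _ ≤ (n : ℝ) * (50 * (27 / 8 * n) + 10.24 * (9 / 8 * n * 1.1944 ^ 2)) := by gcongr
    _ ≤ (13.61 * n) ^ 2 := by
      rw [mul_pow]
      nlinarith [sq_nonneg (n : ℝ)]

set_option maxHeartbeats 1000000 in
lemma tail_numeric_of_pos {p D : ℕ} {P N t ρ R q τ : ℝ} (hD : 1 ≤ D) (hP : 1 ≤ P)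
    (hN : ((p : ℝ) + 2) * (p + 3) ≤ N + 1) (ht : 13 * ((p : ℝ) + 2) ^ 2 * D * P * N < t)
    (hρ : 0 < ρ) (hρ2 : ρ ^ 2 = 1 / (9 * (D * √P / 4) * t)) (hR : 0 < R)
    (hR2 : R ^ 2 = 2 * (N + 1))
    (hq : q = valueTol D (R / t) (D * √P / 4 * R) ρ / ρ)
    (hτ : τ = derivTol D (R / t) (D * √P / 4 * R) ρ) :
    2 * (32 / 5 * gaussPeak * √P * √(1 + 1 / ((p : ℝ) + 2)) ^ (p + 2) *
        √(1 + ρ ^ 2) ^ (p + 3) * √((1 + ((p : ℝ) + 2) * q ^ 2 / 2) ^ (p + 1)) * √(p + 2) * (p + 2) *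
        (τ * √((p + 3) / 2 * q ^ 2 + 64 / 25 * τ ^ 2))) ≤
      13 * ((p : ℝ) + 2) ^ 2 * D * P * N / t := by
  have hD1 : (1 : ℝ) ≤ D := by exact_mod_cast hD
  obtain ⟨n, hn, rfl⟩ : ∃ n, 2 ≤ n ∧ n = p + 2 := ⟨p + 2, by omega, rfl⟩
  obtain ⟨n, hnp⟩ : ∃ n : ℝ, n = (p : ℝ) + 2 := ⟨_, rfl⟩
  have hn2 : 2 ≤ n := by rw [hnp]; linarith [p.cast_nonneg (α := ℝ)]
  have hp3 : (p : ℝ) + 3 = n + 1 := by rw [hnp]; ring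
  have hN5 : 5 ≤ N := by nlinarith
  have hsP : 1 ≤ √P := Real.one_le_sqrt.2 hP
  have hsP2 : √P * √P = P := Real.mul_self_sqrt (by linarith)
  have hn4 : 4 ≤ n ^ 2 := by nlinarith
  have hgp := gaussPeak_le
  have hgp0 := gaussPeak_pos
  have hD2 : (D : ℝ) ≤ D ^ 2 := by nlinarith
  rw [hp3, ← hnp] at hN ⊢
  rw [← hnp] at ht
  have ht0 : 0 < t := lt_trans (by positivity) ht
  have hr : ρ ^ 2 * (585 * n ^ 2 * D ^ 2) ≤ 4 := by
    have h1 : 585 * n ^ 2 * D ^ 2 ≤ 9 * D * √P * t := by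
      calc 585 * n ^ 2 * (D : ℝ) ^ 2 = 9 * D * 1 * (13 * n ^ 2 * D * 1 * 5) := by ring
        _ ≤ 9 * D * √P * (13 * n ^ 2 * D * P * N) := by gcongr
        _ ≤ _ := by gcongr
    calc ρ ^ 2 * (585 * n ^ 2 * D ^ 2) ≤ ρ ^ 2 * (9 * D * √P * t) := by gcongr
      _ = 4 := by rw [hρ2]; field_simp
  have hr1 : ρ ^ 2 * D ≤ 0.00171 := by
    have : ρ ^ 2 * (585 * 4 * D) ≤ ρ ^ 2 * (585 * n ^ 2 * D ^ 2) := by gcongr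
    linarith
  have hr2 : ρ ^ 2 * (2 * D + (n + 1)) ≤ 0.00856 := by
    have h1 : 4 / 5 * (2 * D + (n + 1)) ≤ n ^ 2 * D ^ 2 := by
      have : n + 3 ≤ 5 / 4 * n ^ 2 := by nlinarith
      nlinarith
    have : ρ ^ 2 * (585 * (4 / 5 * (2 * D + (n + 1)))) ≤ ρ ^ 2 * (585 * n ^ 2 * D ^ 2) := by
      rw [mul_assoc 585]
      gcongr
    linarith
  have hr3 : ρ ^ 2 ≤ 0.00171 := by nlinarith
  have hr4 : ρ ≤ 0.04136 := by nlinarith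
  have hsD : √(D : ℝ) ≤ D := Real.sqrt_le_iff.2 ⟨by positivity, hD2⟩
  obtain ⟨κ, hκ⟩ : ∃ κ, κ = 1 + 9 / 2 * ρ * (1 + ρ * √D) := ⟨_, rfl⟩
  have hκ0 : 0 ≤ κ := by rw [hκ]; positivity
  have hκ1 : κ ≤ 1.1944 := by
    have : ρ ^ 2 * √D ≤ ρ ^ 2 * D := by gcongr
    rw [hκ]; nlinarith
  obtain ⟨hq2, hT⟩ := tol_mul_sqrt_eq (by positivity) ht0 hρ hρ2 hR hq hτ
    (a := (n + 1) / 2) (b := 64 / 25) hκ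
  have hK : N + 1 ≤ 6 / 5 * N := by linarith
  have hβ : D * √P / 4 * R ^ 2 / (9 * t) = D * √P * (N + 1) / (18 * t) := by
    rw [hR2]; field_simp; ring
  rw [hβ] at hq2 hT
  have hLD : (1 + ρ ^ 2) ^ D ≤ 1.002 := by
    refine (one_add_pow_le_exp (by positivity) D).trans ((exp_le_inv_one_sub (by linarith)).trans ?_)
    rw [inv_le_comm₀ (by linarith) (by norm_num)]
    norm_num
    linarith
  have hqn : n ^ 2 * q ^ 2 ≤ 0.515 := by
    have h1 : n ^ 2 * (D * √P * (N + 1) / (18 * t)) ≤ 1 / 195 := by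
      rw [← mul_div_assoc, div_le_iff₀ (by positivity)]
      calc n ^ 2 * (D * √P * (N + 1)) ≤ n ^ 2 * (D * P * (6 / 5 * N)) := by
            have : √P ≤ P := by nlinarith
            gcongr
        _ = 6 / 65 * (13 * n ^ 2 * D * P * N) := by ring
        _ ≤ 6 / 65 * t := by gcongr
        _ = _ := by ring
    calc n ^ 2 * q ^ 2 = 100 * (1 + ρ ^ 2) ^ D * (n ^ 2 * (D * √P * (N + 1) / (18 * t))) := by
          rw [hq2]; ring
      _ ≤ 100 * 1.002 * (1 / 195) := by gcongr
      _ ≤ _ := by norm_num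
  have hexp : √(1 + ρ ^ 2) ^ (p + 3) * √((1 + n * q ^ 2 / 2) ^ (p + 1)) * (1 + ρ ^ 2) ^ D ≤
      1.154 := by
    have e1 : √(1 + ρ ^ 2) ^ (p + 3) ≤ Real.exp ((p + 3 : ℕ) * ρ ^ 2 / 2) := by
      rw [← sqrt_pow_eq (by positivity)]
      exact sqrt_one_add_pow_le_exp (by positivity) _
    have e2 := sqrt_one_add_pow_le_exp (x := n * q ^ 2 / 2) (by positivity) (p + 1)
    have e3 := one_add_pow_le_exp (x := ρ ^ 2) (by positivity) D
    have e4 : ((p + 3 : ℕ) * ρ ^ 2 / 2 + (p + 1 : ℕ) * (n * q ^ 2 / 2) / 2 + D * ρ ^ 2) ≤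
        0.1331 := by
      have hp : ((p + 1 : ℕ) : ℝ) ≤ n := by rw [hnp]; push_cast; linarith
      have hp' : ((p + 3 : ℕ) : ℝ) = n + 1 := by rw [hnp]; push_cast; ring
      have : (p + 1 : ℕ) * (n * q ^ 2 / 2) / 2 ≤ n * (n * q ^ 2 / 2) / 2 := by gcongr
      rw [hp']
      nlinarith
    calc _ ≤ Real.exp ((p + 3 : ℕ) * ρ ^ 2 / 2) * Real.exp ((p + 1 : ℕ) * (n * q ^ 2 / 2) / 2) *
          Real.exp (D * ρ ^ 2) := by gcongr
      _ = Real.exp ((p + 3 : ℕ) * ρ ^ 2 / 2 + (p + 1 : ℕ) * (n * q ^ 2 / 2) / 2 + D * ρ ^ 2) := by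
          rw [Real.exp_add, Real.exp_add]
      _ ≤ Real.exp 0.1331 := by gcongr
      _ ≤ (1 - 0.1331)⁻¹ := exp_le_inv_one_sub (by norm_num)
      _ ≤ 1.154 := by norm_num
  have hs := sqrt_growth_le hn hκ0 hκ1
  push_cast at hs
  rw [← hnp] at hs
  rw [hT]
  set X := √(1 + ρ ^ 2) ^ (p + 3) * √((1 + n * q ^ 2 / 2) ^ (p + 1)) * (1 + ρ ^ 2) ^ D
  set Y := √(1 + 1 / n) ^ (p + 2) * √n * √(100 * ((n + 1) / 2) + 4 * (64 / 25) * κ ^ 2)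
  have hX : 0 ≤ X := by positivity
  have hY : 0 ≤ Y := by positivity
  calc _ = 64 / 45 * gaussPeak * κ * X * Y * n * (D * (√P * √P) * (N + 1)) / t := by
        simp only [X, Y]
        generalize √(1 + 1 / n) ^ (p + 2) = a
        generalize √(1 + ρ ^ 2) ^ (p + 3) = b
        generalize √((1 + n * q ^ 2 / 2) ^ (p + 1)) = c
        generalize √(100 * ((n + 1) / 2) + 4 * (64 / 25) * κ ^ 2) = e
        generalize √n = f
        generalize (1 + ρ ^ 2) ^ D = h
        ring
    _ ≤ 64 / 45 * 0.399 * 1.1944 * 1.154 * (13.61 * n) * n * (D * (√P * √P) * (6 / 5 * N)) / t := by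
        gcongr
    _ = (64 / 45 * 0.399 * 1.1944 * 1.154 * 13.61 * (6 / 5)) * (n ^ 2 * D * P * N) / t := by
        rw [hsP2]; ring
    _ ≤ 13 * (n ^ 2 * D * P * N) / t := by gcongr; norm_num
    _ = _ := by ring

lemma tail_numeric_of_zero {D : ℕ} {t : ℝ} (hD : 1 ≤ D) (ht : 13 * (D : ℝ) ^ 3 < t) :
    ∃ g : ℝ, 0 < g ∧ ((D - 1 : ℕ) : ℝ) / 2 ≤ g ^ 2 ∧ ∀ ρ R q τ : ℝ, 0 < ρ →
      ρ ^ 2 = 1 / (9 * g * t) → 0 < R → R ^ 2 = 2 * (D + 1) →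
      q = valueTol D (R / t) (g * R) ρ / ρ → τ = derivTol D (R / t) (g * R) ρ →
      2 * (√(2 * D) * (1 + ρ ^ 2) * (τ * √(q ^ 2 + τ ^ 2))) ≤ 13 * (D : ℝ) ^ 3 / t := by
  have ht0 : 0 < t := lt_of_le_of_lt (by positivity) ht
  have key : ∀ {g ρ R q τ : ℝ}, 0 < g → 0 < ρ →
      ρ ^ 2 = 1 / (9 * g * t) → 0 < R → R ^ 2 = 2 * (D + 1) →
      q = valueTol D (R / t) (g * R) ρ / ρ → τ = derivTol D (R / t) (g * R) ρ →
      2 * (√(2 * D) * (1 + ρ ^ 2) * (τ * √(q ^ 2 + τ ^ 2))) =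
        8 / 9 * (√2 * √D) * g * (D + 1) * (1 + ρ ^ 2) ^ (D + 1) *
          ((1 + 9 / 2 * ρ * (1 + ρ * √D)) *
            √(100 + 4 * (1 + 9 / 2 * ρ * (1 + ρ * √D)) ^ 2)) / t := by
    intro g ρ R q τ hg hρ hρ2 hR hR2 hq hτ
    have h := (tol_mul_sqrt_eq hg ht0 hρ hρ2 hR hq hτ (a := 1) (b := 1) rfl).2
    rw [one_mul, one_mul, mul_one, mul_one, hR2] at h
    rw [h, Real.sqrt_mul zero_le_two, pow_succ]
    field_simp
    ring
  have hs2 : √2 ≤ 1.4143 := Real.sqrt_le_iff.2 ⟨by norm_num, by norm_num⟩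
  obtain rfl | hD2 : D = 1 ∨ 2 ≤ D := by omega
  · refine ⟨1 / 8, by norm_num, by norm_num, fun ρ R q τ hρ hρ2 hR hR2 hq hτ => ?_⟩
    rw [key (by norm_num) hρ hρ2 hR hR2 hq hτ]
    have h1 : ρ ^ 2 ≤ 0.0684 := by
      rw [hρ2, div_le_iff₀ (by positivity)]
      norm_num at ht ⊢
      linarith
    have h2 : ρ ≤ 0.2616 := by nlinarith
    simp only [Nat.cast_one, Real.sqrt_one, mul_one, one_pow]
    have h3 : 1 + 9 / 2 * ρ * (1 + ρ) ≤ 2.4852 := by nlinarith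
    have h4 : √(100 + 4 * (1 + 9 / 2 * ρ * (1 + ρ)) ^ 2) ≤ 11.17 := by
      refine Real.sqrt_le_iff.2 ⟨by norm_num, ?_⟩
      have : (1 + 9 / 2 * ρ * (1 + ρ)) ^ 2 ≤ 2.4852 ^ 2 := by gcongr
      norm_num at this ⊢
      linarith
    calc _ ≤ 8 / 9 * 1.4143 * (1 / 8) * (1 + 1) * (1 + 0.0684) ^ (1 + 1) *
          (2.4852 * 11.17) / t := by gcongr
      _ ≤ 13 / t := by gcongr; norm_num
  · have hDr : (2 : ℝ) ≤ D := by exact_mod_cast hD2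
    have hs1 : 1 ≤ √(D : ℝ) := Real.one_le_sqrt.2 (by linarith)
    have hss : √(D : ℝ) * √D = D := Real.mul_self_sqrt (by positivity)
    refine ⟨D * √D / 4, by positivity, ?_, fun ρ R q τ hρ hρ2 hR hR2 hq hτ => ?_⟩
    · rw [Nat.cast_sub hD]
      have e : (D * √D / 4) ^ 2 = (D : ℝ) ^ 3 / 16 := by
        rw [div_pow, mul_pow, sq √(D : ℝ), hss]; ring
      rw [e]
      push_cast
      nlinarith [mul_nonneg (sub_nonneg.2 hDr) (by nlinarith : (0 : ℝ) ≤ D ^ 2 + 2 * D - 4)]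
    · rw [key (by positivity) hρ hρ2 hR hR2 hq hτ]
      have ht1 : 104 ≤ t := by
        have : (2 : ℝ) ^ 3 ≤ D ^ 3 := by gcongr
        linarith
      have h1 : ρ ^ 2 * D ≤ 0.0043 := by
        have e : ρ ^ 2 * (9 * D * √D * t) = 4 := by rw [hρ2]; field_simp
        have : ρ ^ 2 * (9 * D * 1 * 104) ≤ ρ ^ 2 * (9 * D * √D * t) := by gcongr
        linarith
      have h2 : ρ ^ 2 ≤ 0.00215 := by nlinarith
      have h3 : ρ ≤ 0.0656 := by nlinarith
      have hsD : √(D : ℝ) ≤ D := Real.sqrt_le_iff.2 ⟨by positivity, by nlinarith⟩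
      have h5 : 1 + 9 / 2 * ρ * (1 + ρ * √D) ≤ 1.315 := by
        have : ρ ^ 2 * √D ≤ ρ ^ 2 * D := by gcongr
        nlinarith
      have h4 : √(100 + 4 * (1 + 9 / 2 * ρ * (1 + ρ * √D)) ^ 2) ≤ 10.35 := by
        refine Real.sqrt_le_iff.2 ⟨by norm_num, ?_⟩
        have : (1 + 9 / 2 * ρ * (1 + ρ * √D)) ^ 2 ≤ 1.315 ^ 2 := by gcongr
        norm_num at this ⊢
        linarith
      have h6 : (1 + ρ ^ 2) ^ (D + 1) ≤ 1.01 := by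
        have h7 : ((D + 1 : ℕ) : ℝ) * ρ ^ 2 ≤ 0.0065 := by push_cast; nlinarith
        refine (one_add_pow_le_exp (by positivity) (D + 1)).trans
          ((exp_le_inv_one_sub (by linarith)).trans ?_)
        rw [inv_le_comm₀ (by linarith) (by norm_num)]
        norm_num at h7 ⊢
        linarith
      calc _ = 2 / 9 * √2 * ((√D * √D) * D) * (D + 1) * (1 + ρ ^ 2) ^ (D + 1) *
          ((1 + 9 / 2 * ρ * (1 + ρ * √D)) *
            √(100 + 4 * (1 + 9 / 2 * ρ * (1 + ρ * √D)) ^ 2)) / t := by ring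
        _ ≤ 2 / 9 * 1.4143 * (D * D) * (3 / 2 * D) * 1.01 * (1.315 * 10.35) / t := by
          rw [hss]
          gcongr
          linarith
        _ = (2 / 9 * 1.4143 * (3 / 2) * 1.01 * (1.315 * 10.35)) * (D : ℝ) ^ 3 / t := by ring
        _ ≤ _ := by gcongr; norm_num

end Numerics

section Assembly
open ProbabilityTheory

lemma succ_le_choose_add {n m : ℕ} (hm : 1 ≤ m) : n + 1 ≤ Nat.choose (m + n) n :=
  calc n + 1 = Nat.choose (1 + n) n := by rw [add_comm 1 n, Nat.choose_succ_self_right]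
    _ ≤ _ := Nat.choose_le_choose n (by omega)

lemma two_mul_stdGaussian_illSet_le {n : ℕ} (hn : 1 ≤ n) {d : Fin n → ℕ} (hd : ∀ i, 1 ≤ d i)
    {N : ℕ} (hN : N + 1 = ∑ i, Nat.choose (d i + n) n) {E V : Type*} [NormedAddCommGroup E]
    [InnerProductSpace ℝ E] [FiniteDimensional ℝ E] [MeasurableSpace E] [BorelSpace E]
    [NormedAddCommGroup V] [InnerProductSpace ℝ V] [FiniteDimensional ℝ V] [MeasurableSpace V]
    [BorelSpace V] (hV : Module.finrank ℝ V = n + 1) (K : EvalKernels d E V) {t : ℝ}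
    (ht : 13 * n ^ 2 * ((Finset.univ.sup d : ℕ) : ℝ) * (∏ i, (d i : ℝ)) * N < t) :
    2 * stdGaussian E (K.illSet t ∩ {f | ‖f‖ ≤ √(2 * ((N + 1 : ℕ) : ℝ))}) ≤ ENNReal.ofReal
      (13 * n ^ 2 * ((Finset.univ.sup d : ℕ) : ℝ) * (∏ i, (d i : ℝ)) * N / t) := by
  have ht0 : 0 < t := lt_of_le_of_lt (by positivity) ht
  have hR : 0 < √(2 * ((N + 1 : ℕ) : ℝ)) := by positivity
  have hR2 : √(2 * ((N + 1 : ℕ) : ℝ)) ^ 2 = 2 * (N + 1) := by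
    rw [Real.sq_sqrt (by positivity)]; push_cast; ring
  have hD : ∀ i, d i ≤ Finset.univ.sup d := fun i => Finset.le_sup (Finset.mem_univ i)
  have hD1 : 1 ≤ Finset.univ.sup d := (hd ⟨0, hn⟩).trans (hD _)
  have two_mul_ofReal : ∀ x : ℝ, 2 * ENNReal.ofReal x = ENNReal.ofReal (2 * x) := fun x => by
    rw [ENNReal.ofReal_mul zero_le_two, ENNReal.ofReal_ofNat]
  set R := √(2 * ((N + 1 : ℕ) : ℝ))
  obtain rfl | ⟨p, rfl⟩ : n = 1 ∨ ∃ p, n = p + 2 := by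
    obtain h | h := Nat.lt_or_ge n 2
    · exact Or.inl (by omega)
    · exact Or.inr ⟨n - 2, by omega⟩
  · have hDd : Finset.univ.sup d = d 0 := by simp
    have hNd : N = d 0 := by simpa using hN
    have hC : 13 * ((1 : ℕ) : ℝ) ^ 2 * ((Finset.univ.sup d : ℕ) : ℝ) * (∏ i, (d i : ℝ)) * N =
        13 * (d 0 : ℝ) ^ 3 := by
      rw [hDd, hNd]; simp; ring
    rw [hC] at ht ⊢
    obtain ⟨g, hg, hgD, h⟩ := tail_numeric_of_zero (hd 0) ht
    have hρ : 0 < √(1 / (9 * g * t)) := by positivity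
    refine (mul_le_mul_right (K.stdGaussian_illSet_le_of_zero hV hd (D := d 0) (G := g * R)
      (fun i => by rw [Subsingleton.elim i 0]) hρ hR ht0 (by positivity)
      (by rw [mul_pow]; gcongr) rfl rfl) 2).trans ?_
    rw [two_mul_ofReal]
    refine ENNReal.ofReal_le_ofReal (h _ R _ _ hρ (Real.sq_sqrt (by positivity)) hR ?_ rfl rfl)
    rw [hR2, hNd]
  · set D := Finset.univ.sup d
    have hP1 : ∀ i, (d i : ℝ) ≤ ∏ i, (d i : ℝ) := fun i => by
      exact_mod_cast Finset.single_le_prod' (fun i _ => hd i) (Finset.mem_univ i)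
    have hP0 : (1 : ℝ) ≤ ∏ i, (d i : ℝ) := by
      exact_mod_cast Finset.one_le_prod' (fun i _ => hd i)
    have hDP : (D : ℝ) ≤ ∏ i, (d i : ℝ) := by
      obtain ⟨i, -, hi⟩ := Finset.exists_mem_eq_sup Finset.univ Finset.univ_nonempty d
      rw [show D = d i from hi]
      exact hP1 i
    have hsP : ∏ i, √(d i : ℝ) = √(∏ i, (d i : ℝ)) := by
      rw [eq_comm, Real.sqrt_eq_iff_mul_self_eq (by positivity) (by positivity), ← Finset.prod_mul_distrib]
      simp
    have hNn : ((p : ℝ) + 2) * (p + 3) ≤ N + 1 := by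
      have : (p + 2) * (p + 3) ≤ N + 1 := by
        rw [hN]
        calc (p + 2) * (p + 3) = ∑ _i : Fin (p + 2), (p + 2 + 1) := by simp
          _ ≤ _ := Finset.sum_le_sum fun i _ => succ_le_choose_add (hd i)
      exact_mod_cast this
    set P := ∏ i, (d i : ℝ)
    push_cast at ht ⊢
    have hDr : (1 : ℝ) ≤ D := by exact_mod_cast hD1
    have hρ : 0 < √(1 / (9 * (D * √P / 4) * t)) := by positivity
    refine (mul_le_mul_right (K.stdGaussian_illSet_le_of_pos hV hd (D := D) (G := D * √P / 4 * R)
      hD hρ hR ht0 (by positivity) ?_ rfl rfl) 2).trans ?_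
    · rw [mul_pow]
      gcongr
      rw [div_pow, mul_pow, Real.sq_sqrt (by positivity), Nat.cast_sub hD1]
      obtain h1 | h2 : D = 1 ∨ 2 ≤ D := by omega
      · rw [h1]; norm_num; positivity
      · have hDr : (2 : ℝ) ≤ D := by exact_mod_cast h2
        have : (D : ℝ) ^ 2 * D ≤ D ^ 2 * P := by gcongr
        push_cast
        nlinarith [mul_nonneg (sub_nonneg.2 hDr) (by nlinarith : (0 : ℝ) ≤ (D : ℝ) ^ 2 + 2 * D - 4)]
    · rw [two_mul_ofReal, hsP]
      exact ENNReal.ofReal_le_ofReal (tail_numeric_of_pos hD1 hP0 hNn ht hρ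
        (Real.sq_sqrt (by positivity)) hR hR2 rfl rfl)

end Assembly

/-- **Average analysis of `κ̃`, probability tail bound.**  Identify `H_d` with
`ℝ^{N+1}` (with the Bombieri–Weyl norm) via any linear isometry `φ`; the uniform
probability distribution on `ℙ(H_d)` is realized as the normalized uniform
(surface) measure on the unit sphere `S(H_d)`.  For every `t ≥ N(4n𝒟² + 1)`:
`Prob_{g ∈ ℙ(H_d)} {κ̃(g) ≥ t} ≤ 13 n² D 𝒟 N / t`. -/
theorem average_analysis_kappa_prob {n : ℕ} (hn : 1 ≤ n) (d : Fin n → ℕ)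
    (hd : ∀ i, 1 ≤ d i) (N : ℕ) (hN : N + 1 = ∑ i, Nat.choose (d i + n) n)
    (φ : EuclideanSpace ℝ (Fin (N + 1)) →ₗ[ℝ] (Fin n → MvPolynomial (Fin (n + 1)) ℝ))
    (hφsys : ∀ v, IsSystem d (φ v))
    (hφiso : ∀ v, bwNormSys (φ v) = ‖v‖)
    (hφsurj : ∀ g, IsSystem d g → ∃ v, φ v = g)
    (t : ℝ) (ht : N * (4 * n * (∏ i, (d i : ℝ)) ^ 2 + 1) ≤ t) :
    (volume : Measure (EuclideanSpace ℝ (Fin (N + 1)))).toSphere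
        {g : Metric.sphere (0 : EuclideanSpace ℝ (Fin (N + 1))) 1 |
          ENNReal.ofReal t ≤ kappa d (φ g)} /
      (volume : Measure (EuclideanSpace ℝ (Fin (N + 1)))).toSphere Set.univ
      ≤ ENNReal.ofReal
          (13 * n ^ 2 * ((Finset.univ.sup d : ℕ) : ℝ) * (∏ i, (d i : ℝ)) * N / t) := by
  set C : ℝ := 13 * n ^ 2 * ((Finset.univ.sup d : ℕ) : ℝ) * (∏ i, (d i : ℝ)) * N with hC
  have hN1 : 1 ≤ N := by
    have := (succ_le_choose_add (n := n) (hd (⟨0, hn⟩ : Fin n))).trans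
      (Finset.single_le_sum (f := fun i => Nat.choose (d i + n) n) (fun _ _ => Nat.zero_le _)
        (Finset.mem_univ (⟨0, hn⟩ : Fin n)))
    omega
  have hC0 : 0 ≤ C := by positivity
  have ht0 : 0 < t := lt_of_lt_of_le (by positivity) ht
  obtain htC | htC := le_or_gt t C
  · calc _ ≤ (1 : ℝ≥0∞) := (ENNReal.div_le_div_right (measure_mono (Set.subset_univ _)) _).trans
          ENNReal.div_self_le_one
      _ ≤ _ := by
        rw [ENNReal.one_le_ofReal]
        exact (one_le_div ht0).2 htC
  obtain ⟨K, hke, hkd⟩ := exists_evalKernels hφsys hφiso hφsurj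
  have hlim : Filter.Tendsto (fun s => ENNReal.ofReal (C / s)) (nhdsWithin t (Set.Iio t))
      (nhds (ENNReal.ofReal (C / t))) :=
    ((ENNReal.tendsto_ofReal (tendsto_const_nhds.div Filter.tendsto_id ht0.ne'))).mono_left
      nhdsWithin_le_nhds
  refine ge_of_tendsto hlim ?_
  filter_upwards [Ioo_mem_nhdsLT htC] with s hs
  have hs0 : 0 < s := hC0.trans_lt hs.1
  calc _ ≤ (volume : Measure (EuclideanSpace ℝ (Fin (N + 1)))).toSphere
        {g | (g : EuclideanSpace ℝ (Fin (N + 1))) ∈ K.illSet s} /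
        (volume : Measure (EuclideanSpace ℝ (Fin (N + 1)))).toSphere Set.univ := by
        refine ENNReal.div_le_div_right (measure_mono fun g hg => ?_) _
        exact mem_illSet_of_lt_kappa hn hφiso K hke hkd hs0
          (((ENNReal.ofReal_lt_ofReal_iff ht0).2 hs.2).trans_le hg)
    _ ≤ 2 * ProbabilityTheory.stdGaussian _
        (K.illSet s ∩ {f | ‖f‖ ≤ √(2 * ((N + 1 : ℕ) : ℝ))}) :=
        toSphere_div_le N (K.isClosed_illSet s).measurableSet
          (fun c _ f hf => K.smul_mem_illSet hf) (by positivity)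
          (Real.sq_sqrt (by positivity)).ge
    _ ≤ _ := two_mul_stdGaussian_illSet_le hn hd hN (by simp) K hs.1
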